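/- For every 2-polymatroid ρ on a finite set E, there exist a finite simple graph G and a rational number s such that for every positive integer k, the number of k-tuples (M_1,…,M_k) of matroids on E with ρ(X) = r_{M_1}(X)+⋯+r_{M_k}(X) for all X ⊆ E equals s times the number of proper k-colorings of G. -/

import Mathlib

variable {α : Type*}

/-- `ρ` is an (integer) polymatroid on ground set `E`. -/
def IsPolymatroidOn [DecidableEq α] (E : Finset α) (ρ : Finset α → ℤ) : Prop :=
  ρ ∅ = 0 ∧
  (∀ A B : Finset α, A ⊆ B → B ⊆ E → ρ A ≤ ρ B) ∧
  (∀ A B : Finset α, A ⊆ E → B ⊆ E → ρ (A ∪ B) + ρ (A ∩ B) ≤ ρ A + ρ B)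

/-- `r` is the rank function of a matroid on `E` (matroids are exactly the
`1`-polymatroids). -/
def IsMatroidRankOn [DecidableEq α] (E : Finset α) (r : Finset α → ℤ) : Prop :=
  IsPolymatroidOn E r ∧ ∀ e ∈ E, r {e} ≤ 1

/-- `Δ_ρ^k`: the set of `k`-tuples of matroids on `E` whose rank functions sum to `ρ`.
(Matroids on `E` are recorded via their canonical extension `X ↦ r (X ∩ E)`, so that
each matroid on `E` corresponds to exactly one function.) -/
def Delta [DecidableEq α] (k : ℕ) (E : Finset α) (ρ : Finset α → ℤ) :
    Set (Fin k → Finset α → ℤ) :=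
  {M | (∀ i, IsMatroidRankOn E (M i)) ∧ (∀ i X, M i X = M i (X ∩ E)) ∧
    ∀ X ⊆ E, ρ X = ∑ i, M i X}

/-- A proper `k`-coloring of a graph. -/
def ProperColoring {V : Type*} (G : SimpleGraph V) {k : ℕ} (c : V → Fin k) : Prop :=
  ∀ u v, G.Adj u v → c u ≠ c v

section Rank

variable [DecidableEq α]

/-- Rank functions of polymatroids, defined on all finite sets. -/
structure IsPM (r : Finset α → ℤ) : Prop where
  empty : r ∅ = 0
  mono : ∀ {A B : Finset α}, A ⊆ B → r A ≤ r B
  submod : ∀ A B : Finset α, r (A ∪ B) + r (A ∩ B) ≤ r A + r B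

/-- Rank functions of matroids, defined on all finite sets. -/
structure IsRk (r : Finset α → ℤ) : Prop extends IsPM r where
  unit : ∀ e, r {e} ≤ 1

/-- The nullity of the pair `e`, `f` after contracting `X`. -/
def lam (r : Finset α → ℤ) (e f : α) (X : Finset α) : ℤ :=
  r (insert e X) + r (insert f X) - r X - r (insert e (insert f X))

/-- The local connectivity of two sets. -/
def loc (r : Finset α → ℤ) (X Y : Finset α) : ℤ := r X + r Y - r (X ∪ Y)

/-- The restriction of `r` to `S` is connected. -/
def Conn (r : Finset α → ℤ) (S : Finset α) : Prop :=
  ∀ X ⊆ S, X.Nonempty → X ≠ S → r S < r X + r (S \ X)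

/-- Contraction of a set. -/
def ctr (r : Finset α → ℤ) (A : Finset α) : Finset α → ℤ := fun X => r (X ∪ A) - r A

namespace IsPM

variable {r : Finset α → ℤ}

theorem sm (hr : IsPM r) {A B U I : Finset α} (hU : U ⊆ A ∪ B) (hI : I ⊆ A ∩ B) :
    r U + r I ≤ r A + r B := by
  have h1 := hr.submod A B
  have h2 := hr.mono hU
  have h3 := hr.mono hI
  linarith

theorem nonneg (hr : IsPM r) (A : Finset α) : 0 ≤ r A := by
  have := hr.mono (Finset.empty_subset A)
  rwa [hr.empty] at this

theorem loc_nonneg (hr : IsPM r) (X Y : Finset α) : 0 ≤ loc r X Y := by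
  have := hr.sm (Finset.Subset.refl (X ∪ Y)) (Finset.empty_subset _)
  rw [hr.empty] at this
  unfold loc; linarith

theorem loc_mono (hr : IsPM r) {X X' Y Y' : Finset α} (hX : X ⊆ X') (hY : Y ⊆ Y') :
    loc r X Y ≤ loc r X' Y' := by
  have h1 : r (X' ∪ Y) + r X ≤ r X' + r (X ∪ Y) := hr.sm (by grind) (by grind)
  have h2 : r (X' ∪ Y') + r Y ≤ r Y' + r (X' ∪ Y) := hr.sm (by grind) (by grind)
  unfold loc; linarith

/-- A separation splits the rank of every set. -/
theorem sep (hr : IsPM r) {K K' : Finset α} (h : r K + r K' ≤ r (K ∪ K')) {X Y : Finset α}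
    (hX : X ⊆ K) (hY : Y ⊆ K') : r (X ∪ Y) = r X + r Y := by
  have h1 := hr.loc_mono hX hY
  have h2 := hr.loc_nonneg X Y
  unfold loc at *; linarith

theorem ctr (hr : IsPM r) (A : Finset α) : IsPM (ctr r A) where
  empty := by simp [_root_.ctr]
  mono h := by
    have : r _ ≤ r _ := hr.mono (Finset.union_subset_union h (subset_refl A))
    simp only [_root_.ctr]; linarith
  submod X Y := by
    have : r (X ∪ Y ∪ A) + r (X ∩ Y ∪ A) ≤ r (X ∪ A) + r (Y ∪ A) :=
      hr.sm (by grind) (by grind)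
    simp only [_root_.ctr]; linarith

/-- The connected component of an element. -/
theorem exists_comp (hr : IsPM r) {S : Finset α} {f : α} (hf : f ∈ S) :
    ∃ K ⊆ S, f ∈ K ∧ Conn r K ∧ r K + r (S \ K) ≤ r S := by
  classical
  let C := S.powerset.filter (fun K => f ∈ K ∧ r K + r (S \ K) ≤ r S)
  have hC : C.Nonempty := ⟨S, by simp [C, hf, hr.empty]⟩
  obtain ⟨K, hK, hmin⟩ := C.exists_min_image Finset.card hC
  simp only [C, Finset.mem_filter, Finset.mem_powerset] at hK hmin
  obtain ⟨hKS, hfK, hsep⟩ := hK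
  refine ⟨K, hKS, hfK, ?_, hsep⟩
  have key : ∀ X ⊆ K, f ∈ X → X ≠ K → r K < r X + r (K \ X) := by
    intro X hX hfX hne
    by_contra hcon
    push Not at hcon
    have h1 : r (S \ X) + r ∅ ≤ r (K \ X) + r (S \ K) := hr.sm (by grind) (by grind)
    rw [hr.empty] at h1
    have h2 := hmin X ⟨hX.trans hKS, hfX, by linarith⟩
    have h3 := Finset.card_lt_card (Finset.ssubset_iff_subset_ne.2 ⟨hX, hne⟩)
    omega
  intro X hX hne hneq
  by_cases hfX : f ∈ X
  · exact key X hX hfX hneq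
  · have := key (K \ X) Finset.sdiff_subset (by simp [hfK, hfX]) (by
      intro h; obtain ⟨x, hx⟩ := hne
      have := hX hx
      rw [← h] at this; simp [hx] at this)
    rw [Finset.sdiff_sdiff_eq_self hX] at this
    linarith

end IsPM

theorem lam_ctr (r : Finset α → ℤ) (A X : Finset α) (e f : α) :
    lam (ctr r A) e f X = lam r e f (X ∪ A) := by
  simp only [lam, ctr, Finset.insert_union]; ring

theorem lam_comm (r : Finset α → ℤ) (e f : α) (X : Finset α) : lam r e f X = lam r f e X := by
  unfold lam; rw [Finset.insert_comm e f X]; ring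

theorem loc_comm (r : Finset α → ℤ) (X Y : Finset α) : loc r X Y = loc r Y X := by
  unfold loc; rw [Finset.union_comm]; ring

theorem Conn.congr {r r' : Finset α → ℤ} {S : Finset α} (h : Conn r S)
    (hrr : ∀ X ⊆ S, r X = r' X) : Conn r' S := by
  intro X hX h1 h2
  rw [← hrr S subset_rfl, ← hrr X hX, ← hrr _ Finset.sdiff_subset]
  exact h X hX h1 h2

/-- A connected set lies on one side of every separation. -/
theorem Conn.subset_of_sep {r : Finset α → ℤ} {S K : Finset α} (h : Conn r S)
    (hsep : r (S ∩ K) + r (S \ K) ≤ r S) {e : α} (he : e ∈ S) (heK : e ∈ K) : S ⊆ K := by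
  by_contra hcon
  have h1 := h (S ∩ K) Finset.inter_subset_left ⟨e, by simp [he, heK]⟩
    (fun h => hcon (Finset.inter_eq_left.1 h))
  have : S \ (S ∩ K) = S \ K := by grind
  rw [this] at h1
  linarith

theorem Conn.lt {r : Finset α → ℤ} {S X Y : Finset α} (h : Conn r S) (hX : X.Nonempty)
    (hY : Y.Nonempty) (hd : Disjoint X Y) (hS : X ∪ Y = S) : r S < r X + r Y := by
  subst hS
  have h1 := h X Finset.subset_union_left hX (fun h => by
    obtain ⟨y, hy⟩ := hY
    exact Finset.disjoint_left.1 hd (h ▸ Finset.mem_union_right _ hy) hy)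
  rwa [Finset.union_sdiff_cancel_left hd] at h1

theorem conn_iff {r : Finset α → ℤ} {S : Finset α} : Conn r S ↔ ∀ X Y, X.Nonempty → Y.Nonempty →
    Disjoint X Y → X ∪ Y = S → r S < r X + r Y := by
  refine ⟨fun h X Y hX hY hd hS => h.lt hX hY hd hS, fun h X hX h1 h2 => ?_⟩
  refine h X (S \ X) h1 ?_ Finset.disjoint_sdiff (Finset.union_sdiff_of_subset hX)
  exact Finset.sdiff_nonempty.2 fun h3 => h2 (hX.antisymm h3)

theorem conn_singleton (r : Finset α → ℤ) (e : α) : Conn r {e} := by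
  intro X hX h1 h2
  exact absurd (h1.subset_singleton_iff.1 hX) h2

namespace IsRk

variable {r : Finset α → ℤ}

theorem step (hr : IsRk r) (e : α) (X : Finset α) : r (insert e X) ≤ r X + 1 := by
  have h1 : r (insert e X) + r ∅ ≤ r {e} + r X := hr.sm (by grind) (by grind)
  have h2 := hr.unit e
  rw [hr.empty] at h1
  linarith

theorem le_card (hr : IsRk r) (X : Finset α) : r X ≤ X.card := by
  induction X using Finset.induction_on with
  | empty => simp [hr.empty]
  | insert a X ha ih =>
    have := hr.step a X
    rw [Finset.card_insert_of_notMem ha]; push_cast; linarith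

theorem ctr (hr : IsRk r) (A : Finset α) : IsRk (ctr r A) where
  toIsPM := hr.toIsPM.ctr A
  unit e := by
    have := hr.step e A
    simp only [_root_.ctr, Finset.singleton_union]; linarith

theorem pos (hr : IsRk r) {S : Finset α} (h : Conn r S) (h2 : 2 ≤ S.card) {e : α}
    (he : e ∈ S) : r {e} = 1 ∧ r (S.erase e) = r S := by
  have h1 : r S < r {e} + r (S.erase e) := h.lt (by simp) (by
    rw [← Finset.card_pos, Finset.card_erase_of_mem he]; omega) (by simp) (by grind)
  have h3 := hr.mono (Finset.erase_subset e S)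
  have h4 := hr.unit e
  constructor <;> linarith

end IsRk

theorem IsPM.inc {r : Finset α → ℤ} (hr : IsPM r) {X Y : Finset α} (h : X ⊆ Y) (e : α) :
    r (insert e Y) + r X ≤ r Y + r (insert e X) := hr.sm (by grind) (by grind)

/-- Elements that are coloops of `Z` contribute one each. -/
theorem IsPM.peel {r : Finset α → ℤ} (hr : IsPM r) {X Z : Finset α} (hX : X ⊆ Z)
    (h : ∀ g ∈ X, r (Z.erase g) < r Z) : r (Z \ X) + X.card ≤ r Z := by
  induction X using Finset.induction_on with
  | empty => simp
  | insert a X ha ih =>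
    have h1 := ih (fun x hx => hX (by simp [hx])) (fun g hg => h g (by simp [hg]))
    have h2 := h a (by simp)
    have h3 : r Z + r (Z \ insert a X) ≤ r (Z.erase a) + r (Z \ X) := hr.sm (by grind) (by grind)
    rw [Finset.card_insert_of_notMem ha]; push_cast; linarith

theorem IsPM.closure {r : Finset α → ℤ} (hr : IsPM r) {X L : Finset α}
    (h : ∀ g ∈ L, r (insert g X) ≤ r X) : r (X ∪ L) = r X := by
  induction L using Finset.induction_on with
  | empty => simp
  | insert a L ha ih =>
    have h1 := ih (fun g hg => h g (by simp [hg]))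
    have h2 := h a (by simp)
    have h3 := hr.inc (Finset.subset_union_left (s₁ := X) (s₂ := L)) a
    have h4 := hr.mono (Finset.subset_union_left (s₁ := X) (s₂ := insert a L))
    rw [Finset.union_insert] at *
    linarith

/-- Deleting or contracting an element preserves connectedness. -/
theorem Conn.del_or_ctr {r : Finset α → ℤ} (hr : IsRk r) {S : Finset α} (h : Conn r S) {g : α}
    (hg : g ∈ S) : Conn r (S.erase g) ∨ Conn (ctr r {g}) (S.erase g) := by
  by_contra hcon
  push Not at hcon
  obtain ⟨h1, h2⟩ := hcon
  simp only [conn_iff, not_forall, not_lt] at h1 h2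
  obtain ⟨X, Y, hX, hY, hXY, hS, h1⟩ := h1
  obtain ⟨U, V, hU, hV, hUV, hS', h2⟩ := h2
  have hins : S.erase g ∪ {g} = S := by grind
  simp only [ctr, hins] at h2
  have hgu := hr.unit g
  have hmono := hr.mono (Finset.erase_subset g S)
  have key : ∀ U V : Finset α, U ∪ V = S.erase g → Disjoint U V →
      r (U ∪ {g}) - r {g} + (r (V ∪ {g}) - r {g}) ≤ r S - r {g} →
      (X ∩ U).Nonempty → (Y ∩ V).Nonempty → False := by
    intro U V hS' hUV h2 n1 n2
    have a1 := h.lt n1 (Y := S \ (X ∩ U)) (n2.mono (by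
      intro x hx
      have := Finset.disjoint_left.1 hXY; grind)) Finset.disjoint_sdiff (by grind)
    have a2 := h.lt n2 (Y := S \ (Y ∩ V)) (n1.mono (by
      intro x hx
      have := Finset.disjoint_left.1 hXY; grind)) Finset.disjoint_sdiff (by grind)
    have b1 : r (S \ (Y ∩ V)) + r (X ∩ U) ≤ r X + r (U ∪ {g}) := hr.sm (by grind) (by grind)
    have b2 : r (S \ (X ∩ U)) + r (Y ∩ V) ≤ r Y + r (V ∪ {g}) := hr.sm (by grind) (by grind)
    linarith
  have k1 := key U V hS' hUV (by linarith)
  have k2 := key V U (by rw [Finset.union_comm]; exact hS') hUV.symm (by linarith)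
  obtain ⟨x, hx⟩ := hX
  obtain ⟨y, hy⟩ := hY
  obtain ⟨u, hu⟩ := hU
  obtain ⟨v, hv⟩ := hV
  have e1 : x ∈ U ∪ V := by grind
  have e2 : y ∈ U ∪ V := by grind
  have e3 : u ∈ X ∪ Y := by grind
  have e4 : v ∈ X ∪ Y := by grind
  have m : ∀ {A B : Finset α} {z : α}, z ∈ A → z ∈ B → (A ∩ B).Nonempty :=
    fun h1 h2 => ⟨_, Finset.mem_inter.2 ⟨h1, h2⟩⟩
  rcases Finset.mem_union.1 e1 with e1 | e1 <;> rcases Finset.mem_union.1 e2 with e2 | e2 <;>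
  rcases Finset.mem_union.1 e3 with e3 | e3 <;> rcases Finset.mem_union.1 e4 with e4 | e4
  all_goals first
    | exact k1 (m hx e1) (m hy e2)
    | exact k2 (m hx e1) (m hy e2)
    | exact k1 (m e3 hu) (m e4 hv)
    | exact k2 (m e4 hv) (m e3 hu)
    | exact k1 (m hx e1) (m e4 hv)
    | exact k2 (m hx e1) (m e3 hu)
    | exact k1 (m e3 hu) (m hy e2)
    | exact k2 (m e4 hv) (m hy e2)

theorem Conn.exists_lam {r : Finset α → ℤ} (hr : IsRk r) {S : Finset α} (h : Conn r S) {e f : α}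
    (he : e ∈ S) (hf : f ∈ S) (hef : e ≠ f) : ∃ X ⊆ S, e ∉ X ∧ f ∉ X ∧ 0 < lam r e f X := by
  induction hn : S.card generalizing S r with
  | zero => simp_all
  | succ n ih =>
    by_cases hS : S = {e, f}
    · refine ⟨∅, by simp, by simp, by simp, ?_⟩
      have := h.lt (X := {e}) (Y := {f}) (by simp) (by simp) (by simpa using hef) (by rw [hS]; rfl)
      rw [hS] at this
      simp only [lam, hr.empty, insert_empty_eq]; linarith
    · obtain ⟨g, hg, hge, hgf⟩ : ∃ g ∈ S, g ≠ e ∧ g ≠ f := by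
        by_contra hcon
        push Not at hcon
        apply hS; ext x; simp only [Finset.mem_insert, Finset.mem_singleton]; grind
      have hcard : (S.erase g).card = n := by rw [Finset.card_erase_of_mem hg]; omega
      rcases h.del_or_ctr hr hg with h1 | h1
      · obtain ⟨X, hX, h2⟩ := ih hr h1 (by grind) (by grind) hcard
        exact ⟨X, by grind, h2⟩
      · obtain ⟨X, hX, h2, h3, h4⟩ := ih (hr.ctr {g}) h1 (by grind) (by grind) hcard
        rw [lam_ctr] at h4
        exact ⟨X ∪ {g}, by grind, by grind, by grind, h4⟩

/-- Contracting `X` and restricting to `e`, `f`, `g` gives a uniform matroid of rank `t`. -/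
structure Tri (r : Finset α → ℤ) (e f g : α) (X : Finset α) (t : ℤ) : Prop where
  ht : t = 1 ∨ t = 2
  he : r (insert e X) = r X + 1
  hf : r (insert f X) = r X + 1
  hg : r (insert g X) = r X + 1
  hef : r (insert e (insert f X)) = r X + t
  heg : r (insert e (insert g X)) = r X + t
  hfg : r (insert f (insert g X)) = r X + t
  hefg : r (insert e (insert f (insert g X))) = r X + t

theorem Conn.exists_tri {r : Finset α → ℤ} (hr : IsRk r) {S : Finset α} (h : Conn r S) {e f g : α}
    (he : e ∈ S) (hf : f ∈ S) (hg : g ∈ S) (hef : e ≠ f) (heg : e ≠ g) (hfg : f ≠ g) :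
    ∃ X ⊆ S, ∃ t, e ∉ X ∧ f ∉ X ∧ g ∉ X ∧ Tri r e f g X t := by
  induction hn : S.card generalizing S r with
  | zero => simp_all
  | succ n ih =>
    by_cases hS : S = {e, f, g}
    · subst hS
      have hc : ({e, f, g} : Finset α).card = 3 := by
        rw [Finset.card_eq_three]; exact ⟨e, f, g, hef, heg, hfg, rfl⟩
      refine ⟨∅, by simp, r {e, f, g}, by simp, by simp, by simp, ?_⟩
      obtain ⟨e1, e2⟩ := hr.pos h (by omega) he
      obtain ⟨f1, f2⟩ := hr.pos h (by omega) hf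
      obtain ⟨g1, g2⟩ := hr.pos h (by omega) hg
      rw [show ({e, f, g} : Finset α).erase e = {f, g} by grind] at e2
      rw [show ({e, f, g} : Finset α).erase f = {e, g} by grind] at f2
      rw [show ({e, f, g} : Finset α).erase g = {e, f} by grind] at g2
      have h1 := hr.le_card {e, f}
      rw [Finset.card_pair hef] at h1
      have h2 : r {e} ≤ r {e, f} := hr.mono (by simp)
      constructor <;> try simp only [hr.empty, insert_empty_eq, zero_add] <;> try assumption
      push_cast at h1
      omega
    · obtain ⟨z, hz, hze, hzf, hzg⟩ : ∃ z ∈ S, z ≠ e ∧ z ≠ f ∧ z ≠ g := by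
        by_contra hcon
        push Not at hcon
        apply hS; ext x; simp only [Finset.mem_insert, Finset.mem_singleton]; grind
      have hcard : (S.erase z).card = n := by rw [Finset.card_erase_of_mem hz]; omega
      rcases h.del_or_ctr hr hz with h1 | h1
      · obtain ⟨X, hX, h2⟩ := ih hr h1 (by grind) (by grind) (by grind) hcard
        exact ⟨X, by grind, h2⟩
      · obtain ⟨X, hX, t, h2, h3, h4, h5⟩ :=
          ih (hr.ctr {z}) h1 (by grind) (by grind) (by grind) hcard
        refine ⟨X ∪ {z}, by grind, t, by grind, by grind, by grind, ?_⟩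
        obtain ⟨a0, a1, a2, a3, a4, a5, a6, a7⟩ := h5
        simp only [ctr, Finset.insert_union] at a1 a2 a3 a4 a5 a6 a7
        constructor <;> first | assumption | linarith

end Rank

section Lehman

variable [DecidableEq α]

/-- Two functions with the same local connectivities between subsets of `L` and of `R`. -/
def Cross (r r' : Finset α → ℤ) (L R : Finset α) : Prop :=
  ∀ X ⊆ L, ∀ Y ⊆ R, loc r X Y = loc r' X Y

theorem Cross.symm {r r' : Finset α → ℤ} {L R : Finset α} (h : Cross r r' L R) :
    Cross r' r L R := fun X hX Y hY => (h X hX Y hY).symm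

theorem Cross.swap {r r' : Finset α → ℤ} {L R : Finset α} (h : Cross r r' L R) :
    Cross r r' R L := fun X hX Y hY => by rw [loc_comm r, loc_comm r']; exact h Y hY X hX

theorem Cross.mono {r r' : Finset α → ℤ} {L R L' R' : Finset α} (h : Cross r r' L R)
    (hL : L' ⊆ L) (hR : R' ⊆ R) : Cross r r' L' R' :=
  fun X hX Y hY => h X (hX.trans hL) Y (hY.trans hR)

theorem Cross.lam {r r' : Finset α → ℤ} {L R : Finset α} (h : Cross r r' L R) {e f : α}
    (he : e ∈ L) (hf : f ∈ R) {Z : Finset α} (hZ : Z ⊆ L ∪ R) : lam r e f Z = lam r' e f Z := by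
  have hZ' : Z = Z ∩ L ∪ Z ∩ R := by grind
  have h1 := h (insert e (Z ∩ L)) (by grind) (insert f (Z ∩ R)) (by grind)
  have h2 := h (Z ∩ L) (by grind) (insert f (Z ∩ R)) (by grind)
  have h3 := h (insert e (Z ∩ L)) (by grind) (Z ∩ R) (by grind)
  have h4 := h (Z ∩ L) (by grind) (Z ∩ R) (by grind)
  simp only [loc, Finset.insert_union, Finset.union_insert, ← hZ'] at h1 h2 h3 h4
  simp only [_root_.lam, Finset.insert_comm e f]
  linarith

theorem cross_of_lam {r r' : Finset α → ℤ} (h0 : r ∅ = 0) (h0' : r' ∅ = 0) {L R : Finset α}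
    (h : ∀ e ∈ L, ∀ f ∈ R, ∀ Z ⊆ L ∪ R, e ∉ Z → f ∉ Z → lam r e f Z = lam r' e f Z)
    (hLR : Disjoint L R) : Cross r r' L R := by
  intro X hX Y hY
  have hd := Finset.disjoint_left.1 hLR
  induction X using Finset.induction_on with
  | empty => simp [loc, h0, h0']
  | insert e X he ih =>
    have ih := ih (fun x hx => hX (by simp [hx]))
    have key : ∀ Z ⊆ Y, loc r (insert e X) Z - loc r X Z = loc r' (insert e X) Z - loc r' X Z := by
      intro Z hZ
      induction Z using Finset.induction_on with
      | empty => simp [loc, h0, h0']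
      | insert f Z hf ih2 =>
        have ih2 := ih2 (fun x hx => hZ (by simp [hx]))
        have heL : e ∈ L := hX (by simp)
        have hfR : f ∈ R := hY (hZ (by simp))
        have h1 := h e heL f hfR (X ∪ Z) (by grind) (by grind) (by grind)
        simp only [loc, lam, Finset.insert_union, Finset.union_insert] at ih2 h1 ⊢
        rw [Finset.insert_comm f e] at *
        linarith
    have := key Y subset_rfl
    linarith

theorem Cross.ctr_right {r r' : Finset α → ℤ} {L R : Finset α} (h : Cross r r' L R)
    {A : Finset α} (hA : A ⊆ R) : Cross (ctr r A) (ctr r' A) L R := by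
  intro X hX Y hY
  have h1 := h X hX (Y ∪ A) (Finset.union_subset hY hA)
  have h2 := h X hX A hA
  simp only [loc, ctr, Finset.union_assoc] at *
  linarith

theorem Cross.ctr_left {r r' : Finset α → ℤ} {L R : Finset α} (h : Cross r r' L R)
    {A : Finset α} (hA : A ⊆ L) : Cross (ctr r A) (ctr r' A) L R :=
  (h.swap.ctr_right hA).swap

theorem IsPM.lam_sep {r : Finset α → ℤ} (hr : IsPM r) {X Y : Finset α}
    (h : r X + r Y ≤ r (X ∪ Y)) {e f : α} (he : e ∈ X) (hf : f ∈ Y) {Z : Finset α}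
    (hZ : Z ⊆ X ∪ Y) : lam r e f Z = 0 := by
  have hZ' : Z = Z ∩ X ∪ Z ∩ Y := by grind
  have h1 := hr.sep h (X := insert e (Z ∩ X)) (Y := insert f (Z ∩ Y)) (by grind) (by grind)
  have h2 := hr.sep h (X := Z ∩ X) (Y := insert f (Z ∩ Y)) (by grind) (by grind)
  have h3 := hr.sep h (X := insert e (Z ∩ X)) (Y := Z ∩ Y) (by grind) (by grind)
  have h4 := hr.sep h (X := Z ∩ X) (Y := Z ∩ Y) (by grind) (by grind)
  simp only [Finset.insert_union, Finset.union_insert, ← hZ'] at h1 h2 h3 h4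
  simp only [lam, Finset.insert_comm e f]
  linarith

theorem Conn.union {r : Finset α → ℤ} (hr : IsPM r) {L R : Finset α} (hL : Conn r L)
    (hR : Conn (ctr r L) R) (hd : Disjoint L R) (hloc : r (L ∪ R) < r L + r R) :
    Conn r (L ∪ R) := by
  rw [conn_iff]
  intro X Y hX hY hXY hS
  by_contra hcon
  push Not at hcon
  rw [← hS] at hcon
  have hd' := Finset.disjoint_left.1 hd
  have hXY' := Finset.disjoint_left.1 hXY
  have hm := fun x => Finset.ext_iff.1 hS x
  simp only [Finset.mem_union] at hm
  have key : ∀ X Y : Finset α, Y.Nonempty → Disjoint X Y → X ∪ Y = L ∪ R →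
      r X + r Y ≤ r (X ∪ Y) → L ⊆ X → False := by
    intro X Y hY hXY hS hcon hLX
    have hXY' := Finset.disjoint_left.1 hXY
    have hm := fun x => Finset.ext_iff.1 hS x
    simp only [Finset.mem_union] at hm
    by_cases hX' : (X \ L).Nonempty
    · have h1 := hR.lt hX' hY (by
        rw [Finset.disjoint_left]; grind) (by ext x; grind)
      have h2 : r (Y ∪ L) + r ∅ ≤ r Y + r L := hr.sm (by grind) (by grind)
      have h3 : X \ L ∪ L = X := by grind
      simp only [ctr, h3, hr.empty, Finset.union_comm R L, ← hS] at h1 h2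
      linarith
    · have h3 : X = L := by
        rw [Finset.not_nonempty_iff_eq_empty, Finset.sdiff_eq_empty_iff_subset] at hX'
        exact hX'.antisymm hLX
      have h4 : Y = R := by ext x; grind
      rw [h3, h4] at hcon; linarith
  by_cases h1 : (X ∩ L).Nonempty <;> by_cases h2 : (Y ∩ L).Nonempty
  · have h3 := hL.lt h1 h2 (by rw [Finset.disjoint_left]; grind) (by grind)
    have h4 := hr.sep hcon (X := X ∩ L) (Y := Y ∩ L) (by grind) (by grind)
    rw [show X ∩ L ∪ Y ∩ L = L by grind] at h4
    linarith
  · refine key X Y hY hXY hS hcon ?_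
    intro x hx
    exact ((hm x).2 (.inl hx)).resolve_right fun h => h2 ⟨x, Finset.mem_inter.2 ⟨h, hx⟩⟩
  · refine key Y X hX hXY.symm (by rw [Finset.union_comm]; exact hS)
      (by rw [Finset.union_comm]; linarith) ?_
    intro x hx
    exact ((hm x).2 (.inl hx)).resolve_left fun h => h1 ⟨x, Finset.mem_inter.2 ⟨h, hx⟩⟩
  · refine key X Y hY hXY hS hcon ?_
    intro x hx
    exact ((hm x).2 (.inl hx)).resolve_right fun h => h2 ⟨x, Finset.mem_inter.2 ⟨h, hx⟩⟩

theorem Conn.insert {r : Finset α → ℤ} (hr : IsPM r) {L : Finset α} {f : α} (hL : Conn r L)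
    (hf : f ∉ L) (hloc : r (insert f L) < r L + r {f}) : Conn r (insert f L) := by
  have := hL.union hr (conn_singleton _ f) (by simpa using hf)
    (by rwa [Finset.union_comm, ← Finset.insert_eq])
  rwa [Finset.union_comm, ← Finset.insert_eq] at this

/-- Connectedness of a union depends only on the local connectivities across. -/
theorem Conn.transfer {r r' : Finset α → ℤ} (hr : IsRk r) (hr' : IsPM r') {L R : Finset α}
    (hd : Disjoint L R) (hL : L.Nonempty) (hR : R.Nonempty) (hc : Cross r r' L R)
    (h : Conn r (L ∪ R)) : Conn r' (L ∪ R) := by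
  rw [conn_iff]
  intro X Y hX hY hXY hS
  by_contra hcon
  push Not at hcon
  rw [← hS] at hcon
  have hd' := Finset.disjoint_left.1 hd
  have key : ∀ X Y : Finset α, X ∪ Y = L ∪ R → r' X + r' Y ≤ r' (X ∪ Y) →
      ∀ e ∈ X, ∀ f ∈ Y, e ∈ L → f ∈ R → False := by
    intro X Y hS hcon e he f hf heL hfR
    have hd' := Finset.disjoint_left.1 hd
    obtain ⟨Z, hZ, -, -, h1⟩ := h.exists_lam hr (e := e) (f := f) (by grind) (by grind) (by grind)
    rw [hc.lam heL hfR hZ, hr'.lam_sep hcon he hf (by rwa [hS])] at h1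
    exact lt_irrefl _ h1
  have k1 := key X Y hS hcon
  have k2 := key Y X (by rw [Finset.union_comm]; exact hS) (by rw [Finset.union_comm]; linarith)
  obtain ⟨l, hl⟩ := hL
  obtain ⟨t, ht⟩ := hR
  obtain ⟨x, hx⟩ := hX
  obtain ⟨y, hy⟩ := hY
  have hm := fun x => Finset.ext_iff.1 hS x
  simp only [Finset.mem_union] at hm
  have hlS : l ∈ X ∪ Y := by grind
  have htS : t ∈ X ∪ Y := by grind
  have hxS : x ∈ L ∪ R := by grind
  have hyS : y ∈ L ∪ R := by grind
  grind

theorem lehman_aux {r r' : Finset α → ℤ} (hr : IsRk r) (hr' : IsRk r') {L X : Finset α} {f : α}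
    (hf : f ∉ L) (hX : X ⊆ L) (hc : Cross r r' L {f}) (hf1 : r {f} = 1)
    (hf2 : r' {f} = 1) (hfL : r (insert f L) = r L) (h1 : ∀ g ∈ X, r (X.erase g) = r' (X.erase g))
    (h2 : ∀ g ∈ L, g ∉ X → r (insert g X) = r' (insert g X)) : r X ≤ r' X := by
  by_contra hcon
  push Not at hcon
  have hcl : r (X ∪ L) = r X := by
    refine hr.closure fun g hg => ?_
    by_cases hgX : g ∈ X
    · rw [Finset.insert_eq_of_mem hgX]
    · have := hr'.step g X
      rw [h2 g hg hgX]; linarith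
  rw [Finset.union_eq_right.2 hX] at hcl
  have hXf := hr.mono (Finset.insert_subset_insert f hX)
  have hcf : ∀ Y ⊆ L, r (insert f Y) - r Y = r' (insert f Y) - r' Y := by
    intro Y hY
    have := hc Y hY {f} subset_rfl
    simp only [loc, Finset.union_comm Y {f}, ← Finset.insert_eq] at this
    linarith
  have hpeel := hr.peel (Finset.subset_insert f X) (fun g hg => by
    have e1 : (insert f X).erase g = insert f (X.erase g) := by grind
    have e2 := hcf (X.erase g) (by grind)
    have e3 := hcf X hX
    have e4 := hr'.mono (Finset.insert_subset_insert f (Finset.erase_subset g X))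
    have e5 := h1 g hg
    rw [e1]; linarith)
  have e1 : insert f X \ X = {f} := by grind
  have e2 := hr.le_card X
  rw [e1] at hpeel
  linarith

/-- If `r` is connected on `L ∪ R`, the local connectivities between `L` and `R`
determine `r` on `L`. -/
theorem lehman {r r' : Finset α → ℤ} (hr : IsRk r) (hr' : IsRk r') {L R : Finset α}
    (hd : Disjoint L R) (hR : R.Nonempty) (hc : Cross r r' L R) (h : Conn r (L ∪ R)) :
    ∀ X ⊆ L, r X = r' X := by
  induction hn : (L ∪ R).card generalizing L R r r' with
  | zero =>
    have : R = ∅ := by simp_all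
    simp [this] at hR
  | succ n ih =>
    rcases L.eq_empty_or_nonempty with rfl | hL
    · intro X hX
      rw [Finset.subset_empty.1 hX, hr.empty, hr'.empty]
    have h' := h.transfer hr hr'.toIsPM hd hL hR hc
    have hd' := Finset.disjoint_left.1 hd
    obtain ⟨f, hf⟩ := hR
    have hfL : f ∉ L := fun h => hd' h hf
    by_cases hRf : R = {f}
    · subst hRf
      rw [Finset.card_union_of_disjoint hd, Finset.card_singleton] at hn
      have hLpos := Finset.card_pos.2 hL
      have hcard : 2 ≤ (L ∪ {f}).card := by
        rw [Finset.card_union_of_disjoint hd, Finset.card_singleton]; omega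
      have p1 : ∀ x ∈ L ∪ {f}, r {x} = 1 := fun x hx => (hr.pos h hcard hx).1
      have p2 : ∀ x ∈ L ∪ {f}, r' {x} = 1 := fun x hx => (hr'.pos h' hcard hx).1
      have hfe : (L ∪ {f}).erase f = L := by grind
      have q1 := (hr.pos h hcard (e := f) (by simp)).2
      have q2 := (hr'.pos h' hcard (e := f) (by simp)).2
      rw [hfe, Finset.union_comm, ← Finset.insert_eq] at q1 q2
      by_cases hL1 : L.card = 1
      · obtain ⟨e, rfl⟩ := Finset.card_eq_one.1 hL1
        intro X hX
        rcases Finset.subset_singleton_iff.1 hX with rfl | rfl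
        · rw [hr.empty, hr'.empty]
        · rw [p1 e (by simp), p2 e (by simp)]
      have key : ∀ g ∈ L, (∀ X ⊆ L, g ∉ X → r X = r' X) ∨ (∀ X ⊆ L, g ∈ X → r X = r' X) := by
        intro g hg
        have hgf : g ≠ f := by rintro rfl; exact hfL hg
        have he : (L ∪ {f}).erase g = L.erase g ∪ {f} := by grind
        have hdd : Disjoint (L.erase g) {f} := hd.mono_left (Finset.erase_subset _ _)
        have hcc : (L.erase g ∪ {f}).card = n := by
          rw [Finset.card_union_of_disjoint hdd, Finset.card_singleton,
            Finset.card_erase_of_mem hg]; omega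
        rcases h.del_or_ctr hr (g := g) (by simp [hg]) with h1 | h1
        · left
          rw [he] at h1
          intro X hX hgX
          exact ih hr hr' hdd (by simp) (hc.mono (Finset.erase_subset _ _) subset_rfl) h1 hcc X
            (by grind)
        · right
          rw [he] at h1
          intro X hX hgX
          have := ih (hr.ctr {g}) (hr'.ctr {g}) hdd (by simp)
            ((hc.ctr_left (by simpa using hg)).mono (Finset.erase_subset _ _) subset_rfl) h1 hcc
            (X.erase g) (by grind)
          have e : X.erase g ∪ {g} = X := by grind
          simp only [ctr, e] at this
          rw [p1 g (by simp [hg]), p2 g (by simp [hg])] at this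
          linarith
      intro X hX
      by_contra hne
      have k1 : ∀ g ∈ X, ∀ Y ⊆ L, g ∉ Y → r Y = r' Y := fun g hg =>
        (key g (hX hg)).resolve_right fun h => hne (h X hX hg)
      have k2 : ∀ g ∈ L, g ∉ X → ∀ Y ⊆ L, g ∈ Y → r Y = r' Y := fun g hgL hg =>
        (key g hgL).resolve_left fun h => hne (h X hX hg)
      have l1 := lehman_aux hr hr' hfL hX hc (p1 f (by simp)) (p2 f (by simp)) q1.symm
        (fun g hg => k1 g hg _ (by grind) (by grind))
        (fun g hgL hg => k2 g hgL hg _ (by grind) (by grind))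
      have l2 := lehman_aux hr' hr hfL hX hc.symm (p2 f (by simp)) (p1 f (by simp)) q2.symm
        (fun g hg => (k1 g hg _ (by grind) (by grind)).symm)
        (fun g hgL hg => (k2 g hgL hg _ (by grind) (by grind)).symm)
      exact hne (le_antisymm l1 l2)
    · have he : (L ∪ R).erase f = L ∪ R.erase f := by grind
      have hdd : Disjoint L (R.erase f) := hd.mono_right (Finset.erase_subset _ _)
      have hcc : (L ∪ R.erase f).card = n := by
        rw [← he, Finset.card_erase_of_mem (by simp [hf])]; omega
      have hne : (R.erase f).Nonempty := by
        rw [Finset.nonempty_iff_ne_empty]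
        intro h0
        exact hRf ((Finset.insert_erase hf).symm.trans (by rw [h0]; rfl))
      rcases h.del_or_ctr hr (g := f) (by simp [hf]) with h1 | h1
      · rw [he] at h1
        exact ih hr hr' hdd hne (hc.mono subset_rfl (Finset.erase_subset _ _)) h1 hcc
      · rw [he] at h1
        intro X hX
        have h2 := ih (hr.ctr {f}) (hr'.ctr {f}) hdd hne
            ((hc.ctr_right (by simpa using hf)).mono subset_rfl (Finset.erase_subset _ _)) h1 hcc
            X hX
        have h3 := hc X hX {f} (by simpa using hf)
        simp only [ctr, loc] at h2 h3
        linarith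

end Lehman

section Exch

variable [DecidableEq α]

theorem Cross.eq_of_conn {r r' : Finset α → ℤ} (hr : IsRk r) (hr' : IsRk r') {L R : Finset α}
    (hd : Disjoint L R) (hL : L.Nonempty) (hR : R.Nonempty) (hc : Cross r r' L R)
    (h : Conn r (L ∪ R)) : ∀ X ⊆ L ∪ R, r X = r' X := by
  intro X hX
  have h1 := lehman hr hr' hd hR hc h (X ∩ L) Finset.inter_subset_right
  have h2 := lehman hr hr' hd.symm hL hc.swap (by rwa [Finset.union_comm]) (X ∩ R)
    Finset.inter_subset_right
  have h3 := hc (X ∩ L) Finset.inter_subset_right (X ∩ R) Finset.inter_subset_right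
  rw [loc, loc, show X ∩ L ∪ X ∩ R = X by grind] at h3
  linarith

theorem loc_ctr (r : Finset α → ℤ) (X Y Z : Finset α) :
    loc (ctr r Z) X Y = loc r X (Y ∪ Z) - loc r X Z := by
  simp only [loc, ctr, Finset.union_assoc]; ring

theorem IsRk.loc_step {r : Finset α → ℤ} (hr : IsRk r) (L Z : Finset α) (f : α) :
    loc r L (insert f Z) ≤ loc r L Z + 1 := by
  have h1 := hr.step f Z
  have h2 : r (L ∪ Z) ≤ r (L ∪ insert f Z) := hr.mono (by grind)
  simp only [loc]; linarith

theorem IsPM.exists_step {r : Finset α → ℤ} (hr : IsPM r) {L Z R : Finset α} (hZ : Z ⊆ R)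
    (h0 : loc r L Z = 0) (h1 : 0 < loc r L R) : ∃ Y, Z ⊆ Y ∧ Y ⊆ R ∧ loc r L Y = 0 ∧
      ∃ f ∈ R, f ∉ Y ∧ 0 < loc r L (insert f Y) := by
  let C := R.powerset.filter (fun Y => Z ⊆ Y ∧ loc r L Y = 0)
  obtain ⟨Y, hY, hmax⟩ := C.exists_max_image Finset.card ⟨Z, by simp [C, hZ, h0]⟩
  simp only [C, Finset.mem_filter, Finset.mem_powerset] at hY hmax
  obtain ⟨hYR, hZY, hY0⟩ := hY
  refine ⟨Y, hZY, hYR, hY0, ?_⟩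
  obtain ⟨f, hf, hfY⟩ : ∃ f ∈ R, f ∉ Y := by
    by_contra hcon
    push Not at hcon
    rw [hYR.antisymm hcon] at hY0
    linarith
  refine ⟨f, hf, hfY, lt_of_le_of_ne (hr.loc_nonneg _ _) fun h => ?_⟩
  have := hmax (insert f Y) ⟨Finset.insert_subset hf hYR, hZY.trans (Finset.subset_insert _ _),
    h.symm⟩
  rw [Finset.card_insert_of_notMem hfY] at this
  omega

/-- Two expressions of one polymatroid on `L ∪ R` as a sum of two matroids,
where one of the matroids is separated by `L`, `R`. -/
structure Exch (A B M N : Finset α → ℤ) (L R : Finset α) : Prop where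
  rA : IsRk A
  rB : IsRk B
  rM : IsRk M
  rN : IsRk N
  disj : Disjoint L R
  sum : ∀ X ⊆ L ∪ R, A X + B X = M X + N X
  sep : B L + B R ≤ B (L ∪ R)

namespace Exch

variable {A B M N : Finset α → ℤ} {L R : Finset α}

theorem swap (h : Exch A B M N L R) : Exch A B N M L R :=
  ⟨h.rA, h.rB, h.rN, h.rM, h.disj, fun X hX => by rw [h.sum X hX, add_comm], h.sep⟩

theorem symm (h : Exch A B M N L R) : Exch A B M N R L :=
  ⟨h.rA, h.rB, h.rM, h.rN, h.disj.symm, fun X hX => h.sum X (by rwa [Finset.union_comm]), by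
    rw [Finset.union_comm, add_comm]; exact h.sep⟩

theorem locB (h : Exch A B M N L R) {Y Z : Finset α} (hY : Y ⊆ L) (hZ : Z ⊆ R) :
    B (Y ∪ Z) = B Y + B Z := h.rB.sep h.sep hY hZ

theorem loc_sum (h : Exch A B M N L R) {Y Z : Finset α} (hY : Y ⊆ L) (hZ : Z ⊆ R) :
    loc A Y Z = loc M Y Z + loc N Y Z := by
  have h1 := h.locB hY hZ
  have h2 := h.sum Y (by grind)
  have h3 := h.sum Z (by grind)
  have h4 := h.sum (Y ∪ Z) (by grind)
  simp only [loc]; linarith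

theorem ctr (h : Exch A B M N L R) {Z : Finset α} (hZ : Z ⊆ R) :
    Exch (ctr A Z) (ctr B Z) (ctr M Z) (ctr N Z) L (R \ Z) where
  rA := h.rA.ctr Z
  rB := h.rB.ctr Z
  rM := h.rM.ctr Z
  rN := h.rN.ctr Z
  disj := h.disj.mono_right Finset.sdiff_subset
  sum X hX := by
    have h1 := h.sum Z (by grind)
    have h2 := h.sum (X ∪ Z) (by grind)
    simp only [_root_.ctr]; linarith
  sep := by
    have h1 := h.locB (subset_refl L) hZ
    have h2 := h.locB (subset_refl L) (subset_refl R)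
    have e1 : R \ Z ∪ Z = R := Finset.sdiff_union_of_subset hZ
    simp only [_root_.ctr, Finset.union_assoc, e1]; linarith

theorem eq_of_loc (h : Exch A B M N L R) (hA : Conn A (L ∪ R)) (hL : L.Nonempty)
    (hR : R.Nonempty) (h0 : loc N L R = 0) : ∀ X ⊆ L ∪ R, A X = M X := by
  refine Cross.eq_of_conn h.rA h.rM h.disj hL hR ?_ hA
  intro Y hY Z hZ
  have h1 := h.loc_sum hY hZ
  have h2 := h.rN.loc_mono hY hZ
  have h3 := h.rN.loc_nonneg Y Z
  linarith

theorem eq_right_aux (h : Exch A B M N L R) (hB : Conn B L) {Z : Finset α} {f : α} (hZ : Z ⊆ R)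
    (hf : f ∈ R) (h0 : loc A L Z = 0) (hM : 0 < loc M L (insert f Z))
    (hN : loc N L (insert f Z) = 0) : ∀ X ⊆ L, N X = B X := by
  have hfL : f ∉ L := fun hfL => Finset.disjoint_left.1 h.disj hfL hf
  have hfZ : insert f Z ⊆ R := Finset.insert_subset hf hZ
  have rA' := h.rA.ctr Z
  have rM' := h.rM.ctr Z
  have zA : ∀ Y ⊆ L, loc A Y Z = 0 := fun Y hY =>
    le_antisymm (h0 ▸ h.rA.loc_mono hY subset_rfl) (h.rA.loc_nonneg _ _)
  have zM : ∀ Y ⊆ L, loc M Y Z = 0 := fun Y hY => by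
    have h1 := h.loc_sum hY hZ
    have h2 := h.rM.loc_nonneg Y Z
    have h3 := h.rN.loc_nonneg Y Z
    rw [zA Y hY] at h1; linarith
  have eA : ∀ Y ⊆ L, _root_.ctr A Z Y = A Y := fun Y hY => by
    have := zA Y hY
    simp only [loc] at this
    simp only [_root_.ctr]; linarith
  have eM : ∀ Y ⊆ L, _root_.ctr M Z Y = M Y := fun Y hY => by
    have := zM Y hY
    simp only [loc] at this
    simp only [_root_.ctr]; linarith
  have hc : Cross (_root_.ctr A Z) (_root_.ctr M Z) L {f} := by
    intro Y hY T hT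
    rcases Finset.subset_singleton_iff.1 hT with rfl | rfl
    · simp only [loc_ctr, Finset.empty_union]; ring
    · simp only [loc_ctr, ← Finset.insert_eq, zA Y hY, zM Y hY]
      have h1 := h.loc_sum hY hfZ
      have h2 := h.rN.loc_mono hY (subset_refl (insert f Z))
      have h3 := h.rN.loc_nonneg Y (insert f Z)
      linarith
  have hpos : 0 < loc (_root_.ctr A Z) L {f} := by
    rw [hc L subset_rfl {f} subset_rfl, loc_ctr, zM L subset_rfl, ← Finset.insert_eq]
    linarith
  have comp : ∀ K ⊆ L ∪ {f}, f ∈ K → K = K.erase f ∪ {f} ∧ K.erase f ⊆ L ∧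
      Disjoint (K.erase f) {f} := by
    intro K hK hfK
    refine ⟨(Finset.erase_union_eq f K hfK).symm, ?_, by simp⟩
    rwa [Finset.union_comm, ← Finset.insert_eq, Finset.subset_insert_iff] at hK
  obtain ⟨K, hKS, hfK, hK, hKsep⟩ := rA'.exists_comp (S := L ∪ {f}) (f := f) (by simp)
  obtain ⟨K', hKS', hfK', hK', hKsep'⟩ := rM'.exists_comp (S := L ∪ {f}) (f := f) (by simp)
  obtain ⟨c1, c2, c3⟩ := comp K hKS hfK
  obtain ⟨d1, d2, d3⟩ := comp K' hKS' hfK'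
  have lt_of : ∀ r : Finset α → ℤ, 0 < loc r L {f} → ∀ K ⊆ L ∪ {f}, K = K.erase f ∪ {f} →
      r K + r ((L ∪ {f}) \ K) ≤ r (L ∪ {f}) → (K.erase f).Nonempty := by
    intro r hr K hKS hKf hs
    by_contra hcon
    rw [Finset.not_nonempty_iff_eq_empty] at hcon
    rw [hcon, Finset.empty_union] at hKf
    subst hKf
    rw [Finset.union_sdiff_cancel_right (by simpa using hfL)] at hs
    simp only [loc] at hr
    linarith
  have hne := lt_of _ hpos K hKS c1 hKsep
  have hne' := lt_of _ (by rwa [← hc L subset_rfl {f} subset_rfl]) K' hKS' d1 hKsep'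
  have hKM : Conn (_root_.ctr M Z) K := by
    rw [c1] at hK ⊢
    exact hK.transfer rA' rM'.toIsPM c3 hne (by simp) (hc.mono c2 subset_rfl)
  have hKA : Conn (_root_.ctr A Z) K' := by
    rw [d1] at hK' ⊢
    exact hK'.transfer rM' rA'.toIsPM d3 hne' (by simp) (hc.symm.mono d2 subset_rfl)
  have sub : ∀ r : Finset α → ℤ, IsPM r → ∀ K K' : Finset α, K ⊆ L ∪ {f} → K' ⊆ L ∪ {f} →
      f ∈ K → f ∈ K' → Conn r K → r K' + r ((L ∪ {f}) \ K') ≤ r (L ∪ {f}) → K ⊆ K' := by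
    intro r hr K K' hK hK' hf hf' hc hs
    refine hc.subset_of_sep ?_ hf hf'
    have hs : r K' + r ((L ∪ {f}) \ K') ≤ r (K' ∪ (L ∪ {f}) \ K') := by
      rwa [Finset.union_sdiff_of_subset hK']
    have := hr.sep hs (X := K ∩ K') (Y := K \ K') Finset.inter_subset_right
      (Finset.sdiff_subset_sdiff hK subset_rfl)
    rw [show K ∩ K' ∪ K \ K' = K by rw [Finset.union_comm, Finset.sdiff_union_inter]] at this
    exact this.ge
  have hKK : K' = K := (sub _ rA'.toIsPM K' K hKS' hKS hfK' hfK hKA hKsep).antisymm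
    (sub _ rM'.toIsPM K K' hKS hKS' hfK hfK' hKM hKsep')
  subst hKK
  have eK : ∀ X ⊆ K'.erase f, A X = M X := by
    intro X hX
    have := lehman rA' rM' c3 (by simp) (hc.mono c2 subset_rfl) (by rwa [← c1]) X hX
    rwa [eA X (hX.trans c2), eM X (hX.trans c2)] at this
  have sepW : ∀ r : Finset α → ℤ, IsPM r → r K' + r ((L ∪ {f}) \ K') ≤ r (L ∪ {f}) →
      ∀ X ⊆ K'.erase f, ∀ Y ⊆ L \ K', r (X ∪ Y) = r X + r Y := by
    intro r hr hs X hX Y hY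
    have hs : r K' + r ((L ∪ {f}) \ K') ≤ r (K' ∪ (L ∪ {f}) \ K') := by
      rwa [Finset.union_sdiff_of_subset hKS]
    exact hr.sep hs (hX.trans (Finset.erase_subset _ _))
      (hY.trans (Finset.sdiff_subset_sdiff Finset.subset_union_left subset_rfl))
  have hLK : K'.erase f ∪ L \ K' = L := by
    ext x
    by_cases hx : x = f
    · subst hx; simp [hfK', hfL]
    · have : x ∈ K' → x ∈ L := fun h => c2 (by simp [hx, h])
      simp only [Finset.mem_union, Finset.mem_erase, Finset.mem_sdiff]; tauto
  have hcB : Cross B N (K'.erase f) (L \ K') := by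
    intro X hX Y hY
    have s1 := sepW _ rA'.toIsPM hKsep X hX Y hY
    have s2 := sepW _ rM'.toIsPM hKsep' X hX Y hY
    have hXL := hX.trans c2
    have hYL : Y ⊆ L := hY.trans Finset.sdiff_subset
    have hXY := Finset.union_subset hXL hYL
    rw [eA _ hXL, eA _ hYL, eA _ hXY] at s1
    rw [eM _ hXL, eM _ hYL, eM _ hXY] at s2
    have t1 := h.sum X (hXL.trans Finset.subset_union_left)
    have t2 := h.sum Y (hYL.trans Finset.subset_union_left)
    have t3 := h.sum _ (hXY.trans Finset.subset_union_left)
    simp only [loc]; linarith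
  rcases (L \ K').eq_empty_or_nonempty with h1 | h1
  · rw [h1, Finset.union_empty] at hLK
    intro X hX
    have := eK X (by rwa [hLK])
    have := h.sum X (hX.trans Finset.subset_union_left)
    linarith
  · intro X hX
    refine (hcB.eq_of_conn h.rB h.rN ?_ hne h1 (by rwa [hLK]) X (by rwa [hLK])).symm
    exact Finset.disjoint_sdiff.mono_left (Finset.erase_subset _ _)

theorem eq_or_eq (h : Exch A B M N L R) (hB : Conn B L) (hA : 0 < loc A L R) :
    (∀ X ⊆ L, N X = B X) ∨ (∀ X ⊆ L, M X = B X) := by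
  obtain ⟨Z, -, hZ, hZ0, f, hf, -, hfZ⟩ := h.rA.exists_step (L := L) (Finset.empty_subset R)
    (by simp [loc, h.rA.empty]) hA
  have h1 := h.rA.loc_step L Z f
  have h2 := h.loc_sum (subset_refl L) (Finset.insert_subset hf hZ)
  have h3 := h.rM.loc_nonneg L (insert f Z)
  have h4 := h.rN.loc_nonneg L (insert f Z)
  by_cases h5 : loc N L (insert f Z) = 0
  · exact .inl (h.eq_right_aux hB hZ hf hZ0 (by linarith) h5)
  · have h6 : 0 < loc N L (insert f Z) := by omega
    exact .inr (h.swap.eq_right_aux hB hZ hf hZ0 (by linarith) (by linarith))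

theorem ctr_eq (h : Exch A B M N L R) (hB : Conn B L) (hN : ∀ X ⊆ L, N X = B X) {Z : Finset α}
    {f : α} (hZ : Z ⊆ R) (hf : f ∈ R) (h0 : loc N L Z = 0) (h1 : 0 < loc N L (insert f Z)) :
    ∀ Y ⊆ L, A (Y ∪ Z) - A Z = B Y := by
  have hfL : f ∉ L := fun hfL => Finset.disjoint_left.1 h.disj hfL hf
  have hfZ : insert f Z ⊆ R := Finset.insert_subset hf hZ
  have rA' := h.rA.ctr Z
  have rN' := h.rN.ctr Z
  have zN : ∀ Y ⊆ L, loc N Y Z = 0 := fun Y hY =>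
    le_antisymm (h0 ▸ h.rN.loc_mono hY subset_rfl) (h.rN.loc_nonneg _ _)
  have eN : ∀ Y ⊆ L, _root_.ctr N Z Y = B Y := fun Y hY => by
    have := zN Y hY
    simp only [loc] at this
    rw [← hN Y hY]
    simp only [_root_.ctr]; linarith
  have hc : Cross (_root_.ctr N Z) (_root_.ctr A Z) L {f} := by
    intro Y hY T hT
    rcases Finset.subset_singleton_iff.1 hT with rfl | rfl
    · simp only [loc_ctr, Finset.empty_union]; ring
    · simp only [loc_ctr, ← Finset.insert_eq]
      have h1 := h.loc_sum hY hfZ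
      have h2 := h.loc_sum hY hZ
      have h3 := h.loc_sum (subset_refl L) hfZ
      have h4 := h.loc_sum (subset_refl L) hZ
      have h5 := h.rA.loc_step L Z f
      have h6 : loc (_root_.ctr M Z) Y {f} ≤ loc (_root_.ctr M Z) L {f} :=
        (h.rM.ctr Z).loc_mono hY subset_rfl
      have h7 := (h.rM.ctr Z).loc_nonneg Y {f}
      simp only [loc_ctr, ← Finset.insert_eq] at h6 h7
      linarith
  have hconn : Conn (_root_.ctr N Z) (insert f L) := by
    refine Conn.insert rN'.toIsPM (hB.congr fun X hX => (eN X hX).symm) hfL ?_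
    have : 0 < loc (_root_.ctr N Z) L {f} := by
      rw [loc_ctr, h0, ← Finset.insert_eq]; linarith
    rw [loc, Finset.union_comm, ← Finset.insert_eq] at this
    linarith
  intro Y hY
  have := lehman rN' rA' (by simpa using hfL) (by simp) hc
    (by rwa [Finset.union_comm, ← Finset.insert_eq]) Y hY
  rw [eN Y hY] at this
  exact this.symm

theorem loc_zero_of (h : Exch A B M N L R) (hB : Conn B L) (hN : ∀ X ⊆ L, N X = B X)
    (hA : ∀ X ⊆ L, A X = B X) (hNR : 0 < loc N L R) {Z : Finset α} (hZ : Z ⊆ R)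
    (h0 : loc N L Z = 0) : loc M L Z = 0 := by
  obtain ⟨Y, hZY, hY, hY0, f, hf, -, hfY⟩ := h.rN.exists_step hZ h0 hNR
  have h1 := h.ctr_eq hB hN hY hf hY0 hfY L subset_rfl
  have h2 := h.loc_sum (subset_refl L) hY
  have h3 := h.rM.loc_mono (subset_refl L) hZY
  have h4 := h.rM.loc_nonneg L Z
  have h5 : loc A L Y = 0 := by rw [loc, hA L subset_rfl]; linarith
  linarith

theorem not_both_of_eq (h : Exch A B M N L R) (hB : Conn B L) (hA : ∀ X ⊆ L, A X = B X)
    (hM : 0 < loc M L R) (hN : 0 < loc N L R) : False := by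
  have hall : (∀ X ⊆ L, N X = B X) ∧ (∀ X ⊆ L, M X = B X) := by
    have h1 := h.loc_sum (subset_refl L) (subset_refl R)
    rcases h.eq_or_eq hB (by linarith) with h2 | h2 <;> refine ⟨fun X hX => ?_, fun X hX => ?_⟩ <;>
    · have := h2 X hX
      have := hA X hX
      have := h.sum X (hX.trans Finset.subset_union_left)
      linarith
  obtain ⟨Z, -, hZ, hZ0, f, hf, -, hfZ⟩ := h.rN.exists_step (L := L) (Finset.empty_subset R)
    (by simp [loc, h.rN.empty]) hN
  have hfZR := Finset.insert_subset hf hZ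
  have h1 := h.loc_zero_of hB hall.1 hA hN hZ hZ0
  have h2 : loc M L (insert f Z) ≠ 0 := fun h0 =>
    hfZ.ne' (h.swap.loc_zero_of hB hall.2 hA hM hfZR h0)
  have h3 := h.rM.loc_nonneg L (insert f Z)
  have h4 := h.loc_sum (subset_refl L) hZ
  have h5 := h.loc_sum (subset_refl L) hfZR
  have h6 := h.rA.loc_step L Z f
  omega

/-- The decomposition uses both colors across `L` and `R`, with `M = A` on `L`. -/
structure Mixed (A B M N : Finset α → ℤ) (L R : Finset α) : Prop extends Exch A B M N L R where
  conn : Conn B L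
  eq : ∀ X ⊆ L, N X = B X
  posM : 0 < loc M L R
  posN : 0 < loc N L R

end Exch

namespace Exch.Mixed

variable {A B M N : Finset α → ℤ} {L R : Finset α}

theorem loc_eq (h : Mixed A B M N L R) : ∀ Y ⊆ L, loc M Y R = A Y - B Y := by
  obtain ⟨Z, -, hZ, hZ0, f, hf, -, hfZ⟩ := h.rN.exists_step (L := L) (Finset.empty_subset R)
    (by simp [loc, h.rN.empty]) h.posN
  have h1 := h.ctr_eq h.conn h.eq hZ hf hZ0 hfZ
  have hB' : ∀ Y ⊆ L, _root_.ctr B Z Y = B Y := fun Y hY => by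
    have := h.locB hY hZ
    simp only [_root_.ctr]; linarith
  have hRZ : R \ Z ∪ Z = R := Finset.sdiff_union_of_subset hZ
  have h2 : ¬ 0 < loc (_root_.ctr M Z) L (R \ Z) := fun hpos => by
    refine (h.ctr hZ).not_both_of_eq (h.conn.congr fun X hX => (hB' X hX).symm)
      (fun X hX => (h1 X hX).trans (hB' X hX).symm) hpos ?_
    rw [loc_ctr, hRZ, hZ0]
    linarith [h.posN]
  intro Y hY
  have h3 := (h.rM.ctr Z).loc_mono hY (subset_refl (R \ Z))
  have h4 := (h.rM.ctr Z).loc_nonneg Y (R \ Z)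
  have h5 : loc (_root_.ctr M Z) Y (R \ Z) = 0 := by linarith
  rw [loc_ctr, hRZ] at h5
  have h6 := h.loc_sum hY hZ
  have h7 := h.rN.loc_mono hY (subset_refl Z)
  have h8 := h.rN.loc_nonneg Y Z
  have h9 := h1 Y hY
  simp only [loc] at *
  linarith

theorem eqM (h : Mixed A B M N L R) : ∀ X ⊆ L, M X = A X := fun X hX => by
  have h1 := h.eq X hX
  have h2 := h.sum X (hX.trans Finset.subset_union_left)
  linarith

theorem lt (h : Mixed A B M N L R) : B L < A L := by
  have := h.loc_eq L subset_rfl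
  linarith [h.posM]

theorem ctr_right (h : Mixed A B M N L R) : ∀ X ⊆ L, _root_.ctr M R X = B X := fun X hX => by
  have h1 := h.loc_eq X hX
  have h2 := h.eqM X hX
  simp only [loc] at h1
  simp only [_root_.ctr]; linarith

theorem inc_lt (h : Mixed A B M N L R) : N (L ∪ R) - N R < B L := by
  have h1 := h.posN
  have h2 := h.eq L subset_rfl
  simp only [loc] at h1
  linarith

theorem two_le_card (h : Mixed A B M N L R) : 2 ≤ L.card := by
  have h1 := h.inc_lt
  have h2 := h.lt
  have h3 := h.rA.le_card L
  have h4 : N R ≤ N (L ∪ R) := h.rN.mono Finset.subset_union_right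
  have : (2 : ℤ) ≤ L.card := by linarith
  exact_mod_cast this

theorem not_symm (h : Mixed A B M N L R) (h' : Mixed A B M N R L) : False := by
  let C := L.powerset.filter (fun Y => 0 < loc N Y R)
  obtain ⟨Y, hY, hmin⟩ := C.exists_min_image Finset.card ⟨L, by simp [C, h.posN]⟩
  simp only [C, Finset.mem_filter, Finset.mem_powerset] at hY hmin
  obtain ⟨hYL, hYpos⟩ := hY
  obtain ⟨Z, -, hZ, hZ0, f, hf, -, hfZ⟩ := h.rN.exists_step (L := L) (Finset.empty_subset R)
    (by simp [loc, h.rN.empty]) h.posN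
  have hAZ := h.ctr_eq h.conn h.eq hZ hf hZ0 hfZ
  have key : ∀ e ∈ Y, M ((R ∪ Y).erase e) < M (R ∪ Y) ∧ 0 < loc M (Y.erase e) R := by
    intro e he
    have heL := hYL he
    have heR : e ∉ R := Finset.disjoint_left.1 h.disj heL
    have hYe : Y.erase e ⊆ L := (Finset.erase_subset _ _).trans hYL
    have hins : insert e (Y.erase e) = Y := Finset.insert_erase he
    have h0 : loc N (Y.erase e) R = 0 := by
      refine le_antisymm (le_of_not_gt fun hp => ?_) (h.rN.loc_nonneg _ _)
      have := hmin _ ⟨hYe, hp⟩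
      have := Finset.card_erase_lt_of_mem he
      omega
    have h1 := h'.ctr_eq h'.conn h'.eq (Z := Y.erase e) (f := e) hYe heL
      (by rwa [loc_comm]) (by rwa [hins, loc_comm]) R subset_rfl
    have hlt := h'.lt
    have s1 := h.loc_sum hYe (subset_refl R)
    have s2 := h.loc_sum hYL (subset_refl R)
    have s3 := h.rA.loc_step R (Y.erase e) e
    rw [hins, loc_comm A R Y, loc_comm A R] at s3
    have s4 := h.rM.loc_mono (Finset.erase_subset e Y) (subset_refl R)
    have a1 := hAZ _ hYL
    have a2 := hAZ _ hYe
    have a3 := h.eq _ hYL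
    have a4 := h.eq _ hYe
    have a5 := h.eqM _ hYL
    have a6 := h.eqM _ hYe
    have a7 : A (Y ∪ Z) + A (Y.erase e) ≤ A (Y.erase e ∪ Z) + A Y := h.rA.sm (by grind) (by grind)
    have a8 : N (Y.erase e ∪ R) ≤ N (Y ∪ R) := h.rN.mono (by grind)
    have e1 : (R ∪ Y).erase e = Y.erase e ∪ R := by grind
    rw [e1, Finset.union_comm R Y]
    rw [Finset.union_comm] at h1
    simp only [loc] at *
    constructor <;> linarith
  obtain ⟨e, he⟩ : Y.Nonempty := by
    rw [Finset.nonempty_iff_ne_empty]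
    rintro rfl
    simp [loc, h.rN.empty] at hYpos
  have h1 := h.rM.peel (Finset.subset_union_right (s₁ := R) (s₂ := Y)) fun g hg => (key g hg).1
  have h2 := (key e he).2
  have h3 := h.rM.loc_mono (Finset.erase_subset e Y) (subset_refl R)
  have h4 := h.rM.le_card Y
  have e1 : (R ∪ Y) \ Y = R := by
    have := Finset.disjoint_left.1 h.disj
    ext x; simp only [Finset.mem_sdiff, Finset.mem_union]
    exact ⟨fun h => h.1.resolve_right h.2, fun hx => ⟨.inl hx, fun hy => this (hYL hy) hx⟩⟩
  rw [e1] at h1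
  rw [loc_comm M Y R] at h3
  simp only [loc] at *
  linarith

theorem connM (h : Mixed A B M N L R) (h' : Mixed A B N M R L) : Conn M (L ∪ R) := by
  rw [Finset.union_comm]
  refine Conn.union h.rM.toIsPM (h'.conn.congr fun X hX => (h'.eq X hX).symm)
    (h.conn.congr fun X hX => (h.ctr_right X hX).symm) h'.disj ?_
  have := h'.posN
  simp only [loc] at this
  linarith

theorem unique {M' N' : Finset α → ℤ} (h : Mixed A B M N L R) (h' : Mixed A B N M R L)
    (k : Mixed A B M' N' L R) (k' : Mixed A B N' M' R L) : ∀ X ⊆ L ∪ R, M X = M' X := by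
  have key : ∀ Z ⊆ R, ∀ Y ⊆ L, loc M Y Z = loc M' Y Z := by
    intro Z hZ Y hY
    induction Y using Finset.induction_on with
    | empty => simp [loc, h.rM.empty, k.rM.empty]
    | insert e Y he ih =>
      have hYL : Y ⊆ L := (Finset.subset_insert e Y).trans hY
      have ih := ih hYL
      have gen : ∀ M N : Finset α → ℤ, Mixed A B M N L R →
          (A (insert e Y) - A Y = B (insert e Y) - B Y + 1 →
            loc M (insert e Y) Z - loc M Y Z = loc A (insert e Y) Z - loc A Y Z) ∧
          (A (insert e Y) - A Y ≤ B (insert e Y) - B Y →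
            loc M (insert e Y) Z - loc M Y Z = 0) := by
        intro M N h
        have s1 := h.loc_sum hYL hZ
        have s2 := h.loc_sum hY hZ
        constructor
        · intro h1
          have b1 := h.eq _ hYL
          have b2 := h.eq _ hY
          have b3 := h.rA.step e Y
          have b4 := h.rN.mono (Finset.subset_insert e Y)
          have b5 := h.rN.inc (Finset.subset_union_left (s₁ := Y) (s₂ := Z)) e
          have b6 := h.rN.mono (Finset.subset_insert e (Y ∪ Z))
          simp only [loc, Finset.insert_union] at *
          linarith
        · intro h1
          have b1 := h.loc_eq _ hYL
          have b2 := h.loc_eq _ hY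
          have b3 := h.rM.loc_mono (Finset.subset_insert e Y) (subset_refl R)
          have b4 := h.rM.loc_mono (Finset.subset_insert e Y) (subset_refl Z)
          have b5 := h.rM.inc (Finset.union_subset_union_right (s := Y) hZ) e
          simp only [loc, Finset.insert_union] at *
          linarith
      obtain ⟨g1, g2⟩ := gen M N h
      obtain ⟨g3, g4⟩ := gen M' N' k
      have b3 := h.rA.step e Y
      have b4 := h.rB.mono (Finset.subset_insert e Y)
      by_cases hc : A (insert e Y) - A Y = B (insert e Y) - B Y + 1
      · linarith [g1 hc, g3 hc]
      · have hc' : A (insert e Y) - A Y ≤ B (insert e Y) - B Y := by omega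
        linarith [g2 hc', g4 hc']
  intro X hX
  have h1 := key (X ∩ R) Finset.inter_subset_right (X ∩ L) Finset.inter_subset_right
  have e1 : X ∩ L ∪ X ∩ R = X := by grind
  have h2 := h.eqM (X ∩ L) Finset.inter_subset_right
  have h3 := h'.eq (X ∩ R) Finset.inter_subset_right
  have h4 := k.eqM (X ∩ L) Finset.inter_subset_right
  have h5 := k'.eq (X ∩ R) Finset.inter_subset_right
  simp only [loc, e1] at h1
  linarith

end Exch.Mixed

end Exch

section Three

variable [DecidableEq α] {A B M N : Finset α → ℤ} {L R : Finset α}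

namespace Exch

theorem unmixed_or_mixed (h : Exch A B M N L R) (hB : Conn B L) (hA : Conn A (L ∪ R))
    (hL : L.Nonempty) (hR : R.Nonempty) :
    ((∀ X ⊆ L ∪ R, A X = M X) ∨ (∀ X ⊆ L ∪ R, A X = N X)) ∨
      Mixed A B M N L R ∨ Mixed A B N M L R := by
  by_cases h0 : loc N L R = 0
  · exact .inl (.inl (h.eq_of_loc hA hL hR h0))
  by_cases h1 : loc M L R = 0
  · exact .inl (.inr (h.swap.eq_of_loc hA hL hR h1))
  have h0' := lt_of_le_of_ne (h.rN.loc_nonneg L R) (Ne.symm h0)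
  have h1' := lt_of_le_of_ne (h.rM.loc_nonneg L R) (Ne.symm h1)
  have h2 := h.loc_sum (subset_refl L) (subset_refl R)
  rcases h.eq_or_eq hB (by linarith) with h3 | h3
  · exact .inr (.inl ⟨h, hB, h3, h1', h0'⟩)
  · exact .inr (.inr ⟨h.swap, hB, h3, h0', h1'⟩)

namespace Mixed

theorem not_del (h : Mixed A B M N L R) {T : Finset α} (hT : L ⊆ T) : ¬ ∀ X ⊆ T, A X = N X := by
  intro h1
  have h2 := h1 L hT
  have h3 := h.eq L subset_rfl
  have h4 := h.lt
  linarith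

theorem not_ctr (h : Mixed A B M N L R) {g : α} (hg : g ∈ R) :
    ¬ ∀ X ⊆ (L ∪ R).erase g, _root_.ctr A {g} X = _root_.ctr M {g} X := by
  intro h1
  have h2 := h1 ((L ∪ R).erase g) subset_rfl
  have h3 := h1 (R.erase g) (Finset.erase_subset_erase _ Finset.subset_union_right)
  have h4 := h.sum (L ∪ R) subset_rfl
  have h5 := h.sum R Finset.subset_union_right
  have h6 := h.inc_lt
  have h7 := h.locB (subset_refl L) (subset_refl R)
  simp only [_root_.ctr, Finset.erase_union_eq g R hg,
    Finset.erase_union_eq g (L ∪ R) (Finset.mem_union_right _ hg)] at h2 h3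
  linarith

theorem not_ctr_left (h : Mixed A B M N L R) {g : α} (hg : g ∈ L) :
    ¬ ∀ X ⊆ (L ∪ R).erase g, _root_.ctr A {g} X = _root_.ctr N {g} X := by
  intro h1
  have h2 := h1 (L.erase g) (Finset.erase_subset_erase _ Finset.subset_union_left)
  have h3 := h.sum L Finset.subset_union_left
  have h4 := h.eqM L subset_rfl
  have h5 := h.sum {g} (by simp [hg])
  have h6 := (h.rB.pos h.conn h.two_le_card hg).1
  have h7 := h.rM.unit g
  have h8 := h.lt
  simp only [_root_.ctr, Finset.erase_union_eq g L hg] at h2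
  linarith

theorem not_del_left (h : Mixed A B M N L R) {g : α} (hg : g ∈ L) :
    ¬ ∀ X ⊆ (L ∪ R).erase g, A X = M X := by
  intro h1
  have hgR : g ∉ R := Finset.disjoint_left.1 h.disj hg
  have e1 : (L ∪ R).erase g = L.erase g ∪ R := by
    rw [Finset.erase_union_distrib, Finset.erase_eq_of_notMem hgR]
  rw [e1] at h1
  have hs : L.erase g ∪ R ⊆ L ∪ R :=
    Finset.union_subset_union (Finset.erase_subset _ _) subset_rfl
  have h2 := h1 _ subset_rfl
  have h3 := h1 R Finset.subset_union_right
  have h4 := h.sum _ hs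
  have h5 := h.sum R Finset.subset_union_right
  have h6 := (h.rB.pos h.conn h.two_le_card hg).2
  have h7 := h.locB (Finset.erase_subset g L) (subset_refl R)
  have h8 := h.inc_lt
  have h9 := h.rN.mono hs
  linarith

theorem false_of_two (h : Mixed A B M N L R) {L' R' : Finset α} (h' : Mixed A B M N L' R')
    (hLR : L ∪ R = L' ∪ R') {g : α} (hg : g ∈ L) (hg' : g ∈ R')
    (hu : ((∀ X ⊆ (L ∪ R).erase g, A X = M X) ∨ (∀ X ⊆ (L ∪ R).erase g, A X = N X)) ∨
      ((∀ X ⊆ (L ∪ R).erase g, _root_.ctr A {g} X = _root_.ctr M {g} X) ∨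
        (∀ X ⊆ (L ∪ R).erase g, _root_.ctr A {g} X = _root_.ctr N {g} X))) : False := by
  have hgL' : g ∉ L' := Finset.disjoint_right.1 h'.disj hg'
  rcases hu with (hu | hu) | (hu | hu)
  · exact h.not_del_left hg hu
  · rw [hLR] at hu
    exact h'.not_del (Finset.subset_erase.2 ⟨Finset.subset_union_left, hgL'⟩) hu
  · rw [hLR] at hu
    exact h'.not_ctr hg' hu
  · exact h.not_ctr_left hg hu

end Mixed

end Exch

/-- A sum `A + B` with `A` connected and `B` having at least three components
has no other expressions. -/
theorem eq_or_eq_of_three {S : Finset α} (hA : IsRk A) (hB : IsRk B) (hM : IsRk M)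
    (hN : IsRk N) (hsum : ∀ X ⊆ S, A X + B X = M X + N X) (hc : Conn A S)
    (P : Fin 3 → Finset α) (hP : ∀ i, P i ⊆ S) (hne : ∀ i, (P i).Nonempty)
    (hd : ∀ i j, i ≠ j → Disjoint (P i) (P j)) (hsep : ∀ i, B (P i) + B (S \ P i) ≤ B S) :
    (∀ X ⊆ S, A X = M X) ∨ (∀ X ⊆ S, A X = N X) := by
  induction hn : S.card generalizing S A B M N P with
  | zero =>
    rw [Finset.card_eq_zero] at hn
    exact absurd (hP 0) (by rw [hn, Finset.subset_empty]; exact (hne 0).ne_empty)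
  | succ n ih =>
    by_contra hcon
    have comp : ∀ i, ∃ K ⊆ P i, K.Nonempty ∧ Conn B K ∧ B K + B (S \ K) ≤ B S := by
      intro i
      obtain ⟨f, hf⟩ := hne i
      obtain ⟨K, hK, hfK, hcK, hKs⟩ := hB.exists_comp hf
      refine ⟨K, hK, ⟨f, hfK⟩, hcK, ?_⟩
      have h1 : B (S \ K) + B ∅ ≤ B (P i \ K) + B (S \ P i) :=
        hB.sm (fun x hx => by
          simp only [Finset.mem_sdiff, Finset.mem_union] at *; tauto) (Finset.empty_subset _)
      rw [hB.empty] at h1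
      linarith [hsep i]
    choose L hLP hLne hLc hLs using comp
    have hLS : ∀ i, L i ⊆ S := fun i => (hLP i).trans (hP i)
    have hLd : ∀ i j, i ≠ j → Disjoint (L i) (L j) := fun i j hij =>
      (hd i j hij).mono (hLP i) (hLP j)
    have hLu : ∀ i, L i ∪ S \ L i = S := fun i => Finset.union_sdiff_of_subset (hLS i)
    have sub : ∀ i j, i ≠ j → L i ⊆ S \ L j := fun i j hij =>
      Finset.subset_sdiff.2 ⟨hLS i, hLd i j hij⟩
    have mix : ∀ i, Exch.Mixed A B M N (L i) (S \ L i) ∨ Exch.Mixed A B N M (L i) (S \ L i) := by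
      intro i
      have he : Exch A B M N (L i) (S \ L i) :=
        ⟨hA, hB, hM, hN, Finset.disjoint_sdiff, by rwa [hLu], by rw [hLu]; exact hLs i⟩
      obtain ⟨j, hij⟩ : ∃ j : Fin 3, j ≠ i := exists_ne i
      have := he.unmixed_or_mixed (hLc i) (by rwa [hLu]) (hLne i) ((hLne j).mono (sub j i hij))
      rw [hLu] at this
      exact this.resolve_left hcon
    have hcard : ∀ i, 2 ≤ (L i).card := fun i => by
      rcases mix i with h | h <;> exact h.two_le_card
    have unm : ∀ g ∈ S, ((∀ X ⊆ S.erase g, A X = M X) ∨ (∀ X ⊆ S.erase g, A X = N X)) ∨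
        ((∀ X ⊆ S.erase g, ctr A {g} X = ctr M {g} X) ∨
          (∀ X ⊆ S.erase g, ctr A {g} X = ctr N {g} X)) := by
      intro g hg
      have hn' : (S.erase g).card = n := by rw [Finset.card_erase_of_mem hg, hn]; rfl
      have q1 : ∀ i, (L i).erase g ⊆ S.erase g := fun i => Finset.erase_subset_erase _ (hLS i)
      have q2 : ∀ i, ((L i).erase g).Nonempty := fun i => by
        have := hcard i
        have := Finset.pred_card_le_card_erase (s := L i) (a := g)
        rw [← Finset.card_pos]; omega
      have q3 : ∀ i j, i ≠ j → Disjoint ((L i).erase g) ((L j).erase g) := fun i j hij =>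
        (hLd i j hij).mono (Finset.erase_subset _ _) (Finset.erase_subset _ _)
      have sp : ∀ i, B (L i) + B (S \ L i) ≤ B (L i ∪ S \ L i) := fun i => by
        rw [hLu]; exact hLs i
      have e1 : ∀ i, S.erase g \ (L i).erase g = (S \ L i).erase g := fun i => by
        ext x; simp only [Finset.mem_sdiff, Finset.mem_erase]; tauto
      rcases hc.del_or_ctr hA hg with h | h
      · refine .inl (ih hA hB hM hN (fun X hX => hsum X (hX.trans (Finset.erase_subset _ _))) h
          (fun i => (L i).erase g) q1 q2 q3 (fun i => ?_) hn')
        have := hB.sep (sp i) (Finset.erase_subset g _) (Finset.erase_subset g _)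
        rw [← Finset.erase_union_distrib, hLu] at this
        rw [e1, this]
      · refine .inr (ih (hA.ctr {g}) (hB.ctr {g}) (hM.ctr {g}) (hN.ctr {g}) (fun X hX => ?_) h
          (fun i => (L i).erase g) q1 q2 q3 (fun i => ?_) hn')
        · have h1 := hsum (X ∪ {g}) (Finset.union_subset (hX.trans (Finset.erase_subset _ _))
            (by simpa using hg))
          have h2 := hsum {g} (by simpa using hg)
          simp only [ctr]; linarith
        · rw [e1]
          simp only [ctr, Finset.erase_union_eq g S hg]
          have h1 := hLs i
          have h2 := hB.mono (A := {g}) (B := (L i) ∪ {g}) Finset.subset_union_right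
          by_cases hgi : g ∈ L i
          · have hgi' : g ∉ S \ L i := by simp [hgi]
            have h3 := hB.sep (sp i) (Finset.singleton_subset_iff.2 hgi) (subset_refl (S \ L i))
            rw [Finset.erase_union_eq g _ hgi, Finset.erase_eq_of_notMem hgi',
              Finset.union_comm (S \ L i)]
            linarith
          · have hgi' : g ∈ S \ L i := by simp [hgi, hg]
            have h3 := hB.sep (sp i) (subset_refl (L i)) (Finset.singleton_subset_iff.2 hgi')
            rw [Finset.erase_union_eq g _ hgi', Finset.erase_eq_of_notMem hgi]
            linarith
    have two : ∀ M N : Finset α → ℤ, (∀ g ∈ S, ((∀ X ⊆ S.erase g, A X = M X) ∨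
        (∀ X ⊆ S.erase g, A X = N X)) ∨ ((∀ X ⊆ S.erase g, ctr A {g} X = ctr M {g} X) ∨
          (∀ X ⊆ S.erase g, ctr A {g} X = ctr N {g} X))) → ∀ i j, i ≠ j →
        Exch.Mixed A B M N (L i) (S \ L i) → Exch.Mixed A B M N (L j) (S \ L j) → False := by
      intro M N hu i j hij hi hj
      obtain ⟨g, hg⟩ := hLne i
      exact hi.false_of_two hj (by rw [hLu, hLu]) hg (sub i j hij hg)
        (by rw [hLu]; exact hu g (hLS i hg))
    have two1 := two M N unm
    have two2 := two N M fun g hg => (unm g hg).imp Or.symm Or.symm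
    rcases mix 0 with h0 | h0 <;> rcases mix 1 with h1 | h1 <;> rcases mix 2 with h2 | h2 <;>
    first
      | exact two1 0 1 (by decide) h0 h1
      | exact two1 0 2 (by decide) h0 h2
      | exact two1 1 2 (by decide) h1 h2
      | exact two2 0 1 (by decide) h0 h1
      | exact two2 0 2 (by decide) h0 h2
      | exact two2 1 2 (by decide) h1 h2

end Three

section Piece

/-- The non-loops of `r` in `E`. -/
def supp (E : Finset α) (r : Finset α → ℤ) : Finset α := E.filter fun e => r {e} ≠ 0

theorem mem_supp {E : Finset α} {r : Finset α → ℤ} {e : α} :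
    e ∈ supp E r ↔ e ∈ E ∧ r {e} ≠ 0 := by simp [supp]

theorem supp_subset (E : Finset α) (r : Finset α → ℤ) : supp E r ⊆ E := Finset.filter_subset _ _

variable [DecidableEq α]

/-- A connected matroid on `E` up to loops. -/
structure Piece (E : Finset α) (r : Finset α → ℤ) : Prop extends IsRk r where
  norm : ∀ X, r X = r (X ∩ E)
  ne : (supp E r).Nonempty
  conn : Conn r (supp E r)

theorem IsRk.eq_one {r : Finset α → ℤ} (hr : IsRk r) {E : Finset α} {e : α} (he : e ∈ supp E r) :
    r {e} = 1 := by
  have h1 := hr.unit e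
  have h2 := hr.nonneg {e}
  have h3 := (mem_supp.1 he).2
  omega

theorem IsPM.inter_supp {r : Finset α → ℤ} (hr : IsPM r) {E : Finset α}
    (h : ∀ X, r X = r (X ∩ E)) (X : Finset α) : r X = r (X ∩ supp E r) := by
  have h1 := hr.closure (X := X ∩ supp E r) (L := (X ∩ E) \ supp E r) fun g hg => by
    have h2 : r {g} = 0 := by
      simp only [Finset.mem_sdiff, mem_supp, Finset.mem_inter] at hg
      tauto
    have h3 : r (insert g (X ∩ supp E r)) + r ∅ ≤ r {g} + r (X ∩ supp E r) :=
      hr.sm (by rw [Finset.insert_eq]) (Finset.empty_subset _)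
    rw [h2, hr.empty] at h3
    linarith
  rw [h X, ← h1]
  congr 1
  ext x
  have := @supp_subset α E r x
  simp only [Finset.mem_inter, Finset.mem_union, Finset.mem_sdiff]
  tauto

theorem IsPM.restrict {r : Finset α → ℤ} (hr : IsPM r) (K : Finset α) :
    IsPM fun X => r (X ∩ K) where
  empty := by simp [hr.empty]
  mono h := hr.mono (Finset.inter_subset_inter_right h)
  submod X Y := hr.sm (by rw [Finset.union_inter_distrib_right])
    (by rw [Finset.inter_inter_distrib_right])

theorem IsRk.restrict {r : Finset α → ℤ} (hr : IsRk r) (K : Finset α) :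
    IsRk fun X => r (X ∩ K) where
  toIsPM := hr.toIsPM.restrict K
  unit e := (hr.mono Finset.inter_subset_left).trans (hr.unit e)

theorem supp_restrict {r : Finset α → ℤ} (hr : IsPM r) (E K : Finset α) :
    supp E (fun X => r (X ∩ K)) = supp E r ∩ K := by
  ext x
  simp only [mem_supp, Finset.mem_inter]
  by_cases hx : x ∈ K
  · simp [hx]
  · simp [hx, hr.empty]

theorem IsPM.sum {ι : Type*} {P : ι → Finset α → ℤ} (s : Finset ι) (h : ∀ i ∈ s, IsPM (P i)) :
    IsPM fun X => ∑ i ∈ s, P i X where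
  empty := Finset.sum_eq_zero fun i hi => (h i hi).empty
  mono hX := Finset.sum_le_sum fun i hi => (h i hi).mono hX
  submod X Y := by
    simp only [← Finset.sum_add_distrib]
    exact Finset.sum_le_sum fun i hi => (h i hi).submod X Y

theorem Piece.eq_zero {E : Finset α} {r : Finset α → ℤ} (h : Piece E r) {X : Finset α}
    (hX : Disjoint X (supp E r)) : r X = 0 := by
  rw [h.inter_supp h.norm, Finset.disjoint_iff_inter_eq_empty.1 hX, h.empty]

theorem Piece.eq_zero_of_notMem {E : Finset α} {r : Finset α → ℤ} (h : Piece E r) {e : α}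
    (he : e ∉ supp E r) : r {e} = 0 := h.eq_zero (by simpa using he)

/-- Pieces with pairwise disjoint supports and a common sum with another such
family belong to the other family. -/
theorem exists_eq_of_sum_eq {ι ι' : Type} {E : Finset α} {P : ι → Finset α → ℤ}
    {Q : ι' → Finset α → ℤ} {s : Finset ι} {t : Finset ι'} (hP : ∀ v ∈ s, Piece E (P v))
    (hQ : ∀ v ∈ t, Piece E (Q v))
    (dP : ∀ v ∈ s, ∀ w ∈ s, v ≠ w → Disjoint (supp E (P v)) (supp E (P w)))
    (dQ : ∀ v ∈ t, ∀ w ∈ t, v ≠ w → Disjoint (supp E (Q v)) (supp E (Q w)))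
    (hs : ∀ X ⊆ E, ∑ v ∈ s, P v X = ∑ v ∈ t, Q v X) {v : ι} (hv : v ∈ s) :
    ∃ w ∈ t, Q w = P v := by
  have single : ∀ {κ : Type} {P : κ → Finset α → ℤ} {s : Finset κ},
      (∀ v ∈ s, Piece E (P v)) →
      (∀ v ∈ s, ∀ w ∈ s, v ≠ w → Disjoint (supp E (P v)) (supp E (P w))) →
      ∀ v ∈ s, ∀ X ⊆ supp E (P v), ∑ u ∈ s, P u X = P v X := by
    intro κ P s hP dP v hv X hX
    refine Finset.sum_eq_single_of_mem v hv fun u hu huv => (hP u hu).eq_zero ?_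
    exact (dP v hv u hu huv.symm).mono_left hX
  have sep : ∀ {κ : Type} {P : κ → Finset α → ℤ} {s : Finset κ},
      (∀ v ∈ s, Piece E (P v)) →
      (∀ v ∈ s, ∀ w ∈ s, v ≠ w → Disjoint (supp E (P v)) (supp E (P w))) →
      ∀ v ∈ s, ∀ X, ∑ u ∈ s, P u (X ∩ supp E (P v)) + ∑ u ∈ s, P u (X \ supp E (P v))
        ≤ ∑ u ∈ s, P u X := by
    intro κ P s hP dP v hv X
    rw [← Finset.sum_add_distrib]
    refine Finset.sum_le_sum fun u hu => ?_
    by_cases huv : u = v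
    · subst huv
      rw [(hP u hu).eq_zero (X := X \ _) Finset.sdiff_disjoint, add_zero]
      exact (hP u hu).mono Finset.inter_subset_left
    · rw [(hP u hu).eq_zero (X := X ∩ _)
        ((dP v hv u hu (Ne.symm huv)).mono_left Finset.inter_subset_right), zero_add]
      exact (hP u hu).mono Finset.sdiff_subset
  have sub : ∀ {κ κ' : Type} {P : κ → Finset α → ℤ} {Q : κ' → Finset α → ℤ} {s : Finset κ}
      {t : Finset κ'}, (∀ v ∈ s, Piece E (P v)) → (∀ v ∈ t, Piece E (Q v)) →
      (∀ v ∈ s, ∀ w ∈ s, v ≠ w → Disjoint (supp E (P v)) (supp E (P w))) →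
      (∀ v ∈ t, ∀ w ∈ t, v ≠ w → Disjoint (supp E (Q v)) (supp E (Q w))) →
      (∀ X ⊆ E, ∑ v ∈ s, P v X = ∑ v ∈ t, Q v X) → ∀ v ∈ s, ∀ w ∈ t, ∀ e, e ∈ supp E (P v) →
      e ∈ supp E (Q w) → supp E (P v) ⊆ supp E (Q w) := by
    intro κ κ' P Q s t hP hQ dP dQ hs v hv w hw e hev hew
    refine (hP v hv).conn.subset_of_sep ?_ hev hew
    have h1 := sep hQ dQ w hw (supp E (P v))
    rw [← hs _ (supp_subset _ _), ← hs _ (Finset.inter_subset_left.trans (supp_subset _ _)),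
      ← hs _ (Finset.sdiff_subset.trans (supp_subset _ _)), single hP dP v hv _ subset_rfl,
      single hP dP v hv _ Finset.inter_subset_left,
      single hP dP v hv _ Finset.sdiff_subset] at h1
    exact h1
  obtain ⟨e, he⟩ := (hP v hv).ne
  obtain ⟨w, hw, hew⟩ : ∃ w ∈ t, e ∈ supp E (Q w) := by
    by_contra hcon
    push Not at hcon
    have h1 := hs {e} (by simpa using supp_subset _ _ he)
    rw [single hP dP v hv _ (by simpa using he), (hP v hv).eq_one he,
      Finset.sum_eq_zero fun w hw => (hQ w hw).eq_zero_of_notMem (hcon w hw)] at h1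
    exact one_ne_zero h1
  refine ⟨w, hw, ?_⟩
  have e1 : supp E (P v) = supp E (Q w) :=
    (sub hP hQ dP dQ hs v hv w hw e he hew).antisymm
      (sub hQ hP dQ dP (fun X hX => (hs X hX).symm) w hw v hv e hew he)
  funext X
  rw [(hP v hv).inter_supp (hP v hv).norm, (hQ w hw).inter_supp (hQ w hw).norm, ← e1]
  rw [← single hP dP v hv _ Finset.inter_subset_right,
    ← single hQ dQ w hw _ (by rw [e1]; exact Finset.inter_subset_right)]
  exact (hs _ (Finset.inter_subset_right.trans (supp_subset _ _))).symm

theorem IsRk.exists_pieces {E : Finset α} {r : Finset α → ℤ} (hr : IsRk r)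
    (h : ∀ X, r X = r (X ∩ E)) : ∃ (n : ℕ) (P : Fin n → Finset α → ℤ), (∀ v, Piece E (P v)) ∧
      (∀ v w, v ≠ w → Disjoint (supp E (P v)) (supp E (P w))) ∧ ∀ X, r X = ∑ v, P v X := by
  induction hn : (supp E r).card using Nat.strong_induction_on generalizing r with
  | _ n ih =>
    rcases (supp E r).eq_empty_or_nonempty with h0 | ⟨f, hf⟩
    · refine ⟨0, Fin.elim0, fun v => v.elim0, fun v => v.elim0, fun X => ?_⟩
      rw [hr.inter_supp h, h0]
      simp [hr.empty]
    · obtain ⟨K, hK, hfK, hcK, hKs⟩ := hr.exists_comp hf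
      have hKE := hK.trans (supp_subset E r)
      have s1 : supp E (fun X => r (X ∩ K)) = K := by
        rw [supp_restrict hr.toIsPM, Finset.inter_eq_right.2 hK]
      have s2 : supp E (fun X => r (X ∩ (E \ K))) = supp E r \ K := by
        rw [supp_restrict hr.toIsPM, ← Finset.inter_sdiff_assoc,
          Finset.inter_eq_left.2 (supp_subset E r)]
      have hp : Piece E (fun X => r (X ∩ K)) := by
        refine ⟨hr.restrict K, fun X => ?_, ?_, ?_⟩
        · simp only [Finset.inter_assoc, Finset.inter_eq_right.2 hKE]
        · rw [s1]; exact ⟨f, hfK⟩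
        · rw [s1]
          exact hcK.congr fun X hX => by rw [Finset.inter_eq_left.2 hX]
      obtain ⟨m, P, h1, h2, h3⟩ := ih _ (by
        rw [s2, ← hn, Finset.card_sdiff_of_subset hK]
        have := Finset.card_pos.2 ⟨f, hfK⟩
        have := Finset.card_le_card hK
        omega) (hr.restrict (E \ K)) (fun X => by
          simp only [Finset.inter_assoc, Finset.inter_eq_right.2 (Finset.sdiff_subset (s := E))])
          rfl
      have hd : ∀ v, Disjoint K (supp E (P v)) := by
        intro v
        rw [Finset.disjoint_left]
        intro x hxK hx
        have h4 := h3 {x}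
        simp only [show ({x} : Finset α) ∩ (E \ K) = ∅ by simp [hxK], hr.empty] at h4
        have h5 := Finset.single_le_sum (f := fun w => P w {x})
          (fun w _ => (h1 w).nonneg {x}) (Finset.mem_univ v)
        have h6 := (h1 v).eq_one hx
        linarith
      refine ⟨m + 1, Fin.cons (fun X => r (X ∩ K)) P, ?_, ?_, fun X => ?_⟩
      · intro v
        refine Fin.cases hp (fun v => ?_) v
        exact h1 v
      · intro v w
        refine Fin.cases ?_ (fun v => ?_) v <;> refine Fin.cases ?_ (fun w => ?_) w
        · simp
        · simp only [Fin.cons_zero, Fin.cons_succ, s1]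
          exact fun _ => hd w
        · simp only [Fin.cons_zero, Fin.cons_succ, s1]
          exact fun _ => (hd v).symm
        · simp only [Fin.cons_succ]
          exact fun hvw => h2 v w (fun h => hvw (by rw [h]))
      · rw [Fin.sum_univ_succ]
        simp only [Fin.cons_zero, Fin.cons_succ]
        rw [← h3]
        have h4 := hr.sep (by rwa [Finset.union_sdiff_of_subset hK])
          (Finset.inter_subset_right (s₁ := X) (s₂ := K))
          (Finset.inter_subset_right (s₁ := X) (s₂ := supp E r \ K))
        rw [← Finset.inter_union_distrib_left, Finset.union_sdiff_of_subset hK,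
          ← hr.inter_supp h] at h4
        rw [h4]
        congr 1
        have h5 := (hr.restrict (E \ K)).inter_supp (E := E) (fun Y => by
          simp only [Finset.inter_assoc, Finset.inter_eq_right.2 (Finset.sdiff_subset (s := E))]) X
        rw [s2] at h5
        rw [h5]
        congr 1
        rw [Finset.inter_assoc, Finset.inter_eq_left.2
          (Finset.sdiff_subset_sdiff (supp_subset E r) subset_rfl)]

theorem exists_equiv_of_injective {ι ι' β : Type*} {F : ι → β} {G : ι' → β}
    (hF : F.Injective) (hG : G.Injective) (h : ∀ v, ∃ w, G w = F v) (h' : ∀ w, ∃ v, F v = G w) :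
    ∃ e : ι ≃ ι', ∀ v, G (e v) = F v := by
  choose f hf using h
  choose g hg using h'
  refine ⟨⟨f, g, fun v => hF ?_, fun w => hG ?_⟩, hf⟩
  · rw [hg, hf]
  · rw [hf, hg]

end Piece

section Count

/-- The colorings of the pieces in which intersecting supports get distinct colors. -/
def pieceColorings (E : Finset α) {ι : Type} (P : ι → Finset α → ℤ) (k : ℕ) :
    Set (ι → Fin k) :=
  {c | ∀ v w, v ≠ w → ¬ Disjoint (supp E (P v)) (supp E (P w)) → c v ≠ c w}

theorem ncard_pieceColorings_congr {E : Finset α} {ι ι' : Type} {P : ι → Finset α → ℤ}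
    {Q : ι' → Finset α → ℤ} (e : ι ≃ ι') (h : ∀ v, supp E (Q (e v)) = supp E (P v)) (k : ℕ) :
    (pieceColorings E P k).ncard = (pieceColorings E Q k).ncard := by
  refine Set.ncard_congr (fun c _ => c ∘ e.symm) ?_ ?_ ?_
  · intro c hc v w hvw hd
    refine hc (e.symm v) (e.symm w) (fun h => hvw (e.symm.injective h)) ?_
    rw [← h, ← h]
    simpa using hd
  · intro c c' _ _ hcc
    funext v
    have := congrFun hcc (e v)
    simpa using this
  · intro c hc
    refine ⟨c ∘ e, fun v w hvw hd => ?_, by funext v; simp⟩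
    rw [← h, ← h] at hd
    exact hc (e v) (e w) (fun h => hvw (e.injective h)) hd

theorem pieceColorings.disjoint {E : Finset α} {ι : Type} {P : ι → Finset α → ℤ} {k : ℕ}
    {c : ι → Fin k} (hc : c ∈ pieceColorings E P k) {v w : ι} (hvw : v ≠ w) (h : c v = c w) :
    Disjoint (supp E (P v)) (supp E (P w)) :=
  not_not.1 fun hd => hc v w hvw hd h

variable [DecidableEq α]

/-- An expression of `ρ` as a sum of connected matroids. -/
structure Dec (E : Finset α) (ρ : Finset α → ℤ) {ι : Type} [Fintype ι] (P : ι → Finset α → ℤ) :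
    Prop where
  piece : ∀ v, Piece E (P v)
  sum : ∀ X ⊆ E, ρ X = ∑ v, P v X

theorem Dec.comp {E : Finset α} {ρ : Finset α → ℤ} {ι ι' : Type} [Fintype ι] [Fintype ι']
    {P : ι → Finset α → ℤ} (h : Dec E ρ P) (e : ι' ≃ ι) : Dec E ρ (P ∘ e) where
  piece v := h.piece (e v)
  sum X hX := by
    rw [h.sum X hX, ← Equiv.sum_comp e]; rfl

theorem mem_Delta {E : Finset α} {ρ : Finset α → ℤ} {k : ℕ} {M : Fin k → Finset α → ℤ} :
    M ∈ Delta k E ρ ↔ (∀ i, IsRk (M i)) ∧ (∀ i X, M i X = M i (X ∩ E)) ∧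
      ∀ X ⊆ E, ρ X = ∑ i, M i X := by
  refine ⟨fun h => ⟨fun i => ?_, h.2.1, h.2.2⟩, fun h => ⟨fun i => ?_, h.2.1, h.2.2⟩⟩
  · obtain ⟨⟨h1, h2, h3⟩, h4⟩ := h.1 i
    have hn := h.2.1 i
    refine ⟨⟨h1, fun {A B} hAB => ?_, fun A B => ?_⟩, fun e => ?_⟩
    · rw [hn A, hn B]
      exact h2 _ _ (Finset.inter_subset_inter_right hAB) Finset.inter_subset_right
    · rw [hn A, hn B, hn (A ∪ B), hn (A ∩ B), Finset.union_inter_distrib_right,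
        Finset.inter_inter_distrib_right]
      exact h3 _ _ Finset.inter_subset_right Finset.inter_subset_right
    · by_cases he : e ∈ E
      · exact h4 e he
      · rw [hn, Finset.singleton_inter_of_notMem he, h1]
        exact zero_le_one
  · have hi := h.1 i
    exact ⟨⟨hi.empty, fun A B hAB _ => hi.mono hAB, fun A B _ _ => hi.submod A B⟩,
      fun e _ => hi.unit e⟩

theorem finite_isRk (E : Finset α) :
    {r : Finset α → ℤ | IsRk r ∧ ∀ X, r X = r (X ∩ E)}.Finite := by
  refine Set.Finite.of_injOn (f := fun r (X : E.powerset) => r X)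
    (t := Set.univ.pi fun _ => Set.Icc 0 (E.card : ℤ)) ?_ ?_
    (Set.Finite.pi fun _ => Set.finite_Icc _ _)
  · rintro r ⟨hr, -⟩ ⟨X, hX⟩ -
    refine ⟨hr.nonneg X, (hr.le_card X).trans ?_⟩
    exact_mod_cast Finset.card_le_card (Finset.mem_powerset.1 hX)
  · rintro r ⟨hr, hn⟩ r' ⟨hr', hn'⟩ h
    funext X
    rw [hn, hn']
    exact congrFun h ⟨X ∩ E, Finset.mem_powerset.2 Finset.inter_subset_right⟩

theorem finite_dec (E : Finset α) (ρ : Finset α → ℤ) (ι : Type) [Fintype ι] :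
    {P : ι → Finset α → ℤ | Dec E ρ P}.Finite := by
  refine (Set.Finite.pi (t := fun _ : ι => _) fun _ => finite_isRk E).subset ?_
  intro P hP v _
  exact ⟨(hP.piece v).toIsRk, (hP.piece v).norm⟩

/-- The decompositions into `n` pieces together with colorings of the pieces. -/
def colDec (E : Finset α) (ρ : Finset α → ℤ) (n k : ℕ) :
    Set ((Fin n → Finset α → ℤ) × (Fin n → Fin k)) :=
  {x | Dec E ρ x.1 ∧ x.2 ∈ pieceColorings E x.1 k}

theorem finite_colDec (E : Finset α) (ρ : Finset α → ℤ) (n k : ℕ) : (colDec E ρ n k).Finite :=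
  ((finite_dec E ρ (Fin n)).prod Set.finite_univ).subset fun _ hx => ⟨hx.1, Set.mem_univ _⟩

theorem ncard_colDec {E : Finset α} {ρ : Finset α → ℤ} {n k m : ℕ}
    (h : ∀ P : Fin n → Finset α → ℤ, Dec E ρ P → (pieceColorings E P k).ncard = m) :
    (colDec E ρ n k).ncard = {P : Fin n → Finset α → ℤ | Dec E ρ P}.ncard * m := by
  classical
  have hf := finite_dec E ρ (Fin n)
  have hc := finite_colDec E ρ n k
  rw [Set.ncard_eq_toFinset_card _ hf, Set.ncard_eq_toFinset_card _ hc]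
  rw [Finset.card_eq_sum_card_fiberwise (f := Prod.fst) (t := hf.toFinset)
    (fun x hx => by simpa using (hc.mem_toFinset.1 hx).1), Finset.sum_const_nat]
  intro P hP
  rw [← h P (by simpa using hP), ← Set.ncard_image_of_injective _ (Prod.mk_right_injective P),
    ← Set.ncard_coe_finset]
  congr 1
  ext ⟨Q, c⟩
  simp only [Finset.coe_filter, Set.Finite.mem_toFinset, Set.mem_ofPred_eq, colDec, Set.mem_image,
    Prod.mk.injEq]
  constructor
  · rintro ⟨⟨h1, h2⟩, rfl⟩
    exact ⟨c, h2, rfl, rfl⟩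
  · rintro ⟨c', h2, rfl, rfl⟩
    exact ⟨⟨by simpa using hP, h2⟩, rfl⟩

/-- The number of decompositions that are permutations of a given one. -/
theorem ncard_dec_of_perm {E : Finset α} {ρ : Finset α → ℤ} {n : ℕ} {P : Fin n → Finset α → ℤ}
    (hP : Dec E ρ P) (hi : P.Injective)
    (h : ∀ Q : Fin n → Finset α → ℤ, Dec E ρ Q → ∃ e : Equiv.Perm (Fin n), ∀ v, P (e v) = Q v) :
    {Q : Fin n → Finset α → ℤ | Dec E ρ Q}.ncard = n.factorial := by
  have h1 : {Q : Fin n → Finset α → ℤ | Dec E ρ Q} =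
      Set.range fun e : Equiv.Perm (Fin n) => P ∘ e := by
    ext Q
    constructor
    · intro hQ
      obtain ⟨e, he⟩ := h Q hQ
      exact ⟨e, funext he⟩
    · rintro ⟨e, rfl⟩
      exact hP.comp e
  rw [h1, ← Set.image_univ, Set.ncard_image_of_injective, Set.ncard_univ, Nat.card_eq_fintype_card,
    Fintype.card_perm, Fintype.card_fin]
  intro e e' he
  ext v
  exact congrArg _ (hi (congrFun he v))

/-- The matroids obtained by adding the pieces of each color. -/
def assemble {n k : ℕ} (x : (Fin n → Finset α → ℤ) × (Fin n → Fin k)) :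
    Fin k → Finset α → ℤ := fun i X => ∑ v with x.2 v = i, x.1 v X

theorem IsRk.sum {E : Finset α} {ι : Type} {P : ι → Finset α → ℤ} {s : Finset ι}
    (hP : ∀ v ∈ s, Piece E (P v))
    (hd : ∀ v ∈ s, ∀ w ∈ s, v ≠ w → Disjoint (supp E (P v)) (supp E (P w))) :
    IsRk fun X => ∑ v ∈ s, P v X where
  toIsPM := IsPM.sum s fun v hv => (hP v hv).toIsPM
  unit e := by
    by_cases h : ∃ v ∈ s, e ∈ supp E (P v)
    · obtain ⟨v, hv, he⟩ := h
      rw [Finset.sum_eq_single_of_mem v hv fun w hw hwv =>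
        (hP w hw).eq_zero_of_notMem (Finset.disjoint_left.1 (hd v hv w hw hwv.symm) he)]
      exact (hP v hv).unit e
    · push Not at h
      rw [Finset.sum_eq_zero fun v hv => (hP v hv).eq_zero_of_notMem (h v hv)]
      exact zero_le_one

theorem assemble_mem {E : Finset α} {ρ : Finset α → ℤ} {n k : ℕ}
    {x : (Fin n → Finset α → ℤ) × (Fin n → Fin k)} (hx : x ∈ colDec E ρ n k) :
    assemble x ∈ Delta k E ρ := by
  rw [mem_Delta]
  refine ⟨fun i => ?_, fun i X => ?_, fun X hX => ?_⟩
  · refine IsRk.sum (E := E) (fun v _ => hx.1.piece v) fun v hv w hw hvw => ?_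
    simp only [Finset.mem_filter, Finset.mem_univ, true_and] at hv hw
    exact pieceColorings.disjoint hx.2 hvw (hv.trans hw.symm)
  · exact Finset.sum_congr rfl fun v _ => (hx.1.piece v).norm X
  · rw [hx.1.sum X hX]
    exact (Finset.sum_fiberwise _ _ _).symm

theorem exists_assemble {E : Finset α} {ρ : Finset α → ℤ} {k : ℕ} {M : Fin k → Finset α → ℤ}
    (hM : M ∈ Delta k E ρ) : ∃ n, ∃ x ∈ colDec E ρ n k, assemble x = M := by
  rw [mem_Delta] at hM
  obtain ⟨h1, h2, h3⟩ := hM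
  choose n P hP hd hs using fun i => (h1 i).exists_pieces (h2 i)
  let e := (Fintype.equivFin (Σ i, Fin (n i))).symm
  refine ⟨_, ⟨fun v => P (e v).1 (e v).2, fun v => (e v).1⟩, ⟨⟨fun v => hP _ _, fun X hX => ?_⟩,
    fun v w hvw hdis hc => hdis ?_⟩, ?_⟩
  · simp only
    rw [h3 X hX, Equiv.sum_comp e fun v => P v.1 v.2 X, Fintype.sum_sigma]
    exact Finset.sum_congr rfl fun i _ => hs i X
  · have hne : e v ≠ e w := fun h => hvw (e.injective h)
    simp only at hc ⊢
    generalize e v = a at *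
    generalize e w = b at *
    obtain ⟨i, a⟩ := a
    obtain ⟨j, b⟩ := b
    obtain rfl : i = j := hc
    exact hd i a b fun h => hne (by rw [h])
  · funext i X
    simp only [assemble]
    rw [Finset.sum_filter, Equiv.sum_comp e fun v => if v.1 = i then P v.1 v.2 X else 0,
      Fintype.sum_sigma, Finset.sum_eq_single i, hs i X]
    · simp
    · intro j _ hj
      simp [hj]
    · simp

theorem colDec.injective {E : Finset α} {ρ : Finset α → ℤ} {n k : ℕ}
    {x : (Fin n → Finset α → ℤ) × (Fin n → Fin k)} (hx : x ∈ colDec E ρ n k) :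
    Function.Injective fun v => (x.1 v, x.2 v) := by
  intro v w h
  by_contra hvw
  simp only [Prod.mk.injEq] at h
  have := pieceColorings.disjoint hx.2 hvw h.2
  rw [h.1, disjoint_self] at this
  exact (hx.1.piece w).ne.ne_empty this

theorem exists_equiv_of_assemble_eq {E : Finset α} {ρ : Finset α → ℤ} {n m k : ℕ}
    {x : (Fin n → Finset α → ℤ) × (Fin n → Fin k)} {y : (Fin m → Finset α → ℤ) × (Fin m → Fin k)}
    (hx : x ∈ colDec E ρ n k) (hy : y ∈ colDec E ρ m k) (h : assemble x = assemble y) :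
    ∃ e : Fin n ≃ Fin m, ∀ v, y.1 (e v) = x.1 v ∧ y.2 (e v) = x.2 v := by
  have key : ∀ {n m : ℕ} {x : (Fin n → Finset α → ℤ) × (Fin n → Fin k)}
      {y : (Fin m → Finset α → ℤ) × (Fin m → Fin k)}, x ∈ colDec E ρ n k → y ∈ colDec E ρ m k →
      assemble x = assemble y → ∀ v, ∃ w, (y.1 w, y.2 w) = (x.1 v, x.2 v) := by
    intro n m x y hx hy h v
    obtain ⟨w, hw, hwv⟩ := exists_eq_of_sum_eq (E := E) (P := x.1) (Q := y.1)
      (s := Finset.univ.filter fun u => x.2 u = x.2 v)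
      (t := Finset.univ.filter fun u => y.2 u = x.2 v) (fun u _ => hx.1.piece u)
      (fun u _ => hy.1.piece u) (fun u hu u' hu' huu => by
        simp only [Finset.mem_filter, Finset.mem_univ, true_and] at hu hu'
        exact pieceColorings.disjoint hx.2 huu (hu.trans hu'.symm))
      (fun u hu u' hu' huu => by
        simp only [Finset.mem_filter, Finset.mem_univ, true_and] at hu hu'
        exact pieceColorings.disjoint hy.2 huu (hu.trans hu'.symm))
      (fun X _ => congrFun (congrFun h (x.2 v)) X) (v := v) (by simp)
    simp only [Finset.mem_filter, Finset.mem_univ, true_and] at hw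
    exact ⟨w, by rw [hwv, hw]⟩
  obtain ⟨e, he⟩ := exists_equiv_of_injective (colDec.injective hx) (colDec.injective hy)
    (key hx hy h) (key hy hx h.symm)
  exact ⟨e, fun v => Prod.mk.inj (he v)⟩

theorem ncard_colDec_eq (E : Finset α) (ρ : Finset α → ℤ) (n k : ℕ) :
    (colDec E ρ n k).ncard = (assemble '' colDec E ρ n k).ncard * n.factorial := by
  classical
  have hc := finite_colDec E ρ n k
  have hf := hc.image assemble
  rw [Set.ncard_eq_toFinset_card _ hf, Set.ncard_eq_toFinset_card _ hc]
  rw [Finset.card_eq_sum_card_fiberwise (f := assemble) (t := hf.toFinset)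
    (fun x hx => by simpa using ⟨x.1, x.2, hc.mem_toFinset.1 hx, rfl⟩), Finset.sum_const_nat]
  intro M hM
  rw [Set.Finite.mem_toFinset] at hM
  obtain ⟨x, hx, rfl⟩ := hM
  have h1 : n.factorial = Fintype.card (Equiv.Perm (Fin n)) := by
    rw [Fintype.card_perm, Fintype.card_fin]
  rw [h1, ← Finset.card_univ, ← Finset.card_image_of_injective (f := fun e : Equiv.Perm (Fin n) =>
    (x.1 ∘ e, x.2 ∘ e))]
  · congr 1
    ext y
    simp only [Finset.mem_filter, Set.Finite.mem_toFinset, Finset.mem_image, Finset.mem_univ,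
      true_and]
    constructor
    · rintro ⟨hy, h⟩
      obtain ⟨e, he⟩ := exists_equiv_of_assemble_eq hy hx h
      exact ⟨e, Prod.ext (funext fun v => (he v).1) (funext fun v => (he v).2)⟩
    · rintro ⟨e, rfl⟩
      refine ⟨⟨hx.1.comp e, fun v w hvw hd =>
        hx.2 (e v) (e w) (fun h => hvw (e.injective h)) hd⟩, ?_⟩
      funext i X
      simp only [assemble, Function.comp_apply, Finset.sum_filter]
      exact Equiv.sum_comp e fun v => if x.2 v = i then x.1 v X else 0
  · intro e e' h
    ext v
    have h1 := congrFun (congrArg Prod.fst h) v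
    have h2 := congrFun (congrArg Prod.snd h) v
    exact congrArg _ (colDec.injective hx (Prod.ext h1 h2))

theorem Piece.one_le {E : Finset α} {r : Finset α → ℤ} (h : Piece E r) : 1 ≤ r E := by
  obtain ⟨e, he⟩ := h.ne
  rw [← h.eq_one he]
  exact h.mono (by simpa using supp_subset _ _ he)

theorem Dec.card_le {E : Finset α} {ρ : Finset α → ℤ} {n : ℕ} {P : Fin n → Finset α → ℤ}
    (h : Dec E ρ P) : n ≤ (ρ E).toNat := by
  have h1 : ∑ _v : Fin n, (1 : ℤ) ≤ ∑ v, P v E :=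
    Finset.sum_le_sum fun v _ => (h.piece v).one_le
  rw [← h.sum E subset_rfl] at h1
  simp only [Finset.sum_const, Finset.card_univ, Fintype.card_fin, mul_one,
    nsmul_eq_mul] at h1
  omega

theorem ncard_Delta (E : Finset α) (ρ : Finset α → ℤ) (k : ℕ) :
    ((Delta k E ρ).ncard : ℚ) =
      ∑ n ∈ Finset.range ((ρ E).toNat + 1), ((colDec E ρ n k).ncard : ℚ) / n.factorial := by
  classical
  have h1 : Delta k E ρ = ((Finset.range ((ρ E).toNat + 1)).biUnion fun n =>
      ((finite_colDec E ρ n k).image assemble).toFinset : Finset _) := by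
    ext M
    simp only [Finset.coe_biUnion, Finset.coe_range, Set.mem_Iio, Set.Finite.coe_toFinset,
      Set.mem_iUnion, exists_prop]
    constructor
    · intro hM
      obtain ⟨n, x, hx, h⟩ := exists_assemble hM
      exact ⟨n, Nat.lt_succ_of_le hx.1.card_le, x, hx, h⟩
    · rintro ⟨n, -, x, hx, rfl⟩
      exact assemble_mem hx
  rw [h1, Set.ncard_coe_finset, Finset.card_biUnion]
  · push_cast
    refine Finset.sum_congr rfl fun n _ => ?_
    rw [ncard_colDec_eq, Set.ncard_eq_toFinset_card _ ((finite_colDec E ρ n k).image assemble)]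
    push_cast
    field_simp
  · intro n _ m _ hnm
    simp only [Function.onFun]
    rw [Finset.disjoint_left]
    intro M hM hM'
    rw [Set.Finite.mem_toFinset] at hM hM'
    obtain ⟨x, hx, rfl⟩ := hM
    obtain ⟨y, hy, h⟩ := hM'
    obtain ⟨e, -⟩ := exists_equiv_of_assemble_eq hx hy h.symm
    exact hnm (by simpa using Fintype.card_congr e)

end Count

section Chrom

/-- `f` is a rational multiple of the number of colorings of a graph. -/
def Chrom (f : ℕ → ℚ) : Prop :=
  ∃ (n : ℕ) (G : SimpleGraph (Fin n)) (s : ℚ), ∀ k : ℕ, 0 < k →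
    f k = s * ({c : Fin n → Fin k | ProperColoring G c}.ncard : ℚ)

theorem Chrom.of_graph {f : ℕ → ℚ} {V : Type} [Fintype V] (G : SimpleGraph V) (s : ℚ)
    (h : ∀ k : ℕ, 0 < k → f k = s * ({c : V → Fin k | ProperColoring G c}.ncard : ℚ)) :
    Chrom f := by
  let e := Fintype.equivFin V
  refine ⟨Fintype.card V, G.comap e.symm, s, fun k hk => ?_⟩
  rw [h k hk]
  congr 2
  refine Set.ncard_congr (fun c _ => c ∘ e.symm) ?_ ?_ ?_
  · intro c hc u v huv
    exact hc _ _ huv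
  · intro c c' _ _ hcc
    funext v
    have := congrFun hcc (e v)
    simpa using this
  · intro c hc
    refine ⟨c ∘ e, fun v w hvw => ?_, by funext v; simp⟩
    exact hc (e v) (e w) (by simpa using hvw)

theorem Chrom.mul {f g : ℕ → ℚ} (hf : Chrom f) (hg : Chrom g) : Chrom fun k => f k * g k := by
  obtain ⟨n, G, s, hf⟩ := hf
  obtain ⟨m, H, t, hg⟩ := hg
  refine Chrom.of_graph (G ⊕g H) (s * t) fun k hk => ?_
  rw [hf k hk, hg k hk]
  have : {c : Fin n ⊕ Fin m → Fin k | ProperColoring (G ⊕g H) c}.ncard =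
      ({c : Fin n → Fin k | ProperColoring G c} ×ˢ
        {c : Fin m → Fin k | ProperColoring H c}).ncard := by
    refine Set.ncard_congr (fun c _ => (c ∘ Sum.inl, c ∘ Sum.inr)) ?_ ?_ ?_
    · intro c hc
      exact ⟨fun u v huv => hc _ _ (by simpa using huv), fun u v huv => hc _ _ (by simpa using huv)⟩
    · intro c c' _ _ h
      simp only [Prod.mk.injEq] at h
      funext v
      rcases v with v | v
      · exact congrFun h.1 v
      · exact congrFun h.2 v
    · rintro ⟨c, d⟩ ⟨hc, hd⟩
      refine ⟨Sum.elim c d, fun u v huv => ?_, by simp⟩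
      rcases u with u | u <;> rcases v with v | v
      · exact hc u v (by simpa using huv)
      · simp at huv
      · simp at huv
      · exact hd u v (by simpa using huv)
  rw [this, Set.ncard_prod]
  push_cast
  ring

variable [DecidableEq α]

theorem ncard_Delta_union {E₁ E₂ : Finset α} {ρ : Finset α → ℤ}
    (hd : Disjoint E₁ E₂) (hρ : IsPM ρ) (h : ρ E₁ + ρ E₂ ≤ ρ (E₁ ∪ E₂)) (k : ℕ) :
    (Delta k (E₁ ∪ E₂) ρ).ncard = (Delta k E₁ ρ).ncard * (Delta k E₂ ρ).ncard := by
  have split : ∀ M ∈ Delta k (E₁ ∪ E₂) ρ, ∀ i X, M i X = M i (X ∩ E₁) + M i (X ∩ E₂) := by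
    intro M hM i X
    obtain ⟨h1, h2, h3⟩ := mem_Delta.1 hM
    have h4 : ∀ j, 0 ≤ M j E₁ + M j E₂ - M j (E₁ ∪ E₂) := fun j => (h1 j).loc_nonneg E₁ E₂
    have h5 : ∑ j, (M j E₁ + M j E₂ - M j (E₁ ∪ E₂)) = 0 := by
      refine le_antisymm ?_ (Finset.sum_nonneg fun j _ => h4 j)
      rw [Finset.sum_sub_distrib, Finset.sum_add_distrib, ← h3 _ subset_rfl,
        ← h3 _ Finset.subset_union_left, ← h3 _ Finset.subset_union_right]
      linarith
    have h6 := (Finset.sum_eq_zero_iff_of_nonneg fun j _ => h4 j).1 h5 i (Finset.mem_univ i)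
    rw [h2, Finset.inter_union_distrib_left]
    exact (h1 i).sep (by linarith) Finset.inter_subset_right Finset.inter_subset_right
  rw [← Set.ncard_prod]
  refine Set.ncard_congr (fun M _ => (fun i X => M i (X ∩ E₁), fun i X => M i (X ∩ E₂))) ?_ ?_ ?_
  · intro M hM
    obtain ⟨h1, h2, h3⟩ := mem_Delta.1 hM
    refine ⟨mem_Delta.2 ⟨fun i => (h1 i).restrict E₁, fun i X => ?_, fun X hX => ?_⟩,
      mem_Delta.2 ⟨fun i => (h1 i).restrict E₂, fun i X => ?_, fun X hX => ?_⟩⟩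
    · simp
    · simp only [Finset.inter_eq_left.2 hX]
      exact h3 X (hX.trans Finset.subset_union_left)
    · simp
    · simp only [Finset.inter_eq_left.2 hX]
      exact h3 X (hX.trans Finset.subset_union_right)
  · intro M M' hM hM' h
    simp only [Prod.mk.injEq] at h
    funext i X
    have h1 := congrFun (congrFun h.1 i) X
    have h2 := congrFun (congrFun h.2 i) X
    rw [split M hM, split M' hM']
    exact congrArg₂ _ h1 h2
  · rintro ⟨M, N⟩ ⟨hM, hN⟩
    change M ∈ Delta k E₁ ρ at hM
    change N ∈ Delta k E₂ ρ at hN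
    obtain ⟨m1, m2, m3⟩ := mem_Delta.1 hM
    obtain ⟨n1, n2, n3⟩ := mem_Delta.1 hN
    have hMz : ∀ i X, Disjoint X E₁ → M i X = 0 := fun i X hX => by
      rw [m2, Finset.disjoint_iff_inter_eq_empty.1 hX, (m1 i).empty]
    have hNz : ∀ i X, Disjoint X E₂ → N i X = 0 := fun i X hX => by
      rw [n2, Finset.disjoint_iff_inter_eq_empty.1 hX, (n1 i).empty]
    have hD := Finset.disjoint_left.1 hd
    refine ⟨fun i X => M i X + N i X, mem_Delta.2 ⟨fun i => ?_, fun i X => ?_, fun X hX => ?_⟩, ?_⟩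
    · refine ⟨⟨by rw [(m1 i).empty, (n1 i).empty, add_zero], fun hAB =>
        add_le_add ((m1 i).mono hAB) ((n1 i).mono hAB), fun A B => ?_⟩, fun e => ?_⟩
      · have := (m1 i).submod A B
        have := (n1 i).submod A B
        linarith
      · by_cases he : e ∈ E₁
        · rw [hNz i {e} (by simpa using hD he), add_zero]
          exact (m1 i).unit e
        · rw [hMz i {e} (by simpa using he), zero_add]
          exact (n1 i).unit e
    · rw [m2 i X, n2 i X, m2 i (X ∩ (E₁ ∪ E₂)), n2 i (X ∩ (E₁ ∪ E₂)), Finset.inter_assoc,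
        Finset.inter_assoc, Finset.union_inter_cancel_left, Finset.union_inter_cancel_right]
    · rw [Finset.sum_add_distrib]
      have h1 : X = X ∩ E₁ ∪ X ∩ E₂ := by
        rw [← Finset.inter_union_distrib_left, Finset.inter_eq_left.2 hX]
      have h2 := hρ.sep h (X := X ∩ E₁) (Y := X ∩ E₂) Finset.inter_subset_right
        Finset.inter_subset_right
      rw [← h1, m3 _ Finset.inter_subset_right, n3 _ Finset.inter_subset_right] at h2
      rw [h2]
      congr 1
      · exact Finset.sum_congr rfl fun i _ => (m2 i X).symm
      · exact Finset.sum_congr rfl fun i _ => (n2 i X).symm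
    · simp only [Prod.mk.injEq]
      constructor
      · funext i X
        rw [hNz i (X ∩ E₁) (hd.mono_left Finset.inter_subset_right), add_zero, ← m2]
      · funext i X
        rw [hMz i (X ∩ E₂) (hd.symm.mono_left Finset.inter_subset_right), zero_add, ← n2]

theorem ncard_Delta_eq_one {E : Finset α} {ρ : Finset α → ℤ} (hρ : IsPM ρ) (h : ρ E = 0) (k : ℕ) :
    (Delta k E ρ).ncard = 1 := by
  rw [Set.ncard_eq_one]
  refine ⟨fun _ _ => 0, Set.eq_singleton_iff_unique_mem.2 ⟨?_, fun M hM => ?_⟩⟩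
  · refine mem_Delta.2 ⟨fun i => ⟨⟨rfl, fun _ => le_rfl, fun _ _ => by simp⟩, fun _ => zero_le_one⟩,
      fun _ _ => rfl, fun X hX => ?_⟩
    have h1 := hρ.mono hX
    have h2 := hρ.nonneg X
    simp only [Finset.sum_const_zero]
    linarith
  · obtain ⟨h1, h2, h3⟩ := mem_Delta.1 hM
    funext i X
    have h4 := h3 E subset_rfl
    rw [h] at h4
    have h5 := (Finset.sum_eq_zero_iff_of_nonneg fun j _ => (h1 j).nonneg E).1 h4.symm i
      (Finset.mem_univ i)
    have h6 := (h1 i).mono (Finset.inter_subset_right (s₁ := X) (s₂ := E))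
    have h7 := (h1 i).nonneg (X ∩ E)
    rw [h2]
    linarith

end Chrom

section Overlap

variable [DecidableEq α]

theorem IsPM.lam_nonneg {r : Finset α → ℤ} (hr : IsPM r) (e f : α) {X : Finset α} :
    0 ≤ lam r e f X ∨ e ∈ X ∨ f ∈ X ∨ e = f := by
  by_cases h : e ∈ X ∨ f ∈ X ∨ e = f
  · exact Or.inr h
  · left
    push Not at h
    have := hr.sm (A := insert e X) (B := insert f X) (U := insert e (insert f X)) (I := X)
      (by grind) (by grind)
    simp only [lam]
    linarith

theorem Piece.insert {E : Finset α} {r : Finset α → ℤ} (h : Piece E r) {e : α}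
    (he : e ∉ supp E r) (X : Finset α) : r (insert e X) = r X := by
  rw [h.inter_supp h.norm, h.inter_supp h.norm X, Finset.insert_inter_of_notMem he]

theorem Piece.lam_eq_zero {E : Finset α} {r : Finset α → ℤ} (h : Piece E r) {e f : α}
    (hef : e ∉ supp E r ∨ f ∉ supp E r) (X : Finset α) : lam r e f X = 0 := by
  rcases hef with he | hf
  · rw [lam, h.insert he, h.insert he]
    ring
  · rw [lam_comm, lam, h.insert hf, h.insert hf]
    ring

namespace Dec

variable {E : Finset α} {ρ : Finset α → ℤ} {ι ι' : Type} [Fintype ι] [Fintype ι']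
  {P : ι → Finset α → ℤ} {Q : ι' → Finset α → ℤ}

theorem deg (h : Dec E ρ P) {e : α} (he : e ∈ E) :
    ρ {e} = ((Finset.univ.filter fun v => e ∈ supp E (P v)).card : ℤ) := by
  rw [h.sum _ (by simpa using he), Finset.card_filter]
  push_cast
  refine Finset.sum_congr rfl fun v _ => ?_
  split_ifs with hv
  · exact (h.piece v).eq_one hv
  · exact (h.piece v).eq_zero_of_notMem hv

theorem exists_mem (h : Dec E ρ P) {e : α} (he : e ∈ E) (hpos : 0 < ρ {e}) :
    ∃ v, e ∈ supp E (P v) := by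
  rw [h.deg he] at hpos
  obtain ⟨v, hv⟩ := Finset.card_pos.1 (by exact_mod_cast hpos)
  exact ⟨v, by simpa using hv⟩

theorem pos_of_mem (h : Dec E ρ P) {e : α} {v : ι} (hv : e ∈ supp E (P v)) : 0 < ρ {e} := by
  rw [h.deg (supp_subset _ _ hv)]
  exact_mod_cast Finset.card_pos.2 ⟨v, by simpa using hv⟩

theorem eq_or_eq (h : Dec E ρ P) {e : α} (h2 : ∀ e ∈ E, ρ {e} ≤ 2) {u v w : ι}
    (hu : e ∈ supp E (P u)) (hv : e ∈ supp E (P v)) (huv : u ≠ v)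
    (hw : e ∈ supp E (P w)) : w = u ∨ w = v := by
  by_contra hne
  push Not at hne
  have h3 := h2 e (supp_subset _ _ hu)
  rw [h.deg (supp_subset _ _ hu)] at h3
  have h4 : 2 < (Finset.univ.filter fun v => e ∈ supp E (P v)).card :=
    Finset.two_lt_card.2 ⟨w, by simpa using hw, u, by simpa using hu, v, by simpa using hv,
      hne.1, hne.2, huv⟩
  omega

theorem two_le (h : Dec E ρ P) {e : α} {u v : ι} (hu : e ∈ supp E (P u)) (hv : e ∈ supp E (P v))
    (huv : u ≠ v) : 2 ≤ ρ {e} := by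
  rw [h.deg (supp_subset _ _ hu)]
  exact_mod_cast Finset.one_lt_card.2 ⟨u, by simpa using hu, v, by simpa using hv, huv⟩

theorem exists_ne (h : Dec E ρ P) {e : α} (he : e ∈ E) (h2 : 2 ≤ ρ {e}) (v : ι) :
    ∃ w, w ≠ v ∧ e ∈ supp E (P w) := by
  rw [h.deg he] at h2
  obtain ⟨w, hw, hwv⟩ := Finset.exists_mem_ne (by exact_mod_cast h2) v
  exact ⟨w, hwv, by simpa using hw⟩

theorem lam_eq (h : Dec E ρ P) {e f : α} (he : e ∈ E) (hf : f ∈ E) {X : Finset α} (hX : X ⊆ E) :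
    lam ρ e f X = ∑ v, lam (P v) e f X := by
  simp only [lam, Finset.sum_sub_distrib, Finset.sum_add_distrib]
  rw [h.sum X hX, h.sum _ (Finset.insert_subset he hX), h.sum _ (Finset.insert_subset hf hX),
    h.sum _ (Finset.insert_subset he (Finset.insert_subset hf hX))]

theorem lam_eq_of_unique (h : Dec E ρ P) {e f : α} (he : e ∈ E) (hf : f ∈ E) {v : ι}
    (hv : ∀ w, e ∈ supp E (P w) → f ∈ supp E (P w) → w = v) {X : Finset α} (hX : X ⊆ E) :
    lam ρ e f X = lam (P v) e f X := by
  rw [h.lam_eq he hf hX]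
  refine Finset.sum_eq_single_of_mem v (Finset.mem_univ v) fun w _ hw => ?_
  refine (h.piece w).lam_eq_zero ?_ X
  by_contra hef
  push Not at hef
  exact hw (hv w hef.1 hef.2)

theorem shared_congr (h : Dec E ρ P) (h' : Dec E ρ Q) {e f : α} {v : ι} (he : e ∈ supp E (P v))
    (hf : f ∈ supp E (P v)) : ∃ w, e ∈ supp E (Q w) ∧ f ∈ supp E (Q w) := by
  have heE := supp_subset _ _ he
  have hfE := supp_subset _ _ hf
  by_cases hef : e = f
  · subst hef
    obtain ⟨w, hw⟩ := h'.exists_mem heE (h.pos_of_mem he)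
    exact ⟨w, hw, hw⟩
  · obtain ⟨X, hX, heX, hfX, hlam⟩ := (h.piece v).conn.exists_lam (h.piece v).toIsRk he hf hef
    have hXE := hX.trans (supp_subset _ _)
    have h1 : lam (P v) e f X ≤ lam ρ e f X := by
      rw [h.lam_eq heE hfE hXE]
      refine Finset.single_le_sum (f := fun v => lam (P v) e f X) (fun w _ => ?_)
        (Finset.mem_univ v)
      rcases (h.piece w).lam_nonneg e f (X := X) with h0 | h0 | h0 | h0
      · exact h0
      · exact absurd h0 heX
      · exact absurd h0 hfX
      · exact absurd h0 hef
    by_contra hw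
    push Not at hw
    rw [h'.lam_eq heE hfE hXE, Finset.sum_eq_zero fun w _ => (h'.piece w).lam_eq_zero ?_ X] at h1
    · linarith
    · by_contra h0
      push Not at h0
      exact hw w h0.1 h0.2

theorem eq_of_closed (h : Dec E ρ P) (hc : Conn ρ E) {W : Finset α} (hW : W ⊆ E)
    (hne : W.Nonempty) (hv : ∀ v, supp E (P v) ⊆ W ∨ Disjoint (supp E (P v)) W) : W = E := by
  by_contra hWE
  have h1 := hc W hW hne hWE
  rw [h.sum _ subset_rfl, h.sum _ hW, h.sum _ Finset.sdiff_subset, ← Finset.sum_add_distrib] at h1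
  refine absurd h1 (not_lt.2 (Finset.sum_le_sum fun v _ => ?_))
  rcases hv v with hs | hd
  · rw [(h.piece v).eq_zero (Finset.sdiff_disjoint.mono_right hs),
      (h.piece v).inter_supp (h.piece v).norm E, (h.piece v).inter_supp (h.piece v).norm W,
      Finset.inter_eq_right.2 hs, Finset.inter_eq_right.2 (supp_subset _ _), add_zero]
  · rw [(h.piece v).eq_zero hd.symm, zero_add]
    exact (h.piece v).mono Finset.sdiff_subset

theorem eq_univ_of_supp_eq (h : Dec E ρ P) (hc : Conn ρ E) (h2 : ∀ e ∈ E, ρ {e} ≤ 2) {v w : ι}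
    (hvw : v ≠ w) (hs : supp E (P v) = supp E (P w)) :
    supp E (P v) = E ∧ ∀ u, u = v ∨ u = w := by
  have h1 : ∀ u e, e ∈ supp E (P v) → e ∈ supp E (P u) → u = v ∨ u = w := fun u e he hu =>
    h.eq_or_eq h2 he (hs ▸ he) hvw hu
  have h3 : supp E (P v) = E := by
    refine h.eq_of_closed hc (supp_subset _ _) (h.piece v).ne fun u => ?_
    by_cases hu : Disjoint (supp E (P u)) (supp E (P v))
    · exact Or.inr hu
    · obtain ⟨e, he, he'⟩ := Finset.not_disjoint_iff.1 hu
      left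
      rcases h1 u e he' he with rfl | rfl
      · rfl
      · rw [hs]
  refine ⟨h3, fun u => ?_⟩
  obtain ⟨e, he⟩ := (h.piece u).ne
  exact h1 u e (by rw [h3]; exact supp_subset _ _ he) he

theorem exists_second (h : Dec E ρ P) (h' : Dec E ρ Q) {e f g : α} {x : ι}
    (he : e ∈ supp E (P x)) (hf : f ∈ supp E (P x)) (hg : g ∈ supp E (P x))
    (hno : ∀ v, e ∈ supp E (Q v) → f ∈ supp E (Q v) → g ∉ supp E (Q v)) :
    ∃ y, y ≠ x ∧ e ∈ supp E (P y) ∧ f ∈ supp E (P y) ∧ g ∈ supp E (P y) := by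
  have hef : e ≠ f := by
    rintro rfl
    obtain ⟨w, h1, h2⟩ := h.shared_congr h' he hg
    exact hno w h1 h1 h2
  have heg : e ≠ g := by
    rintro rfl
    obtain ⟨w, h1, h2⟩ := h.shared_congr h' he hf
    exact hno w h1 h2 h1
  have hfg : f ≠ g := by
    rintro rfl
    obtain ⟨w, h1, h2⟩ := h.shared_congr h' he hf
    exact hno w h1 h2 h2
  obtain ⟨X, hX, t, -, -, -, T⟩ := (h.piece x).conn.exists_tri (h.piece x).toIsRk he hf hg hef heg
    hfg
  have heE := supp_subset _ _ he
  have hfE := supp_subset _ _ hf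
  have hgE := supp_subset _ _ hg
  have hXE := hX.trans (supp_subset _ _)
  have swap : ∀ a b : α, insert a (insert b X) = insert b (insert a X) := fun a b =>
    Finset.insert_comm a b X
  have key : ∀ {r : Finset α → ℤ}, Piece E r → (e ∉ supp E r ∨ f ∉ supp E r ∨ g ∉ supp E r) →
      lam r e f X = lam r e f (insert g X) := by
    intro r hr h0
    rcases h0 with h0 | h0 | h0
    · rw [hr.lam_eq_zero (Or.inl h0), hr.lam_eq_zero (Or.inl h0)]
    · rw [hr.lam_eq_zero (Or.inr h0), hr.lam_eq_zero (Or.inr h0)]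
    · have h3 : insert e (insert f (insert g X)) = insert g (insert e (insert f X)) := by
        rw [Finset.insert_comm f g, Finset.insert_comm e g]
      simp only [lam]
      rw [h3, swap e g, swap f g, hr.insert h0, hr.insert h0, hr.insert h0, hr.insert h0]
  by_contra hy
  push Not at hy
  have h1 : lam ρ e f X = lam ρ e f (insert g X) := by
    rw [h'.lam_eq heE hfE hXE, h'.lam_eq heE hfE (Finset.insert_subset hgE hXE)]
    refine Finset.sum_congr rfl fun v _ => key (h'.piece v) ?_
    by_contra h0
    push Not at h0
    exact hno v h0.1 h0.2.1 h0.2.2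
  classical
  rw [h.lam_eq heE hfE hXE, h.lam_eq heE hfE (Finset.insert_subset hgE hXE),
    ← Finset.add_sum_erase _ _ (Finset.mem_univ x),
    ← Finset.add_sum_erase _ (fun v => lam (P v) e f (insert g X)) (Finset.mem_univ x),
    Finset.sum_congr rfl fun v hv => key (h.piece v) ?_] at h1
  · have h2 := add_right_cancel h1
    simp only [lam, T.he, T.hf, T.hg, T.hef, T.heg, T.hfg, T.hefg] at h2
    rcases T.ht with ht | ht <;> linarith
  · by_contra h0
    push Not at h0
    exact hy v (Finset.ne_of_mem_erase hv) h0.1 h0.2.1 h0.2.2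

end Dec

/-- Two pieces, both supported on all of `E`. -/
def IsPair (E : Finset α) {ι : Type} (P : ι → Finset α → ℤ) : Prop :=
  ∃ x y, x ≠ y ∧ (∀ v, v = x ∨ v = y) ∧ supp E (P x) = E ∧ supp E (P y) = E

/-- Three pieces, pairwise overlapping, such that each element of `E` is in exactly two of them. -/
structure IsTriangle (E : Finset α) {ι : Type} (P : ι → Finset α → ℤ) (a b c : ι) : Prop where
  hab : a ≠ b
  hac : a ≠ c
  hbc : b ≠ c
  all : ∀ v, v = a ∨ v = b ∨ v = c
  mem : ∀ e ∈ E, (e ∈ supp E (P a) ∧ e ∈ supp E (P b) ∧ e ∉ supp E (P c)) ∨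
    (e ∈ supp E (P a) ∧ e ∉ supp E (P b) ∧ e ∈ supp E (P c)) ∨
    (e ∉ supp E (P a) ∧ e ∈ supp E (P b) ∧ e ∈ supp E (P c))
  ab : ∃ e, e ∈ supp E (P a) ∧ e ∈ supp E (P b)
  ac : ∃ e, e ∈ supp E (P a) ∧ e ∈ supp E (P c)
  bc : ∃ e, e ∈ supp E (P b) ∧ e ∈ supp E (P c)

namespace Dec

variable {E : Finset α} {ρ : Finset α → ℤ} {ι ι' : Type} [Fintype ι] [Fintype ι']
  {P : ι → Finset α → ℤ} {Q : ι' → Finset α → ℤ}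

theorem pair_triangle (h : Dec E ρ P) (h' : Dec E ρ Q) (hc : Conn ρ E) (h2 : ∀ e ∈ E, ρ {e} ≤ 2)
    {e f g : α} {x : ι} (he : e ∈ supp E (P x)) (hf : f ∈ supp E (P x)) (hg : g ∈ supp E (P x))
    (hno : ∀ v, e ∈ supp E (Q v) → f ∈ supp E (Q v) → g ∉ supp E (Q v)) :
    IsPair E P ∧ ∃ a b c, IsTriangle E Q a b c := by
  obtain ⟨y, hyx, hey, hfy, hgy⟩ := h.exists_second h' he hf hg hno
  obtain ⟨a, hea, hfa⟩ := h.shared_congr h' he hf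
  obtain ⟨b, hfb, hgb⟩ := h.shared_congr h' hf hg
  obtain ⟨c, hec, hgc⟩ := h.shared_congr h' he hg
  have hga := hno a hea hfa
  have heb : e ∉ supp E (Q b) := fun h => hno b h hfb hgb
  have hfc : f ∉ supp E (Q c) := fun h => hno c hec h hgc
  have hab : a ≠ b := fun h => heb (h ▸ hea)
  have hac : a ≠ c := fun h => hfc (h ▸ hfa)
  have hbc : b ≠ c := fun h => hfc (h ▸ hfb)
  have pe : ∀ v, e ∈ supp E (Q v) → v = a ∨ v = c := fun v hv => h'.eq_or_eq h2 hea hec hac hv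
  have pf : ∀ v, f ∈ supp E (Q v) → v = a ∨ v = b := fun v hv => h'.eq_or_eq h2 hfa hfb hab hv
  have pg : ∀ v, g ∈ supp E (Q v) → v = b ∨ v = c := fun v hv => h'.eq_or_eq h2 hgb hgc hbc hv
  have both : ∀ u p q z, u ∈ supp E (P z) → p ∈ supp E (P z) → q ∈ supp E (P z) →
      (p ∈ supp E (P x) ∧ p ∈ supp E (P y)) → (z = x ∨ z = y) →
      (∀ v, u ∈ supp E (Q v) → p ∈ supp E (Q v) → q ∉ supp E (Q v)) →
      u ∈ supp E (P x) ∧ u ∈ supp E (P y) := by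
    intro u p q z hu hp hq hpp hz h0
    obtain ⟨w, hwz, hw, hwp, -⟩ := h.exists_second h' hu hp hq h0
    have hw' := h.eq_or_eq h2 hpp.1 hpp.2 hyx.symm hwp
    rcases hz with rfl | rfl <;> rcases hw' with rfl | rfl
    · exact absurd rfl hwz
    · exact ⟨hu, hw⟩
    · exact ⟨hw, hu⟩
    · exact absurd rfl hwz
  have main : ∀ u z, u ∈ supp E (P z) → (z = x ∨ z = y) →
      (u ∈ supp E (P x) ∧ u ∈ supp E (P y)) ∧
      ((u ∈ supp E (Q a) ∧ u ∈ supp E (Q b) ∧ u ∉ supp E (Q c)) ∨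
      (u ∈ supp E (Q a) ∧ u ∉ supp E (Q b) ∧ u ∈ supp E (Q c)) ∨
      (u ∉ supp E (Q a) ∧ u ∈ supp E (Q b) ∧ u ∈ supp E (Q c))) := by
    intro u z hu hz
    have hez : e ∈ supp E (P z) := by rcases hz with rfl | rfl <;> assumption
    have hfz : f ∈ supp E (P z) := by rcases hz with rfl | rfl <;> assumption
    have hgz : g ∈ supp E (P z) := by rcases hz with rfl | rfl <;> assumption
    have u1 : u ∈ supp E (Q a) ∨ u ∈ supp E (Q c) := by
      obtain ⟨w, hw, hw'⟩ := h.shared_congr h' hu hez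
      rcases pe w hw' with rfl | rfl
      exacts [Or.inl hw, Or.inr hw]
    have u2 : u ∈ supp E (Q a) ∨ u ∈ supp E (Q b) := by
      obtain ⟨w, hw, hw'⟩ := h.shared_congr h' hu hfz
      rcases pf w hw' with rfl | rfl
      exacts [Or.inl hw, Or.inr hw]
    have u3 : u ∈ supp E (Q b) ∨ u ∈ supp E (Q c) := by
      obtain ⟨w, hw, hw'⟩ := h.shared_congr h' hu hgz
      rcases pg w hw' with rfl | rfl
      exacts [Or.inl hw, Or.inr hw]
    by_cases ua : u ∈ supp E (Q a)
    · by_cases ub : u ∈ supp E (Q b)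
      · have uc : u ∉ supp E (Q c) := fun uc => by
          rcases h'.eq_or_eq h2 ua ub hab uc with h0 | h0
          exacts [hac h0.symm, hbc h0.symm]
        refine ⟨both u e g z hu hez hgz ⟨he, hey⟩ hz fun v hv hv' hv'' => ?_,
          Or.inl ⟨ua, ub, uc⟩⟩
        rcases pe v hv' with rfl | rfl
        exacts [hga hv'', uc hv]
      · have uc := u3.resolve_left ub
        refine ⟨both u f g z hu hfz hgz ⟨hf, hfy⟩ hz fun v hv hv' hv'' => ?_,
          Or.inr (Or.inl ⟨ua, ub, uc⟩)⟩
        rcases pf v hv' with rfl | rfl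
        exacts [hga hv'', ub hv]
    · have ub := u2.resolve_left ua
      have uc := u1.resolve_left ua
      refine ⟨both u e f z hu hez hfz ⟨he, hey⟩ hz fun v hv hv' hv'' => ?_,
        Or.inr (Or.inr ⟨ua, ub, uc⟩)⟩
      rcases pe v hv' with rfl | rfl
      exacts [ua hv, hfc hv'']
  have hs : supp E (P x) = supp E (P y) := Finset.Subset.antisymm
    (fun u hu => (main u x hu (Or.inl rfl)).1.2) (fun u hu => (main u y hu (Or.inr rfl)).1.1)
  obtain ⟨hE, hall⟩ := h.eq_univ_of_supp_eq hc h2 hyx.symm hs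
  have hmem := fun u (hu : u ∈ E) => (main u x (by rwa [hE]) (Or.inl rfl)).2
  refine ⟨⟨x, y, hyx.symm, hall, hE, hs ▸ hE⟩, a, b, c, hab, hac, hbc, fun v => ?_, hmem,
    ⟨f, hfa, hfb⟩, ⟨e, hea, hec⟩, ⟨g, hgb, hgc⟩⟩
  obtain ⟨u, hu⟩ := (h'.piece v).ne
  rcases hmem u (supp_subset _ _ hu) with ⟨h3, h4, -⟩ | ⟨h3, -, h4⟩ | ⟨-, h3, h4⟩
  · rcases h'.eq_or_eq h2 h3 h4 hab hu with h5 | h5 <;> simp [h5]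
  · rcases h'.eq_or_eq h2 h3 h4 hac hu with h5 | h5 <;> simp [h5]
  · rcases h'.eq_or_eq h2 h3 h4 hbc hu with h5 | h5 <;> simp [h5]

theorem helly (h : Dec E ρ P) (h2 : ∀ e ∈ E, ρ {e} ≤ 2) {S : Finset α} (hne : S.Nonempty)
    (hS : ∀ e ∈ S, ∀ f ∈ S, ∀ g ∈ S, ∃ v, e ∈ supp E (P v) ∧ f ∈ supp E (P v) ∧
      g ∈ supp E (P v)) : ∃ v, S ⊆ supp E (P v) := by
  obtain ⟨e, he⟩ := hne
  obtain ⟨v, hv, -⟩ := hS e he e he e he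
  by_contra hno
  push Not at hno
  obtain ⟨f, hf, hfv⟩ := Finset.not_subset.1 (hno v)
  obtain ⟨w, hw, hfw, -⟩ := hS e he f hf f hf
  obtain ⟨g, hg, hgw⟩ := Finset.not_subset.1 (hno w)
  obtain ⟨u, hu, hfu, hgu⟩ := hS e he f hf g hg
  have hvw : v ≠ w := fun h => hfv (h ▸ hfw)
  rcases h.eq_or_eq h2 hv hw hvw hu with rfl | rfl
  exacts [hfv hfu, hgw hgu]

theorem cov_congr (h : Dec E ρ P) (h' : Dec E ρ Q) (hc : Conn ρ E) (h2 : ∀ e ∈ E, ρ {e} ≤ 2)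
    (hK : ∀ a b c, ¬ IsTriangle E Q a b c) {S : Finset α} (hne : S.Nonempty) {v : ι}
    (hv : S ⊆ supp E (P v)) : ∃ w, S ⊆ supp E (Q w) := by
  refine h'.helly h2 hne fun e he f hf g hg => ?_
  by_contra hno
  push Not at hno
  obtain ⟨-, a, b, c, hT⟩ := h.pair_triangle h' hc h2 (hv he) (hv hf) (hv hg) hno
  exact hK a b c hT

end Dec

end Overlap

section Conclude

/-- The graph whose vertices are the pieces, overlapping pieces being adjacent. -/
def pieceGraph (E : Finset α) {ι : Type} (P : ι → Finset α → ℤ) : SimpleGraph ι where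
  Adj v w := v ≠ w ∧ ¬ Disjoint (supp E (P v)) (supp E (P w))
  symm := ⟨fun _ _ h => ⟨h.1.symm, fun hd => h.2 hd.symm⟩⟩
  loopless := ⟨fun _ h => h.1 rfl⟩

theorem pieceColorings_eq {E : Finset α} {ι : Type} (P : ι → Finset α → ℤ) (k : ℕ) :
    pieceColorings E P k = {c : ι → Fin k | ProperColoring (pieceGraph E P) c} := by
  ext c
  exact ⟨fun h u v huv => h u v huv.1 huv.2, fun h u v h1 h2 => h u v ⟨h1, h2⟩⟩

theorem chrom_add {E : Finset α} {ι : Type} [Fintype ι] {P : ι → Finset α → ℤ} {p q t : ι} (hpq : p ≠ q)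
    (hpt : p ≠ t) (hqt : q ≠ t) (hall : ∀ v, v = p ∨ v = q ∨ v = t)
    (opq : ¬ Disjoint (supp E (P p)) (supp E (P q)))
    (opt : ¬ Disjoint (supp E (P p)) (supp E (P t))) :
    Chrom fun k => ((pieceColorings E P k).ncard : ℚ) +
      ({c : Fin 2 → Fin k | c 0 ≠ c 1}.ncard : ℚ) := by
  classical
  refine Chrom.of_graph ((pieceGraph E P).deleteEdges {s(p, q)}) 1 fun k _ => ?_
  set A := {c : ι → Fin k | ProperColoring ((pieceGraph E P).deleteEdges {s(p, q)}) c} with hA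
  have h1 : pieceColorings E P k = A ∩ {c | c p ≠ c q} := by
    ext c
    rw [pieceColorings_eq]
    constructor
    · intro hc
      exact ⟨fun u v huv => hc u v ((SimpleGraph.deleteEdges_adj).1 huv).1, hc p q ⟨hpq, opq⟩⟩
    · rintro ⟨hc, hcpq⟩ u v huv
      by_cases h : s(u, v) = s(p, q)
      · rcases Sym2.eq_iff.1 h with ⟨rfl, rfl⟩ | ⟨rfl, rfl⟩
        exacts [hcpq, Ne.symm hcpq]
      · exact hc u v ((SimpleGraph.deleteEdges_adj).2 ⟨huv, h⟩)
  have h2 : {c : Fin 2 → Fin k | c 0 ≠ c 1}.ncard = (A \ {c | c p ≠ c q}).ncard := by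
    symm
    refine Set.ncard_congr (fun c _ => ![c p, c t]) ?_ ?_ ?_
    · rintro c ⟨hc, -⟩
      refine hc p t ((SimpleGraph.deleteEdges_adj).2 ⟨⟨hpt, opt⟩, fun h => ?_⟩)
      rcases Sym2.eq_iff.1 h with h | h
      exacts [hqt h.2.symm, hpq h.1]
    · rintro c c' ⟨-, hc⟩ ⟨-, hc'⟩ h
      have hcq : c p = c q := not_not.1 hc
      have hcq' : c' p = c' q := not_not.1 hc'
      have e0 : c p = c' p := congrFun h 0
      have e1 : c t = c' t := congrFun h 1
      funext v
      rcases hall v with rfl | rfl | rfl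
      exacts [e0, by rw [← hcq, ← hcq', e0], e1]
    · intro d hd
      refine ⟨fun v => if v = t then d 1 else d 0, ⟨fun u v huv => ?_, ?_⟩, ?_⟩
      · obtain ⟨huv, hn⟩ := (SimpleGraph.deleteEdges_adj).1 huv
        have hd' : d 0 ≠ d 1 := hd
        by_cases hu : u = t <;> by_cases hv : v = t
        · exact absurd (hu.trans hv.symm) huv.1
        · simpa [hu, hv] using hd'.symm
        · simpa [hu, hv] using hd'
        · refine absurd ?_ hn
          have hu' := (or_assoc.2 (hall u)).resolve_right hu
          have hv' := (or_assoc.2 (hall v)).resolve_right hv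
          have hne := huv.1
          rcases hu' with rfl | rfl <;> rcases hv' with rfl | rfl <;> simp_all [Sym2.eq_swap]
      · simp [hpt, hqt]
      · funext i
        fin_cases i <;> simp [hpt]
  rw [one_mul, h1, h2, ← Nat.cast_add, Set.ncard_inter_add_ncard_sdiff_eq_ncard]

variable [DecidableEq α] {E : Finset α} {ρ : Finset α → ℤ}

theorem chrom_of_same (h : ∀ n m (P : Fin n → Finset α → ℤ) (Q : Fin m → Finset α → ℤ),
    Dec E ρ P → Dec E ρ Q → ∀ k, (pieceColorings E P k).ncard = (pieceColorings E Q k).ncard) :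
    Chrom fun k => ((Delta k E ρ).ncard : ℚ) := by
  by_cases hex : ∃ n, ∃ P : Fin n → Finset α → ℤ, Dec E ρ P
  · obtain ⟨n, P, hP⟩ := hex
    refine ⟨n, pieceGraph E P, ∑ m ∈ Finset.range ((ρ E).toNat + 1),
      ({Q : Fin m → Finset α → ℤ | Dec E ρ Q}.ncard : ℚ) / m.factorial, fun k _ => ?_⟩
    beta_reduce
    rw [ncard_Delta, Finset.sum_mul, ← pieceColorings_eq]
    refine Finset.sum_congr rfl fun m _ => ?_
    rw [ncard_colDec (m := (pieceColorings E P k).ncard) fun Q hQ => h m n Q P hQ hP k]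
    push_cast
    ring
  · push Not at hex
    refine ⟨0, ⊥, 0, fun k _ => ?_⟩
    beta_reduce
    rw [ncard_Delta, zero_mul]
    refine Finset.sum_eq_zero fun m _ => ?_
    rw [ncard_colDec (m := 0) fun Q hQ => absurd hQ (hex m Q)]
    simp

theorem chrom_of_three {P : Fin 3 → Finset α → ℤ} (hP : Dec E ρ P) (hi : P.Injective) {p q t : Fin 3}
    (hpq : p ≠ q) (hpt : p ≠ t) (hqt : q ≠ t)
    (opq : ¬ Disjoint (supp E (P p)) (supp E (P q)))
    (opt : ¬ Disjoint (supp E (P p)) (supp E (P t)))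
    (hn : ∀ n (Q : Fin n → Finset α → ℤ), Dec E ρ Q → n = 2 ∨ n = 3)
    (h3 : ∀ Q : Fin 3 → Finset α → ℤ, Dec E ρ Q → ∃ e : Equiv.Perm (Fin 3), ∀ v, P (e v) = Q v)
    (h2 : ∀ Q : Fin 2 → Finset α → ℤ, Dec E ρ Q →
      ¬ Disjoint (supp E (Q 0)) (supp E (Q 1)) ∧ Q.Injective ∧
      ∀ Q' : Fin 2 → Finset α → ℤ, Dec E ρ Q' → ∃ e : Equiv.Perm (Fin 2), ∀ v, Q (e v) = Q' v) :
    Chrom fun k => ((Delta k E ρ).ncard : ℚ) := by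
  have hall : ∀ v, v = p ∨ v = q ∨ v = t := by omega
  have key : ∀ k, ((Delta k E ρ).ncard : ℚ) = ((pieceColorings E P k).ncard : ℚ) +
      ({Q : Fin 2 → Finset α → ℤ | Dec E ρ Q}.ncard : ℚ) *
        ({c : Fin 2 → Fin k | c 0 ≠ c 1}.ncard : ℚ) / 2 := by
    intro k
    have hsub : ({2, 3} : Finset ℕ) ⊆ Finset.range ((ρ E).toNat + 1) := by
      have := hP.card_le
      intro m hm
      simp only [Finset.mem_insert, Finset.mem_singleton] at hm
      rw [Finset.mem_range]
      omega
    rw [ncard_Delta, ← Finset.sum_subset hsub, Finset.sum_pair (by norm_num),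
      ncard_colDec (n := 3) (m := (pieceColorings E P k).ncard),
      ncard_colDec (n := 2) (m := {c : Fin 2 → Fin k | c 0 ≠ c 1}.ncard),
      ncard_dec_of_perm hP hi h3]
    · simp only [Nat.factorial]
      push_cast
      ring
    · intro Q hQ
      congr 1
      ext c
      constructor
      · intro hc
        exact hc 0 1 (by simp) (h2 Q hQ).1
      · intro hc v w hvw _
        have hc' : c 0 ≠ c 1 := hc
        fin_cases v <;> fin_cases w
        exacts [absurd rfl hvw, hc', hc'.symm, absurd rfl hvw]
    · intro Q hQ
      obtain ⟨e, he⟩ := h3 Q hQ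
      exact ncard_pieceColorings_congr e (fun v => by rw [he]) k
    · intro m _ hm
      rw [ncard_colDec (m := 0) fun Q hQ => ?_]
      · simp
      · rcases hn m Q hQ with rfl | rfl <;> simp at hm
  by_cases hex : ∃ Q : Fin 2 → Finset α → ℤ, Dec E ρ Q
  · obtain ⟨Q, hQ⟩ := hex
    rw [show (fun k => ((Delta k E ρ).ncard : ℚ)) = fun k => ((pieceColorings E P k).ncard : ℚ) +
      ({c : Fin 2 → Fin k | c 0 ≠ c 1}.ncard : ℚ) from funext fun k => by
        rw [key, ncard_dec_of_perm hQ (h2 Q hQ).2.1 (h2 Q hQ).2.2]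
        simp [Nat.factorial]]
    exact chrom_add hpq hpt hqt hall opq opt
  · push Not at hex
    refine ⟨3, pieceGraph E P, 1, fun k _ => ?_⟩
    beta_reduce
    have h0 : {Q : Fin 2 → Finset α → ℤ | Dec E ρ Q} = ∅ := Set.eq_empty_of_forall_notMem hex
    rw [key, h0, pieceColorings_eq]
    simp

end Conclude

section Nested

variable [DecidableEq α]

namespace Dec

variable {E : Finset α} {ρ : Finset α → ℤ} {ι ι' : Type} [Fintype ι] [Fintype ι']
  {P : ι → Finset α → ℤ} {Q : ι' → Finset α → ℤ}

theorem supp_subset_supp (h : Dec E ρ P) (h' : Dec E ρ Q) (h2 : ∀ e ∈ E, ρ {e} ≤ 2) {L : Finset α}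
    {v w : ι} {v' w' : ι'} (hw : L ⊆ supp E (P w)) (hw' : L ⊆ supp E (Q w'))
    (hL : ∀ X ⊆ L, P w X = Q w' X) (hv : v ≠ w) (hv' : v' ≠ w') (hvL : supp E (P v) ⊆ L)
    {e : α} (he : e ∈ supp E (P v)) (he' : e ∈ supp E (Q v')) :
    supp E (P v) ⊆ supp E (Q v') := by
  classical
  set S := supp E (P v) with hS
  set K := supp E (Q v') with hK
  have hSE : S ⊆ E := supp_subset _ _
  have hP : ∀ X ⊆ S, ρ X = P w X + P v X := by
    intro X hX
    rw [h.sum X (hX.trans hSE)]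
    refine Finset.sum_eq_add_of_mem w v (Finset.mem_univ _) (Finset.mem_univ _) hv.symm
      fun u _ hu => (h.piece u).eq_zero (Finset.disjoint_left.2 fun f hf hfu => ?_)
    have hfv := hX hf
    rcases h.eq_or_eq h2 hfv (hw (hvL hfv)) hv hfu with h0 | h0
    exacts [hu.2 h0, hu.1 h0]
  have hQ : ∀ X ⊆ S, P v X = ∑ u ∈ Finset.univ.erase w', Q u X := by
    intro X hX
    have h3 := hP X hX
    rw [h'.sum X (hX.trans hSE), ← Finset.add_sum_erase _ _ (Finset.mem_univ w'),
      hL X (hX.trans hvL)] at h3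
    linarith
  refine (h.piece v).conn.subset_of_sep ?_ he he'
  rw [← hS, hQ _ Finset.inter_subset_left, hQ _ Finset.sdiff_subset, hQ _ subset_rfl,
    ← Finset.sum_add_distrib]
  refine Finset.sum_le_sum fun u hu => ?_
  have hu' := Finset.ne_of_mem_erase hu
  by_cases huv : u = v'
  · rw [huv, (h'.piece v').eq_zero (X := S \ K) Finset.sdiff_disjoint, add_zero]
    exact (h'.piece v').mono Finset.inter_subset_left
  · rw [(h'.piece u).eq_zero (X := S ∩ K), zero_add]
    · exact (h'.piece u).mono Finset.sdiff_subset
    · refine Finset.disjoint_left.2 fun f hf hfu => ?_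
      have hf' := Finset.mem_inter.1 hf
      rcases h'.eq_or_eq h2 (hw' (hvL hf'.1)) hf'.2 hv'.symm hfu with h0 | h0
      exacts [hu' h0, huv h0]

theorem injective_supp (h : Dec E ρ P) (hc : Conn ρ E) (h2 : ∀ e ∈ E, ρ {e} ≤ 2)
    (hB : ∀ v, supp E (P v) = E → ¬ ∀ e ∈ E, ρ {e} = 2) :
    Function.Injective fun v => supp E (P v) := by
  intro v w hs
  by_contra hvw
  have hs' : supp E (P v) = supp E (P w) := hs
  obtain ⟨hE, -⟩ := h.eq_univ_of_supp_eq hc h2 hvw hs'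
  refine hB v hE fun e he => le_antisymm (h2 e he) ?_
  rw [← hE] at he
  exact h.two_le he (hs' ▸ he) hvw

theorem exists_supp_eq (h : Dec E ρ P) (h' : Dec E ρ Q) (hc : Conn ρ E) (h2 : ∀ e ∈ E, ρ {e} ≤ 2)
    (hP : ∀ a b c, ¬ IsTriangle E P a b c) (hQ : ∀ a b c, ¬ IsTriangle E Q a b c)
    (hB : ∀ v, supp E (P v) = E → ¬ ∀ e ∈ E, ρ {e} = 2) (v : ι) :
    ∃ w, supp E (Q w) = supp E (P v) := by
  classical
  obtain ⟨w, hw, hmax⟩ := Finset.exists_max_image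
    (Finset.univ.filter fun w => supp E (P v) ⊆ supp E (P w)) (fun w => (supp E (P w)).card)
    ⟨v, by simp⟩
  simp only [Finset.mem_filter, Finset.mem_univ, true_and] at hw hmax
  obtain ⟨w', hw'⟩ := h.cov_congr h' hc h2 hQ (h.piece w).ne (subset_refl (supp E (P w)))
  obtain ⟨u, hu⟩ := h'.cov_congr h hc h2 hP (h'.piece w').ne (subset_refl (supp E (Q w')))
  have hwu := Finset.eq_of_subset_of_card_le (hw'.trans hu) (hmax u (hw.trans (hw'.trans hu)))
  have hs : supp E (Q w') = supp E (P w) := Finset.Subset.antisymm (hu.trans hwu.symm.subset) hw'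
  by_cases hvw : supp E (P v) = supp E (P w)
  · exact ⟨w', hs.trans hvw.symm⟩
  have hne : v ≠ w := fun h => hvw (by rw [h])
  set W := supp E (P w) with hW
  set L := W.filter fun e => ρ {e} = 2 ∧ ∀ S, e ∈ S → (∃ z, S ⊆ supp E (P z)) → S ⊆ W with hLdef
  have hLW : L ⊆ W := Finset.filter_subset _ _
  have mem_L : ∀ {e}, e ∈ L ↔ e ∈ W ∧ ρ {e} = 2 ∧
      ∀ S, e ∈ S → (∃ z, S ⊆ supp E (P z)) → S ⊆ W := by
    intro e
    rw [hLdef, Finset.mem_filter]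
  have subP : ∀ z ≠ w, supp E (P z) ⊆ W → supp E (P z) ⊆ L := by
    intro z hz hzW f hf
    refine mem_L.2 ⟨hzW hf, le_antisymm (h2 f (supp_subset _ _ hf)) (h.two_le hf (hzW hf) hz), ?_⟩
    rintro S hfS ⟨y, hy⟩
    rcases h.eq_or_eq h2 hf (hzW hf) hz (hy hfS) with rfl | rfl
    exacts [hy.trans hzW, hy]
  have subQ : ∀ z ≠ w', supp E (Q z) ⊆ W → supp E (Q z) ⊆ L := by
    intro z hz hzW f hf
    have hfw : f ∈ supp E (Q w') := hs ▸ hzW hf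
    refine mem_L.2 ⟨hzW hf, le_antisymm (h2 f (supp_subset _ _ hf)) (h'.two_le hf hfw hz), ?_⟩
    rintro S hfS ⟨y, hy⟩
    obtain ⟨y', hy'⟩ := h.cov_congr h' hc h2 hQ ⟨f, hfS⟩ hy
    rcases h'.eq_or_eq h2 hf hfw hz (hy' hfS) with rfl | rfl
    exacts [hy'.trans hzW, hs ▸ hy']
  have meetP : ∀ z ≠ w, ∀ e ∈ L, e ∈ supp E (P z) → supp E (P z) ⊆ L := fun z hz e he hez =>
    subP z hz ((mem_L.1 he).2.2 _ hez ⟨z, subset_rfl⟩)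
  have meetQ : ∀ z ≠ w', ∀ e ∈ L, e ∈ supp E (Q z) → supp E (Q z) ⊆ L := fun z hz e he hez =>
    subQ z hz ((mem_L.1 he).2.2 _ hez
      (h'.cov_congr h hc h2 hP ⟨e, hez⟩ (subset_refl (supp E (Q z)))))
  have hvL : supp E (P v) ⊆ L := subP v hne hw
  have hWE : W ⊆ E := supp_subset _ _
  have hR : (W \ L).Nonempty := by
    rw [Finset.nonempty_iff_ne_empty]
    intro h0
    have hWL : W ⊆ L := Finset.sdiff_eq_empty_iff_subset.1 h0
    have hEW : W = E := by
      refine h.eq_of_closed hc hWE (h.piece w).ne fun z => ?_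
      by_cases hz : Disjoint (supp E (P z)) W
      · exact Or.inr hz
      · obtain ⟨e, he, heW⟩ := Finset.not_disjoint_iff.1 hz
        exact Or.inl ((mem_L.1 (hWL heW)).2.2 _ he ⟨z, subset_rfl⟩)
    exact hB w hEW fun e he => (mem_L.1 (hWL (hEW.symm ▸ he))).2.1
  have hLR : L ∪ W \ L = W := Finset.union_sdiff_of_subset hLW
  have hcross : Cross (P w) (Q w') L (W \ L) := by
    refine cross_of_lam (h.piece w).empty (h'.piece w').empty (fun e he f hf Z hZ _ _ => ?_)
      Finset.disjoint_sdiff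
    rw [hLR] at hZ
    have hf' := Finset.mem_sdiff.1 hf
    rw [← h.lam_eq_of_unique (hWE (hLW he)) (hWE hf'.1) (v := w) ?_ (hZ.trans hWE),
      ← h'.lam_eq_of_unique (hWE (hLW he)) (hWE hf'.1) (v := w') ?_ (hZ.trans hWE)]
    · intro z hez hfz
      by_contra hz
      exact hf'.2 (meetQ z hz e he hez hfz)
    · intro z hez hfz
      by_contra hz
      exact hf'.2 (meetP z hz e he hez hfz)
  have heq : ∀ X ⊆ L, P w X = Q w' X := lehman (h.piece w).toIsRk (h'.piece w').toIsRk
    Finset.disjoint_sdiff hR hcross (by rw [hLR]; exact (h.piece w).conn)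
  obtain ⟨e, he⟩ := (h.piece v).ne
  obtain ⟨v', hv', hev'⟩ := h'.exists_ne (supp_subset _ _ he) (mem_L.1 (hvL he)).2.1.ge w'
  have hLW' : L ⊆ supp E (Q w') := hs ▸ hLW
  exact ⟨v', Finset.Subset.antisymm
    (h'.supp_subset_supp h h2 hLW' hLW (fun X hX => (heq X hX).symm) hv' hne
      (meetQ v' hv' e (hvL he) hev') hev' he)
    (h.supp_subset_supp h' h2 hLW hLW' heq hne hv' hvL he hev')⟩

theorem ncard_pieceColorings_eq (h : Dec E ρ P) (h' : Dec E ρ Q) (hc : Conn ρ E)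
    (h2 : ∀ e ∈ E, ρ {e} ≤ 2)
    (hP : ∀ a b c, ¬ IsTriangle E P a b c) (hQ : ∀ a b c, ¬ IsTriangle E Q a b c)
    (hB : ∀ v, supp E (P v) = E → ¬ ∀ e ∈ E, ρ {e} = 2)
    (hB' : ∀ v, supp E (Q v) = E → ¬ ∀ e ∈ E, ρ {e} = 2) (k : ℕ) :
    (pieceColorings E P k).ncard = (pieceColorings E Q k).ncard := by
  obtain ⟨e, he⟩ := exists_equiv_of_injective (h.injective_supp hc h2 hB)
    (h'.injective_supp hc h2 hB') (h.exists_supp_eq h' hc h2 hP hQ hB)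
    (h'.exists_supp_eq h hc h2 hQ hP hB')
  exact ncard_pieceColorings_congr e he k

end Dec

end Nested

section StarDec

variable [DecidableEq α]

/-- The sum of all pieces but one. -/
def rest {ι : Type} [Fintype ι] [DecidableEq ι] (P : ι → Finset α → ℤ) (a : ι) : Finset α → ℤ :=
  fun X => ∑ v ∈ Finset.univ.erase a, P v X

/-- A decomposition with a piece supported on all of `E`, in which each element of `E` is in
exactly two pieces. -/
structure StarDec (E : Finset α) (ρ : Finset α → ℤ) {ι : Type} [Fintype ι] (P : ι → Finset α → ℤ)
    (a : ι) : Prop extends Dec E ρ P where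
  conn : Conn ρ E
  two : ∀ e ∈ E, ρ {e} = 2
  center : supp E (P a) = E

namespace StarDec

variable {E : Finset α} {ρ : Finset α → ℤ} {ι ι' : Type} [Fintype ι] [Fintype ι']
  {P : ι → Finset α → ℤ} {Q : ι' → Finset α → ℤ} {a : ι} {m : ι'}

theorem le_two (h : StarDec E ρ P a) : ∀ e ∈ E, ρ {e} ≤ 2 := fun e he => (h.two e he).le

theorem nonempty (h : StarDec E ρ P a) : E.Nonempty := by
  rw [← h.center]
  exact (h.piece a).ne

theorem disjoint (h : StarDec E ρ P a) {v w : ι} (hv : v ≠ a) (hw : w ≠ a) (hvw : v ≠ w) :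
    Disjoint (supp E (P v)) (supp E (P w)) := by
  refine Finset.disjoint_left.2 fun e he he' => ?_
  rcases h.eq_or_eq h.le_two (u := a) (by rw [h.center]; exact supp_subset _ _ he) he hv.symm he'
    with h0 | h0
  exacts [hw h0, hvw h0.symm]

theorem exists_leaf (h : StarDec E ρ P a) {e : α} (he : e ∈ E) : ∃ v, v ≠ a ∧ e ∈ supp E (P v) :=
  h.exists_ne he (h.two e he).ge a

variable [DecidableEq ι] [DecidableEq ι']

theorem isRk_rest (h : StarDec E ρ P a) : IsRk (rest P a) :=
  IsRk.sum (E := E) (fun v _ => h.piece v) fun _ hv _ hw hvw =>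
    h.disjoint (Finset.ne_of_mem_erase hv) (Finset.ne_of_mem_erase hw) hvw

theorem sum_rest (h : StarDec E ρ P a) {X : Finset α} (hX : X ⊆ E) : ρ X = P a X + rest P a X := by
  rw [h.sum X hX, ← Finset.add_sum_erase _ _ (Finset.mem_univ a), rest]

theorem rest_eq (h : StarDec E ρ P a) {v : ι} (hv : v ≠ a) {X : Finset α} (hX : X ⊆ supp E (P v)) :
    rest P a X = P v X :=
  Finset.sum_eq_single_of_mem v (Finset.mem_erase.2 ⟨hv, Finset.mem_univ v⟩) fun w hw hwv =>
    (h.piece w).eq_zero ((h.disjoint hv (Finset.ne_of_mem_erase hw) hwv.symm).mono_left hX)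

theorem conn_rest (h : StarDec E ρ P a) {v : ι} (hv : v ≠ a) : Conn (rest P a) (supp E (P v)) :=
  (h.piece v).conn.congr fun _ hX => (h.rest_eq hv hX).symm

theorem sep_rest (h : StarDec E ρ P a) {v : ι} (hv : v ≠ a) :
    rest P a (supp E (P v)) + rest P a (E \ supp E (P v)) ≤ rest P a E := by
  simp only [rest]
  rw [← Finset.sum_add_distrib]
  refine Finset.sum_le_sum fun w hw => ?_
  by_cases hwv : w = v
  · rw [hwv, (h.piece v).eq_zero (X := E \ supp E (P v)) Finset.sdiff_disjoint, add_zero]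
    exact (h.piece v).mono (supp_subset _ _)
  · rw [(h.piece w).eq_zero (X := supp E (P v)) (h.disjoint hv (Finset.ne_of_mem_erase hw)
      (Ne.symm hwv)), zero_add]
    exact (h.piece w).mono Finset.sdiff_subset

theorem eq_univ_of_conn_rest (h : StarDec E ρ P a) (hc : Conn (rest P a) E) {v : ι} (hv : v ≠ a) :
    supp E (P v) = E := by
  obtain ⟨e, he⟩ := (h.piece v).ne
  refine Finset.Subset.antisymm (supp_subset _ _) (hc.subset_of_sep ?_ (supp_subset _ _ he) he)
  rw [Finset.inter_eq_right.2 (supp_subset _ _)]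
  exact h.sep_rest hv

theorem not_conn_rest (h : StarDec E ρ P a) {u v : ι} (hu : u ≠ a) (hv : v ≠ a) (huv : u ≠ v) :
    ¬ Conn (rest P a) E := by
  intro hc
  have h1 := h.disjoint hu hv huv
  rw [h.eq_univ_of_conn_rest hc hu, h.eq_univ_of_conn_rest hc hv, disjoint_self] at h1
  exact h.nonempty.ne_empty h1

theorem sum_eq (h : StarDec E ρ P a) (h' : StarDec E ρ Q m) :
    ∀ X ⊆ E, P a X + rest P a X = Q m X + rest Q m X := fun X hX => by
  rw [← h.sum_rest hX, ← h'.sum_rest hX]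

theorem ne_rest (h : StarDec E ρ P a) (h' : StarDec E ρ Q m) {u v : ι} (hu : u ≠ a) (hv : v ≠ a)
    (huv : u ≠ v) : ¬ ∀ X ⊆ E, P a X = rest Q m X := by
  intro h0
  refine h.not_conn_rest hu hv huv (Conn.congr (r := Q m) ?_ fun X hX => ?_)
  · have := (h'.piece m).conn
    rwa [h'.center] at this
  · have h1 := h.sum_eq h' X hX
    have h2 := h0 X hX
    linarith

theorem injective_of_leaves (h : StarDec E ρ P a) {u v : ι} (hu : u ≠ a) (hv : v ≠ a) (huv : u ≠ v) :
    P.Injective := by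
  intro x y hxy
  by_contra hne
  obtain ⟨-, hall⟩ := h.eq_univ_of_supp_eq h.conn h.le_two hne (by rw [hxy])
  rcases hall u with rfl | rfl <;> rcases hall v with rfl | rfl <;> rcases hall a with rfl | rfl <;>
    contradiction

theorem exists_equiv (h : StarDec E ρ P a) (h' : StarDec E ρ Q m) (hi : P.Injective)
    (h0 : ∀ X ⊆ E, P a X = Q m X) : ∃ e : ι ≃ ι', ∀ v, Q (e v) = P v := by
  have ha : P a = Q m := by
    funext X
    rw [(h.piece a).norm, (h'.piece m).norm]
    exact h0 _ Finset.inter_subset_right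
  have hr : ∀ X ⊆ E, rest P a X = rest Q m X := fun X hX => by
    have h1 := h.sum_eq h' X hX
    have h2 := h0 X hX
    linarith
  have leaf : ∀ v ≠ a, ∃ w, w ≠ m ∧ Q w = P v := by
    intro v hv
    obtain ⟨w, hw, hwv⟩ := exists_eq_of_sum_eq (fun v _ => h.piece v) (fun v _ => h'.piece v)
      (fun v hv w hw => h.disjoint (Finset.ne_of_mem_erase hv) (Finset.ne_of_mem_erase hw))
      (fun v hv w hw => h'.disjoint (Finset.ne_of_mem_erase hv) (Finset.ne_of_mem_erase hw))
      hr (Finset.mem_erase.2 ⟨hv, Finset.mem_univ v⟩)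
    exact ⟨w, Finset.ne_of_mem_erase hw, hwv⟩
  have leaf' : ∀ w ≠ m, ∃ v, v ≠ a ∧ P v = Q w := by
    intro v hv
    obtain ⟨w, hw, hwv⟩ := exists_eq_of_sum_eq (fun v _ => h'.piece v) (fun v _ => h.piece v)
      (fun v hv w hw => h'.disjoint (Finset.ne_of_mem_erase hv) (Finset.ne_of_mem_erase hw))
      (fun v hv w hw => h.disjoint (Finset.ne_of_mem_erase hv) (Finset.ne_of_mem_erase hw))
      (fun X hX => (hr X hX).symm) (Finset.mem_erase.2 ⟨hv, Finset.mem_univ v⟩)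
    exact ⟨w, Finset.ne_of_mem_erase hw, hwv⟩
  have hm : ∀ w ≠ m, Q w ≠ Q m := by
    intro w hw hwm
    obtain ⟨v, hv, hvw⟩ := leaf' w hw
    exact hv (hi (hvw.trans (hwm.trans ha.symm)))
  refine exists_equiv_of_injective hi (fun x y hxy => ?_) (fun v => ?_) fun w => ?_
  · by_cases hx : x = m
    · subst hx
      by_contra hne
      exact hm y (Ne.symm hne) hxy.symm
    · by_cases hy : y = m
      · subst hy
        exact absurd hxy (hm x hx)
      · by_contra hne
        have h1 := h'.disjoint hx hy hne
        rw [hxy, disjoint_self] at h1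
        exact (h'.piece y).ne.ne_empty h1
  · by_cases hv : v = a
    · exact ⟨m, by rw [hv, ha]⟩
    · obtain ⟨w, -, hw⟩ := leaf v hv
      exact ⟨w, hw⟩
  · by_cases hw : w = m
    · exact ⟨a, by rw [hw, ha]⟩
    · obtain ⟨v, -, hv⟩ := leaf' w hw
      exact ⟨v, hv⟩

theorem exists_equiv_of_three (h : StarDec E ρ P a) (h' : StarDec E ρ Q m) {u v w : ι} (hu : u ≠ a)
    (hv : v ≠ a) (hw : w ≠ a) (huv : u ≠ v) (huw : u ≠ w) (hvw : v ≠ w) :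
    ∃ e : ι ≃ ι', ∀ v, Q (e v) = P v := by
  refine h.exists_equiv h' (h.injective_of_leaves hu hv huv) ?_
  have hc : Conn (P a) E := by
    have := (h.piece a).conn
    rwa [h.center] at this
  have hl : ∀ i, ![u, v, w] i ≠ a := by
    intro i
    fin_cases i <;> assumption
  have hne : ∀ i j, i ≠ j → ![u, v, w] i ≠ ![u, v, w] j := by
    intro i j hij
    fin_cases i <;> fin_cases j
    exacts [absurd rfl hij, huv, huw, huv.symm, absurd rfl hij, hvw, huw.symm, hvw.symm,
      absurd rfl hij]
  refine (eq_or_eq_of_three (h.piece a).toIsRk h.isRk_rest (h'.piece m).toIsRk h'.isRk_rest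
    (h.sum_eq h') hc (fun i => supp E (P (![u, v, w] i))) (fun i => supp_subset _ _)
    (fun i => (h.piece _).ne) (fun i j hij => h.disjoint (hl i) (hl j) (hne i j hij))
    fun i => h.sep_rest (hl i)).resolve_right (h.ne_rest h' hu hv huv)

/-- The two pieces of a decomposition that mixes the pieces of a star with two leaves. -/
structure MixedPair (E : Finset α) {ι ι' : Type} [Fintype ι] [DecidableEq ι]
    (P : ι → Finset α → ℤ) (a v w : ι) (Q : ι' → Finset α → ℤ) (x y : ι') : Prop where
  ne : x ≠ y
  all : ∀ u, u = x ∨ u = y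
  left : supp E (Q x) = E
  right : supp E (Q y) = E
  mixed : Exch.Mixed (P a) (rest P a) (Q x) (Q y) (supp E (P v)) (supp E (P w))
  mixed' : Exch.Mixed (P a) (rest P a) (Q y) (Q x) (supp E (P w)) (supp E (P v))

theorem exists_equiv_or_mixedPair (h : StarDec E ρ P a) (h' : StarDec E ρ Q m) {v w : ι} (hv : v ≠ a)
    (hw : w ≠ a) (hvw : v ≠ w) (hE : supp E (P v) ∪ supp E (P w) = E) :
    (∃ e : ι ≃ ι', ∀ v, Q (e v) = P v) ∨ ∃ x y, MixedPair E P a v w Q x y := by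
  by_cases hM : ∀ X ⊆ E, P a X = Q m X
  · exact Or.inl (h.exists_equiv h' (h.injective_of_leaves hv hw hvw) hM)
  right
  have hN := h.ne_rest h' hv hw hvw
  have hc : Conn (P a) E := by
    have := (h.piece a).conn
    rwa [h.center] at this
  have hX : Exch (P a) (rest P a) (Q m) (rest Q m) (supp E (P v)) (supp E (P w)) :=
    { rA := (h.piece a).toIsRk
      rB := h.isRk_rest
      rM := (h'.piece m).toIsRk
      rN := h'.isRk_rest
      disj := h.disjoint hv hw hvw
      sum := by
        rw [hE]
        exact h.sum_eq h'
      sep := by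
        have h1 := h.sep_rest hv
        have h2 : E \ supp E (P v) = supp E (P w) := by
          refine Eq.trans (congrArg (· \ supp E (P v)) hE.symm) ?_
          exact (Finset.union_sdiff_left _ _).trans
            (Finset.sdiff_eq_self_of_disjoint (h.disjoint hw hv hvw.symm))
        rw [h2] at h1
        rwa [hE] }
  have m1 : Exch.Mixed (P a) (rest P a) (Q m) (rest Q m) (supp E (P v)) (supp E (P w)) ∨
      Exch.Mixed (P a) (rest P a) (rest Q m) (Q m) (supp E (P v)) (supp E (P w)) := by
    refine (hX.unmixed_or_mixed (h.conn_rest hv) (by rwa [hE]) (h.piece v).ne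
      (h.piece w).ne).resolve_left ?_
    rw [hE]
    rintro (h0 | h0)
    exacts [hM h0, hN h0]
  have hE' : supp E (P w) ∪ supp E (P v) = E := by rw [Finset.union_comm, hE]
  have m2 : Exch.Mixed (P a) (rest P a) (Q m) (rest Q m) (supp E (P w)) (supp E (P v)) ∨
      Exch.Mixed (P a) (rest P a) (rest Q m) (Q m) (supp E (P w)) (supp E (P v)) := by
    refine (hX.symm.unmixed_or_mixed (h.conn_rest hw) (by rwa [hE']) (h.piece w).ne
      (h.piece v).ne).resolve_left ?_
    rw [hE']
    rintro (h0 | h0)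
    exacts [hM h0, hN h0]
  have fin : Conn (rest Q m) E → ∃ y, y ≠ m ∧ (∀ u, u = m ∨ u = y) ∧ supp E (Q y) = E ∧
      rest Q m = Q y := by
    intro hcN
    obtain ⟨e, he⟩ := h'.nonempty
    obtain ⟨y, hy, -⟩ := h'.exists_leaf he
    have hyE := h'.eq_univ_of_conn_rest hcN hy
    obtain ⟨-, hall⟩ := h'.eq_univ_of_supp_eq h'.conn h'.le_two hy.symm (h'.center.trans hyE.symm)
    refine ⟨y, hy, hall, hyE, ?_⟩
    funext X
    refine Finset.sum_eq_single_of_mem y (Finset.mem_erase.2 ⟨hy, Finset.mem_univ y⟩) ?_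
    intro u hu huy
    rcases hall u with h0 | h0
    exacts [absurd h0 (Finset.ne_of_mem_erase hu), absurd h0 huy]
  rcases m1 with m1 | m1 <;> rcases m2 with m2 | m2
  · exact (m1.not_symm m2).elim
  · obtain ⟨y, hy, hall, hyE, hyr⟩ := fin (hE' ▸ m2.connM m1)
    rw [hyr] at m1 m2
    exact ⟨m, y, hy.symm, hall, h'.center, hyE, m1, m2⟩
  · obtain ⟨y, hy, hall, hyE, hyr⟩ := fin (hE ▸ m1.connM m2)
    rw [hyr] at m1 m2
    exact ⟨y, m, hy, fun u => (hall u).symm, hyE, h'.center, m1, m2⟩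
  · exact (m1.not_symm m2).elim

end StarDec

end StarDec

section StarCount

variable [DecidableEq α] {E : Finset α} {ρ : Finset α → ℤ}

namespace StarDec.MixedPair

variable {ι ι' ι'' : Type} [Fintype ι] [DecidableEq ι] {P : ι → Finset α → ℤ}
  {Q : ι' → Finset α → ℤ} {Q' : ι'' → Finset α → ℤ} {a v w : ι} {x y : ι'} {x' y' : ι''}

theorem injective (h : MixedPair E P a v w Q x y) : Q.Injective := by
  have hne : Q x ≠ Q y := fun h0 => by
    have h1 := h.mixed.eqM _ subset_rfl
    have h2 := h.mixed.eq _ subset_rfl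
    have h3 := h.mixed.lt
    rw [h0] at h1
    omega
  intro s t hst
  rcases h.all s with rfl | rfl <;> rcases h.all t with rfl | rfl
  exacts [rfl, absurd hst hne, absurd hst.symm hne, rfl]

theorem not_disjoint (h : MixedPair E P a v w Q x y) (hE : E.Nonempty) (s t : ι') :
    ¬ Disjoint (supp E (Q s)) (supp E (Q t)) := by
  have h0 : ∀ s, supp E (Q s) = E := fun s => by
    rcases h.all s with rfl | rfl
    exacts [h.left, h.right]
  rw [h0, h0, disjoint_self]
  exact hE.ne_empty

theorem exists_equiv (h : MixedPair E P a v w Q x y) (h' : MixedPair E P a v w Q' x' y')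
    (hE : supp E (P v) ∪ supp E (P w) = E) (hQ : ∀ v, Piece E (Q v)) (hQ' : ∀ v, Piece E (Q' v)) :
    ∃ e : ι' ≃ ι'', ∀ v, Q' (e v) = Q v := by
  have hE' : supp E (P w) ∪ supp E (P v) = E := by rw [Finset.union_comm, hE]
  have hx : Q' x' = Q x := by
    funext X
    rw [(hQ x).norm, (hQ' x').norm]
    exact (h.mixed.unique h.mixed' h'.mixed h'.mixed' _
      (Finset.inter_subset_right.trans hE.ge)).symm
  have hy : Q' y' = Q y := by
    funext X
    rw [(hQ y).norm, (hQ' y').norm]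
    exact (h.mixed'.unique h.mixed h'.mixed' h'.mixed _
      (Finset.inter_subset_right.trans hE'.ge)).symm
  refine exists_equiv_of_injective h.injective h'.injective (fun s => ?_) fun s => ?_
  · rcases h.all s with rfl | rfl
    exacts [⟨x', hx⟩, ⟨y', hy⟩]
  · rcases h'.all s with rfl | rfl
    exacts [⟨x, hx.symm⟩, ⟨y, hy.symm⟩]

end StarDec.MixedPair

theorem eq_two_of_forall {n : ℕ} {x y : Fin n} (hxy : x ≠ y) (h : ∀ u, u = x ∨ u = y) : n = 2 := by
  have h1 : (Finset.univ : Finset (Fin n)) = {x, y} := by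
    ext u
    simpa using h u
  have h2 := congrArg Finset.card h1
  rwa [Finset.card_pair hxy, Finset.card_univ, Fintype.card_fin] at h2

theorem StarDec.chrom_of_three {P : Fin 3 → Finset α → ℤ} {a v w : Fin 3} (h : StarDec E ρ P a)
    (hv : v ≠ a) (hw : w ≠ a) (hvw : v ≠ w)
    (hstar : ∀ n (Q : Fin n → Finset α → ℤ), Dec E ρ Q → ∃ m, StarDec E ρ Q m) :
    Chrom fun k => ((Delta k E ρ).ncard : ℚ) := by
  have hall : ∀ u, u = a ∨ u = v ∨ u = w := by omega
  have hE : supp E (P v) ∪ supp E (P w) = E := by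
    refine Finset.Subset.antisymm (Finset.union_subset (supp_subset _ _) (supp_subset _ _))
      fun e he => ?_
    obtain ⟨u, hu, heu⟩ := h.exists_leaf he
    rcases hall u with rfl | rfl | rfl
    exacts [absurd rfl hu, Finset.mem_union_left _ heu, Finset.mem_union_right _ heu]
  have key : ∀ n (Q : Fin n → Finset α → ℤ), Dec E ρ Q → (∃ e : Fin 3 ≃ Fin n, ∀ v, Q (e v) = P v) ∨
      ∃ x y, MixedPair E P a v w Q x y := fun n Q hQ => by
    obtain ⟨m, hm⟩ := hstar n Q hQ
    exact h.exists_equiv_or_mixedPair hm hv hw hvw hE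
  have two : ∀ Q : Fin 2 → Finset α → ℤ, Dec E ρ Q → ∃ x y, MixedPair E P a v w Q x y :=
    fun Q hQ => (key 2 Q hQ).resolve_left fun ⟨e, _⟩ => by
      have := Fintype.card_congr e
      simp at this
  have ov : ∀ u, ¬ Disjoint (supp E (P a)) (supp E (P u)) := fun u hd => by
    rw [h.center] at hd
    exact (h.piece u).ne.ne_empty (Finset.disjoint_self_iff_empty _ |>.1 (hd.mono_left (supp_subset _ _)))
  refine _root_.chrom_of_three h.toDec (h.injective_of_leaves hv hw hvw) hv.symm hw.symm hvw (ov v)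
    (ov w) (fun n Q hQ => ?_) (fun Q hQ => ?_) fun Q hQ => ?_
  · rcases key n Q hQ with ⟨e, _⟩ | ⟨x, y, hm⟩
    · right
      have := Fintype.card_congr e
      simpa using this.symm
    · exact Or.inl (eq_two_of_forall hm.ne hm.all)
  · rcases key 3 Q hQ with ⟨e, he⟩ | ⟨x, y, hm⟩
    · exact ⟨e.symm, fun v => by rw [← he, e.apply_symm_apply]⟩
    · have := eq_two_of_forall hm.ne hm.all
      omega
  · obtain ⟨x, y, hm⟩ := two Q hQ
    refine ⟨hm.not_disjoint h.nonempty 0 1, hm.injective, fun Q' hQ' => ?_⟩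
    obtain ⟨x', y', hm'⟩ := two Q' hQ'
    obtain ⟨e, he⟩ := hm'.exists_equiv hm hE hQ'.piece hQ.piece
    exact ⟨e, he⟩

theorem chrom_of_star (hE : E.Nonempty)
    (hstar : ∀ n (Q : Fin n → Finset α → ℤ), Dec E ρ Q → ∃ m, StarDec E ρ Q m) :
    Chrom fun k => ((Delta k E ρ).ncard : ℚ) := by
  by_cases h4 : ∃ n, ∃ P : Fin n → Finset α → ℤ, Dec E ρ P ∧ 4 ≤ n
  · obtain ⟨n, P, hP, hn⟩ := h4
    obtain ⟨a, ha⟩ := hstar n P hP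
    obtain ⟨u, hu, v, hv, w, hw, huv, huw, hvw⟩ :=
      Finset.two_lt_card.1 (show 2 < (Finset.univ.erase a).card by
        rw [Finset.card_erase_of_mem (Finset.mem_univ a), Finset.card_univ, Fintype.card_fin]
        omega)
    have key : ∀ m (Q : Fin m → Finset α → ℤ), Dec E ρ Q → ∀ k,
        (pieceColorings E P k).ncard = (pieceColorings E Q k).ncard := fun m Q hQ k => by
      obtain ⟨b, hb⟩ := hstar m Q hQ
      obtain ⟨e, he⟩ := ha.exists_equiv_of_three hb (Finset.ne_of_mem_erase hu)
        (Finset.ne_of_mem_erase hv) (Finset.ne_of_mem_erase hw) huv huw hvw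
      exact ncard_pieceColorings_congr e (fun v => by rw [he]) k
    exact chrom_of_same fun n' m Q Q' hQ hQ' k => (key n' Q hQ k).symm.trans (key m Q' hQ' k)
  by_cases h3 : ∃ P : Fin 3 → Finset α → ℤ, Dec E ρ P
  · obtain ⟨P, hP⟩ := h3
    obtain ⟨a, ha⟩ := hstar 3 P hP
    obtain ⟨v, hv, w, hw, hvw⟩ := Finset.one_lt_card.1 (show 1 < (Finset.univ.erase a).card by
      rw [Finset.card_erase_of_mem (Finset.mem_univ a)]
      decide)
    exact ha.chrom_of_three (Finset.ne_of_mem_erase hv) (Finset.ne_of_mem_erase hw) hvw hstar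
  have two : ∀ n (Q : Fin n → Finset α → ℤ), Dec E ρ Q → n = 2 ∧ ∀ v, supp E (Q v) = E := by
    intro n Q hQ
    obtain ⟨a, ha⟩ := hstar n Q hQ
    obtain ⟨e, he⟩ := hE
    obtain ⟨b, hb, -⟩ := ha.exists_leaf he
    have h1 : n < 4 := not_le.1 fun h => h4 ⟨n, Q, hQ, h⟩
    have hn : n = 2 := by
      have h2 : n ≠ 3 := by
        rintro rfl
        exact h3 ⟨Q, hQ⟩
      omega
    subst hn
    refine ⟨rfl, fun v => ?_⟩
    by_cases hva : v = a
    · rw [hva, ha.center]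
    refine Finset.Subset.antisymm (supp_subset _ _) fun f hf => ?_
    obtain ⟨u, hu, hfu⟩ := ha.exists_leaf hf
    rwa [show v = u by omega]
  refine chrom_of_same fun n m P Q hP hQ k => ?_
  obtain ⟨rfl, h1⟩ := two n P hP
  obtain ⟨rfl, h2⟩ := two m Q hQ
  exact ncard_pieceColorings_congr (Equiv.refl _) (fun v => by rw [h1, h2]) k

end StarCount

section Triangle

variable {E : Finset α} {ρ : Finset α → ℤ} {ι ι' : Type} {P : ι → Finset α → ℤ}
  {Q : ι' → Finset α → ℤ} {a b c : ι} {x y z : ι'}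

theorem Piece.ext [DecidableEq α] {r r' : Finset α → ℤ} (h : Piece E r) (h' : Piece E r')
    (hs : supp E r = supp E r') (hX : ∀ X ⊆ supp E r, r X = r' X) : r = r' := by
  funext X
  rw [h.inter_supp h.norm, h'.inter_supp h'.norm, ← hs]
  exact hX _ Finset.inter_subset_right

namespace IsTriangle

theorem rotate (h : IsTriangle E P a b c) : IsTriangle E P b c a where
  hab := h.hbc
  hac := h.hab.symm
  hbc := h.hac.symm
  all v := by
    have := h.all v
    tauto
  mem e he := by
    have := h.mem e he
    tauto
  ab := h.bc
  ac := by
    have := h.ab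
    tauto
  bc := by
    have := h.ac
    tauto

theorem swap (h : IsTriangle E P a b c) : IsTriangle E P a c b where
  hab := h.hac
  hac := h.hab
  hbc := h.hbc.symm
  all v := by
    have := h.all v
    tauto
  mem e he := by
    have := h.mem e he
    tauto
  ab := h.ac
  ac := h.ab
  bc := by
    have := h.bc
    tauto

theorem not_isPair (h : IsTriangle E P a b c) : ¬ IsPair E P := by
  rintro ⟨x, y, -, hall, -⟩
  have h1 := h.hab
  have h2 := h.hac
  have h3 := h.hbc
  rcases hall a with rfl | rfl <;> rcases hall b with rfl | rfl <;> rcases hall c with rfl | rfl <;>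
    contradiction

theorem supp_ne (h : IsTriangle E P a b c) : supp E (P a) ≠ supp E (P b) := fun h0 => by
  obtain ⟨e, h1, h2⟩ := h.bc
  have := h.mem e (supp_subset _ _ h1)
  rw [h0] at this
  tauto

theorem injective (h : IsTriangle E P a b c) : P.Injective := by
  intro u v huv
  have hs : supp E (P u) = supp E (P v) := by rw [huv]
  have h1 := h.supp_ne
  have h2 := h.swap.supp_ne
  have h3 := h.rotate.supp_ne
  rcases h.all u with rfl | rfl | rfl <;> rcases h.all v with rfl | rfl | rfl
  exacts [rfl, absurd hs h1, absurd hs h2, absurd hs.symm h1, rfl, absurd hs h3, absurd hs.symm h2,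
    absurd hs.symm h3, rfl]

variable [DecidableEq α]

theorem notMem_of_inter (h : IsTriangle E P a b c) {e : α}
    (he : e ∈ supp E (P a) ∩ supp E (P b)) : e ∉ supp E (P c) := by
  have := h.mem e (supp_subset _ _ (Finset.mem_of_mem_inter_left he))
  rw [Finset.mem_inter] at he
  tauto

theorem union_inter (h : IsTriangle E P a b c) :
    (supp E (P a) ∩ supp E (P b)) ∪ (supp E (P a) ∩ supp E (P c)) = supp E (P a) := by
  rw [← Finset.inter_union_distrib_left]
  refine Finset.inter_eq_left.2 fun e he => ?_
  have := h.mem e (supp_subset _ _ he)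
  rw [Finset.mem_union]
  tauto

theorem disjoint_inter (h : IsTriangle E P a b c) :
    Disjoint (supp E (P a) ∩ supp E (P b)) (supp E (P a) ∩ supp E (P c)) :=
  Finset.disjoint_left.2 fun _ he he' => h.notMem_of_inter he (Finset.mem_of_mem_inter_right he')

theorem nonempty_inter (h : IsTriangle E P a b c) : (supp E (P a) ∩ supp E (P b)).Nonempty := by
  obtain ⟨e, h1, h2⟩ := h.ab
  exact ⟨e, Finset.mem_inter.2 ⟨h1, h2⟩⟩

theorem eq_of_subset (ht : IsTriangle E P a b c) {v : ι} (hv : supp E (P a) ⊆ supp E (P v)) :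
    v = a := by
  obtain ⟨e, he⟩ := ht.nonempty_inter
  obtain ⟨f, hf⟩ := ht.swap.nonempty_inter
  rcases ht.all v with rfl | rfl | rfl
  · rfl
  · exact absurd (hv (Finset.mem_of_mem_inter_left hf)) (ht.swap.notMem_of_inter hf)
  · exact absurd (hv (Finset.mem_of_mem_inter_left he)) (ht.notMem_of_inter he)

variable [Fintype ι] [Fintype ι']

theorem lam_eq (ht : IsTriangle E P a b c) (h : Dec E ρ P) {e f : α}
    (he : e ∈ supp E (P a) ∩ supp E (P b)) (hf : f ∈ supp E (P a) ∩ supp E (P c)) {X : Finset α}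
    (hX : X ⊆ E) : lam ρ e f X = lam (P a) e f X := by
  refine h.lam_eq_of_unique (supp_subset _ _ (Finset.mem_of_mem_inter_left he))
    (supp_subset _ _ (Finset.mem_of_mem_inter_left hf)) (fun w hew hfw => ?_) hX
  rcases ht.all w with rfl | rfl | rfl
  exacts [rfl, absurd hfw (ht.swap.notMem_of_inter hf), absurd hew (ht.notMem_of_inter he)]

theorem eq_of_supp_eq (ht : IsTriangle E P a b c) (ht' : IsTriangle E Q x y z) (h : Dec E ρ P)
    (h' : Dec E ρ Q) (hx : supp E (Q x) = supp E (P a)) (hy : supp E (Q y) = supp E (P b))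
    (hz : supp E (Q z) = supp E (P c)) : Q x = P a := by
  refine ((h.piece a).ext (h'.piece x) hx.symm ?_).symm
  have hc : Cross (P a) (Q x) (supp E (P a) ∩ supp E (P b)) (supp E (P a) ∩ supp E (P c)) := by
    refine cross_of_lam (h.piece a).empty (h'.piece x).empty (fun e he f hf Z hZ _ _ => ?_)
      ht.disjoint_inter
    have hZE : Z ⊆ E := by
      rw [ht.union_inter] at hZ
      exact hZ.trans (supp_subset _ _)
    rw [← ht.lam_eq h he hf hZE, ht'.lam_eq h' (by rwa [hx, hy]) (by rwa [hx, hz]) hZE]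
  have := hc.eq_of_conn (h.piece a).toIsRk (h'.piece x).toIsRk ht.disjoint_inter
    ht.nonempty_inter ht.swap.nonempty_inter (by rw [ht.union_inter]; exact (h.piece a).conn)
  rwa [ht.union_inter] at this

theorem exists_supp_eq (ht : IsTriangle E P a b c) (h : Dec E ρ P) (h' : Dec E ρ Q) (hc : Conn ρ E)
    (h2 : ∀ e ∈ E, ρ {e} ≤ 2) (hQ : ¬ IsPair E Q) : ∃ x, supp E (Q x) = supp E (P a) := by
  have h1 : ∀ v, ∃ w, supp E (P v) ⊆ supp E (Q w) := fun v =>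
    h'.helly h2 (h.piece v).ne fun e he f hf g hg => by
      by_contra! hno
      exact ht.not_isPair (h.pair_triangle h' hc h2 he hf hg hno).1
  have h3 : ∀ w, ∃ v, supp E (Q w) ⊆ supp E (P v) := fun v =>
    h.helly h2 (h'.piece v).ne fun e he f hf g hg => by
      by_contra! hno
      exact hQ (h'.pair_triangle h hc h2 he hf hg hno).1
  obtain ⟨x, hx⟩ := h1 a
  obtain ⟨v, hv⟩ := h3 x
  obtain rfl := ht.eq_of_subset (hx.trans hv)
  exact ⟨x, hv.antisymm hx⟩

theorem isPair_or_exists_equiv (ht : IsTriangle E P a b c) (h : Dec E ρ P) (h' : Dec E ρ Q)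
    (hc : Conn ρ E) (h2 : ∀ e ∈ E, ρ {e} ≤ 2) :
    IsPair E Q ∨ ∃ e : ι ≃ ι', ∀ v, Q (e v) = P v := by
  by_cases hQ : IsPair E Q
  · exact Or.inl hQ
  right
  obtain ⟨x, hx⟩ := ht.exists_supp_eq h h' hc h2 hQ
  obtain ⟨y, hy⟩ := ht.rotate.exists_supp_eq h h' hc h2 hQ
  obtain ⟨z, hz⟩ := ht.rotate.rotate.exists_supp_eq h h' hc h2 hQ
  have hxy : x ≠ y := by
    rintro rfl
    exact ht.supp_ne (hx.symm.trans hy)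
  have hxz : x ≠ z := by
    rintro rfl
    exact ht.swap.supp_ne (hx.symm.trans hz)
  have hyz : y ≠ z := by
    rintro rfl
    exact ht.rotate.supp_ne (hy.symm.trans hz)
  have ht' : IsTriangle E Q x y z :=
    { hab := hxy
      hac := hxz
      hbc := hyz
      all := fun v => by
        obtain ⟨e, he⟩ := (h'.piece v).ne
        have h0 := ht.mem e (supp_subset _ _ he)
        rw [← hx, ← hy, ← hz] at h0
        rcases h0 with ⟨h3, h4, -⟩ | ⟨h3, -, h4⟩ | ⟨-, h3, h4⟩
        · have := h'.eq_or_eq h2 h3 h4 hxy he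
          tauto
        · have := h'.eq_or_eq h2 h3 h4 hxz he
          tauto
        · have := h'.eq_or_eq h2 h3 h4 hyz he
          tauto
      mem := by
        rw [hx, hy, hz]
        exact ht.mem
      ab := by
        rw [hx, hy]
        exact ht.ab
      ac := by
        rw [hx, hz]
        exact ht.ac
      bc := by
        rw [hy, hz]
        exact ht.bc }
  have ex := ht.eq_of_supp_eq ht' h h' hx hy hz
  have ey := ht.rotate.eq_of_supp_eq ht'.rotate h h' hy hz hx
  have ez := ht.rotate.rotate.eq_of_supp_eq ht'.rotate.rotate h h' hz hx hy
  refine exists_equiv_of_injective ht.injective ht'.injective (fun v => ?_) fun v => ?_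
  · rcases ht.all v with rfl | rfl | rfl
    exacts [⟨x, ex⟩, ⟨y, ey⟩, ⟨z, ez⟩]
  · rcases ht'.all v with rfl | rfl | rfl
    exacts [⟨a, ex.symm⟩, ⟨b, ey.symm⟩, ⟨c, ez.symm⟩]

end IsTriangle

end Triangle

section Side

variable [DecidableEq α] {A B M N : Finset α → ℤ} {L R : Finset α}

namespace Exch

theorem eq_or_eq_of_not_conn (h : Exch A B M N L R) (hA : Conn A (L ∪ R)) (hB : ¬ Conn B L)
    (hR : R.Nonempty) : (∀ X ⊆ L ∪ R, A X = M X) ∨ (∀ X ⊆ L ∪ R, A X = N X) := by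
  simp only [Conn, not_forall, not_lt] at hB
  obtain ⟨X, hX, hne, hneL, hsep⟩ := hB
  have hd : Disjoint (L \ X) R := h.disj.mono_left Finset.sdiff_subset
  have hdX : Disjoint X R := h.disj.mono_left hX
  have hXX : Disjoint X (L \ X) := Finset.disjoint_sdiff
  have hs : ∀ Y ⊆ L, B Y + B (L \ Y) ≤ B L → B Y + B ((L ∪ R) \ Y) ≤ B (L ∪ R) := by
    intro Y _ hY
    have h1 : B ((L ∪ R) \ Y) + B ∅ ≤ B (L \ Y) + B R :=
      h.rB.sm (by
        rw [Finset.union_sdiff_distrib]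
        exact Finset.union_subset_union_right Finset.sdiff_subset) (Finset.empty_subset _)
    have h2 := h.rB.empty
    have h3 := h.sep
    omega
  refine eq_or_eq_of_three h.rA h.rB h.rM h.rN h.sum hA ![X, L \ X, R] ?_ ?_ ?_ ?_
  · intro i
    fin_cases i
    exacts [hX.trans Finset.subset_union_left,
      Finset.sdiff_subset.trans Finset.subset_union_left, Finset.subset_union_right]
  · intro i
    fin_cases i
    exacts [hne, Finset.sdiff_nonempty.2 fun h0 => hneL (hX.antisymm h0), hR]
  · intro i j hij
    fin_cases i <;> fin_cases j
    exacts [absurd rfl hij, hXX, hdX, hXX.symm, absurd rfl hij, hd, hdX.symm, hd.symm,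
      absurd rfl hij]
  · intro i
    fin_cases i
    · exact hs X hX hsep
    · refine hs (L \ X) Finset.sdiff_subset ?_
      rw [Finset.sdiff_sdiff_eq_self hX, add_comm]
      exact hsep
    · show B R + B ((L ∪ R) \ R) ≤ B (L ∪ R)
      rw [Finset.union_sdiff_right, Finset.sdiff_eq_self_of_disjoint h.disj, add_comm]
      exact h.sep

theorem eq_or_mixed (h : Exch A B M N L R) (hA : Conn A (L ∪ R)) (hL : L.Nonempty)
    (hR : R.Nonempty) : (∀ X ⊆ L ∪ R, A X = M X) ∨ (∀ X ⊆ L ∪ R, A X = N X) ∨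
      (Mixed A B M N L R ∧ Mixed A B N M R L) ∨ (Mixed A B N M L R ∧ Mixed A B M N R L) := by
  have hA' : Conn A (R ∪ L) := by rwa [Finset.union_comm]
  by_cases cL : Conn B L
  · by_cases cR : Conn B R
    · rcases h.unmixed_or_mixed cL hA hL hR with h0 | m1
      · tauto
      rcases h.symm.unmixed_or_mixed cR hA' hR hL with h0 | m2
      · rw [Finset.union_comm] at h0
        tauto
      rcases m1 with m1 | m1 <;> rcases m2 with m2 | m2
      exacts [(m1.not_symm m2).elim, Or.inr (Or.inr (Or.inl ⟨m1, m2⟩)),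
        Or.inr (Or.inr (Or.inr ⟨m1, m2⟩)), (m1.not_symm m2).elim]
    · have h0 := h.symm.eq_or_eq_of_not_conn hA' cR hL
      rw [Finset.union_comm] at h0
      tauto
  · have := h.eq_or_eq_of_not_conn hA cL hR
    tauto

end Exch

end Side

section PairOfTriangle

variable [DecidableEq α] {E : Finset α} {ρ : Finset α → ℤ} {ι : Type} [Fintype ι]
  {P : ι → Finset α → ℤ} {a b c : ι} {M N M' N' : Finset α → ℤ}

namespace IsTriangle

theorem sum_eq (ht : IsTriangle E P a b c) (h : Dec E ρ P) {X : Finset α} (hX : X ⊆ E) :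
    ρ X = P a X + (P b X + P c X) := by
  classical
  have h1 : (Finset.univ : Finset ι) = {a, b, c} := by
    ext v
    simpa using ht.all v
  rw [h.sum X hX, h1, Finset.sum_insert (by simp [ht.hab, ht.hac]), Finset.sum_pair ht.hbc]

theorem eq_or_eq_or_lt (ht : IsTriangle E P a b c) (h : Dec E ρ P) (hM : IsRk M) (hN : IsRk N)
    (hs : ∀ X ⊆ E, ρ X = M X + N X) : (∀ X ⊆ supp E (P a), P a X = M X) ∨
      (∀ X ⊆ supp E (P a), P a X = N X) ∨
      (P b (supp E (P a) ∩ supp E (P b)) < P a (supp E (P a) ∩ supp E (P b)) ∧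
        P c (supp E (P a) ∩ supp E (P c)) < P a (supp E (P a) ∩ supp E (P c)) ∧
        (M (supp E (P a) ∩ supp E (P b)) = P a (supp E (P a) ∩ supp E (P b)) ∨
          M (supp E (P a) ∩ supp E (P c)) = P a (supp E (P a) ∩ supp E (P c)))) := by
  set S := supp E (P a)
  set L := S ∩ supp E (P b)
  set R := S ∩ supp E (P c)
  have hLR : L ∪ R = S := ht.union_inter
  have hSE : S ⊆ E := supp_subset _ _
  have bR : ∀ X ⊆ R, P b X = 0 := fun X hX => (h.piece b).eq_zero
    (Finset.disjoint_left.2 fun e he => ht.swap.notMem_of_inter (hX he))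
  have cL : ∀ X ⊆ L, P c X = 0 := fun X hX => (h.piece c).eq_zero
    (Finset.disjoint_left.2 fun e he => ht.notMem_of_inter (hX he))
  have hLS : L ⊆ S := Finset.inter_subset_left
  have hRS : R ⊆ S := Finset.inter_subset_left
  set B : Finset α → ℤ := fun X => P b (X ∩ S) + P c (X ∩ S) with hB
  have rB : IsRk B :=
    { empty := by simp [hB, (h.piece b).empty, (h.piece c).empty]
      mono := fun hXY => add_le_add ((h.piece b).mono (Finset.inter_subset_inter_right hXY))
        ((h.piece c).mono (Finset.inter_subset_inter_right hXY))
      submod := fun X Y => by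
        have h1 := ((h.piece b).toIsPM.restrict S).submod X Y
        have h2 := ((h.piece c).toIsPM.restrict S).submod X Y
        simp only [hB]
        linarith
      unit := fun e => by
        by_cases he : e ∈ S
        · have h1 : ({e} : Finset α) ∩ S = {e} := by simpa using he
          simp only [hB, h1]
          rw [← hLR, Finset.mem_union] at he
          rcases he with he | he
          · rw [cL {e} (by simpa using he)]
            simpa using (h.piece b).unit e
          · rw [bR {e} (by simpa using he)]
            simpa using (h.piece c).unit e
        · have h1 : ({e} : Finset α) ∩ S = ∅ := Finset.singleton_inter_of_notMem he
          simp [hB, h1, (h.piece b).empty, (h.piece c).empty] }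
  have BS : ∀ X ⊆ S, B X = P b X + P c X := fun X hX => by
    simp only [hB, Finset.inter_eq_left.2 hX]
  have BL : B L = P b L := by rw [BS L hLS, cL L subset_rfl, add_zero]
  have BR : B R = P c R := by rw [BS R hRS, bR R subset_rfl, zero_add]
  have hX : Exch (P a) B M N L R :=
    { rA := (h.piece a).toIsRk
      rB := rB
      rM := hM
      rN := hN
      disj := ht.disjoint_inter
      sum := fun X hX => by
        rw [hLR] at hX
        rw [BS X hX, ← ht.sum_eq h (hX.trans hSE), hs X (hX.trans hSE)]
      sep := by
        rw [BL, BR, hLR, BS S subset_rfl]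
        exact add_le_add ((h.piece b).mono hLS) ((h.piece c).mono hRS) }
  rcases hX.eq_or_mixed (by rw [hLR]; exact (h.piece a).conn) ht.nonempty_inter
    ht.swap.nonempty_inter with h0 | h0 | ⟨m1, m2⟩ | ⟨m1, m2⟩
  · rw [hLR] at h0
    exact Or.inl h0
  · rw [hLR] at h0
    exact Or.inr (Or.inl h0)
  · have h1 := m1.lt
    have h2 := m2.lt
    rw [BL] at h1
    rw [BR] at h2
    exact Or.inr (Or.inr ⟨h1, h2, Or.inl (m1.eqM _ subset_rfl)⟩)
  · have h1 := m1.lt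
    have h2 := m2.lt
    rw [BL] at h1
    rw [BR] at h2
    exact Or.inr (Or.inr ⟨h1, h2, Or.inr (m2.eqM _ subset_rfl)⟩)

theorem eq_of_ne (ht : IsTriangle E P a b c) (h : Dec E ρ P) (hM : IsRk M) (hN : IsRk N)
    (hs : ∀ X ⊆ E, ρ X = M X + N X) (hn : ∀ v, ¬ ∀ X ⊆ supp E (P v), P v X = N X) :
    ∀ X ⊆ supp E (P a), M X = P a X := by
  rcases ht.eq_or_eq_or_lt h hM hN hs with h0 | h0 | ⟨l1, l2, hm⟩
  · exact fun X hX => (h0 X hX).symm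
  · exact absurd h0 (hn a)
  exfalso
  have hb : ∀ X ⊆ supp E (P b), P b X = M X := by
    rcases ht.rotate.swap.eq_or_eq_or_lt h hM hN hs with h0 | h0 | ⟨l3, -, -⟩
    · exact h0
    · exact absurd h0 (hn b)
    · rw [Finset.inter_comm] at l3
      omega
  have hc : ∀ X ⊆ supp E (P c), P c X = M X := by
    rcases ht.rotate.rotate.eq_or_eq_or_lt h hM hN hs with h0 | h0 | ⟨l3, -, -⟩
    · exact h0
    · exact absurd h0 (hn c)
    · rw [Finset.inter_comm] at l3
      omega
  rcases hm with hm | hm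
  · rw [← hb _ Finset.inter_subset_right] at hm
    omega
  · rw [← hc _ Finset.inter_subset_right] at hm
    omega

end IsTriangle

theorem not_eq_of_lam {r : Finset α → ℤ} (h : Piece E r) (hN : IsRk N) {e f : α} {X : Finset α}
    (he : e ∈ supp E r) (hf : f ∈ supp E r) (hl : 1 ≤ lam r e f X)
    (h2 : N X + 2 ≤ N (insert e (insert f X))) : ¬ ∀ Y ⊆ supp E r, r Y = N Y := by
  intro h0
  have hr : ∀ Z, r Z = N (Z ∩ supp E r) := fun Z => by
    rw [h.inter_supp h.norm, h0 _ Finset.inter_subset_right]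
  simp only [lam, hr, Finset.insert_inter_of_mem he, Finset.insert_inter_of_mem hf] at hl
  have h3 := hN.step e (X ∩ supp E r)
  have h4 := hN.inc (Finset.insert_subset_insert f (Finset.inter_subset_left : X ∩ supp E r ⊆ X)) e
  have h5 := hN.step f X
  omega

namespace IsTriangle

theorem lam_insert (ht : IsTriangle E P a b c) (h : Dec E ρ P) {e f g : α}
    (he : e ∈ supp E (P a) ∩ supp E (P b)) (hf : f ∈ supp E (P a) ∩ supp E (P c))
    (hg : g ∈ supp E (P b) ∩ supp E (P c)) {X : Finset α} (hX : X ⊆ E) :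
    lam ρ e f (insert g X) = lam ρ e f X := by
  have hgE : g ∈ E := supp_subset _ _ (Finset.mem_of_mem_inter_left hg)
  have hga := ht.rotate.notMem_of_inter hg
  rw [ht.lam_eq h he hf (Finset.insert_subset hgE hX), ht.lam_eq h he hf hX]
  simp only [lam]
  rw [Finset.insert_comm e g, Finset.insert_comm f g, Finset.insert_comm e g, (h.piece a).insert hga,
    (h.piece a).insert hga, (h.piece a).insert hga, (h.piece a).insert hga]

theorem lam_le (ht : IsTriangle E P a b c) (h : Dec E ρ P) {e f : α}
    (he : e ∈ supp E (P a) ∩ supp E (P b)) (hf : f ∈ supp E (P a) ∩ supp E (P c)) {X : Finset α}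
    (hX : X ⊆ E) : lam ρ e f X ≤ 1 := by
  rw [ht.lam_eq h he hf hX]
  have h1 := (h.piece a).step e X
  have h2 := (h.piece a).mono (Finset.subset_insert e (insert f X))
  simp only [lam]
  omega

end IsTriangle

theorem IsPM.submod_insert {r : Finset α → ℤ} (hr : IsPM r) (e f : α) (X : Finset α) :
    r (insert e (insert f X)) + r X ≤ r (insert e X) + r (insert f X) := by
  have := hr.inc (Finset.subset_insert f X) e
  omega

end PairOfTriangle

section PairOfTriangle

variable [DecidableEq α] {E : Finset α} {ρ : Finset α → ℤ} {ι : Type} [Fintype ι]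
  {P : ι → Finset α → ℤ} {a b c : ι} {M N M' N' : Finset α → ℤ}

namespace IsTriangle

theorem ne_or_ne (ht : IsTriangle E P a b c) (h : Dec E ρ P) (hM : IsRk M) (hN : IsRk N)
    (hc : Conn M E) (hs : ∀ X ⊆ E, ρ X = M X + N X) :
    (∀ v, ¬ ∀ X ⊆ supp E (P v), P v X = M X) ∨ (∀ v, ¬ ∀ X ⊆ supp E (P v), P v X = N X) := by
  obtain ⟨e, he⟩ := ht.nonempty_inter
  obtain ⟨f, hf⟩ := ht.swap.nonempty_inter
  obtain ⟨g, hg⟩ := ht.rotate.nonempty_inter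
  have he' : e ∈ supp E (P b) ∩ supp E (P a) := by rwa [Finset.inter_comm]
  have hf' : f ∈ supp E (P c) ∩ supp E (P a) := by rwa [Finset.inter_comm]
  have hg' : g ∈ supp E (P c) ∩ supp E (P b) := by rwa [Finset.inter_comm]
  have heE : e ∈ E := supp_subset _ _ (Finset.mem_of_mem_inter_left he)
  have hfE : f ∈ E := supp_subset _ _ (Finset.mem_of_mem_inter_left hf)
  have hgE : g ∈ E := supp_subset _ _ (Finset.mem_of_mem_inter_left hg)
  have hef : e ≠ f := by
    rintro rfl
    exact Finset.disjoint_left.1 ht.disjoint_inter he hf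
  have heg : e ≠ g := by
    rintro rfl
    exact Finset.disjoint_left.1 ht.rotate.disjoint_inter hg he'
  have hfg : f ≠ g := by
    rintro rfl
    exact Finset.disjoint_left.1 ht.rotate.rotate.disjoint_inter hf' hg'
  obtain ⟨X, hX, t, -, -, -, T⟩ := hc.exists_tri hM heE hfE hgE hef heg hfg
  have key : (1 ≤ lam ρ e f X ∧ 1 ≤ lam ρ e g X ∧ 1 ≤ lam ρ f g X) ∧
      ((M X + 2 ≤ M (insert e (insert f X)) ∧ M X + 2 ≤ M (insert e (insert g X)) ∧
        M X + 2 ≤ M (insert f (insert g X))) ∨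
      (N X + 2 ≤ N (insert e (insert f X)) ∧ N X + 2 ≤ N (insert e (insert g X)) ∧
        N X + 2 ≤ N (insert f (insert g X)))) := by
    have l1 := ht.lam_insert h he hf hg hX
    have u1 := ht.lam_le h he hf hX
    have u2 := ht.rotate.swap.lam_le h he' hg hX
    have u3 := ht.rotate.rotate.lam_le h hf' hg' hX
    have fE := Finset.insert_subset hfE hX
    have gE := Finset.insert_subset hgE hX
    have fgE := Finset.insert_subset hfE gE
    have s0 := hs _ hX
    have s1 := hs _ (Finset.insert_subset heE hX)
    have s2 := hs _ fE
    have s3 := hs _ gE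
    have s12 := hs _ (Finset.insert_subset heE fE)
    have s13 := hs _ (Finset.insert_subset heE gE)
    have s23 := hs _ fgE
    have s123 := hs _ (Finset.insert_subset heE fgE)
    have n1 := hN.submod_insert e f X
    have n2 := hN.submod_insert e g X
    have n3 := hN.submod_insert f g X
    have n4 := hN.submod_insert e f (insert g X)
    have n5 := hN.submod_insert e g (insert f X)
    have n6 := hN.submod_insert f g (insert e X)
    rw [Finset.insert_comm g f] at n5
    rw [Finset.insert_comm f e X, Finset.insert_comm g e X, Finset.insert_comm f e (insert g X)]
      at n6
    have n7 := hN.mono (Finset.subset_insert e (insert f (insert g X)))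
    have n8 := hN.mono (Finset.subset_insert f (insert e (insert g X)))
    have n9 := hN.mono (Finset.subset_insert g (insert e (insert f X)))
    rw [Finset.insert_comm f e] at n8
    rw [Finset.insert_comm g e, Finset.insert_comm g f] at n9
    obtain ⟨ht', t1, t2, t3, t12, t13, t23, t123⟩ := T
    simp only [lam] at *
    rcases ht' with rfl | rfl
    · refine ⟨?_, Or.inr ?_⟩ <;> omega
    · refine ⟨?_, Or.inl ?_⟩ <;> omega
  obtain ⟨⟨k1, k2, k3⟩, hk⟩ := key
  rw [ht.lam_eq h he hf hX] at k1
  rw [ht.rotate.swap.lam_eq h he' hg hX] at k2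
  rw [ht.rotate.rotate.lam_eq h hf' hg' hX] at k3
  rw [Finset.mem_inter] at he hf hg
  rcases hk with ⟨h1, h2, h3⟩ | ⟨h1, h2, h3⟩
  · left
    intro v
    rcases ht.all v with rfl | rfl | rfl
    exacts [not_eq_of_lam (h.piece _) hM he.1 hf.1 k1 h1,
      not_eq_of_lam (h.piece _) hM he.2 hg.1 k2 h2, not_eq_of_lam (h.piece _) hM hf.2 hg.2 k3 h3]
  · right
    intro v
    rcases ht.all v with rfl | rfl | rfl
    exacts [not_eq_of_lam (h.piece _) hN he.1 hf.1 k1 h1,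
      not_eq_of_lam (h.piece _) hN he.2 hg.1 k2 h2, not_eq_of_lam (h.piece _) hN hf.2 hg.2 k3 h3]

theorem le_of_ssubset (ht : IsTriangle E P a b c) (h : Dec E ρ P) (hM : IsRk M) (hN : IsRk N)
    (hM' : IsRk M') (hN' : IsRk N') (hs : ∀ X ⊆ E, ρ X = M X + N X)
    (hs' : ∀ X ⊆ E, ρ X = M' X + N' X) (hv : ∀ v, ∀ X ⊆ supp E (P v), M X = M' X) {X : Finset α}
    (hX : X ⊆ E) (ih : ∀ Y ⊂ X, M Y = M' Y) : M X ≤ M' X := by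
  by_contra! hlt
  have meet : ∀ v, ∃ e ∈ X, e ∉ supp E (P v) := fun v => by
    by_contra! h0
    have := hv v X h0
    omega
  obtain ⟨e, heX, hec⟩ := meet c
  obtain ⟨f, hfX, hfb⟩ := meet b
  obtain ⟨g, hgX, hga⟩ := meet a
  have he : e ∈ supp E (P a) ∩ supp E (P b) := by
    have := ht.mem e (hX heX)
    rw [Finset.mem_inter]
    tauto
  have hf : f ∈ supp E (P a) ∩ supp E (P c) := by
    have := ht.mem f (hX hfX)
    rw [Finset.mem_inter]
    tauto
  have hg : g ∈ supp E (P b) ∩ supp E (P c) := by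
    have := ht.mem g (hX hgX)
    rw [Finset.mem_inter]
    tauto
  have hef : e ≠ f := by
    rintro rfl
    exact hfb (Finset.mem_of_mem_inter_right he)
  have heg : e ≠ g := by
    rintro rfl
    exact hga (Finset.mem_of_mem_inter_left he)
  have hfg : f ≠ g := by
    rintro rfl
    exact hga (Finset.mem_of_mem_inter_left hf)
  obtain ⟨Z, hZ, heZ, hfZ, hgZ⟩ : ∃ Z, X = insert e (insert f (insert g Z)) ∧ e ∉ Z ∧ f ∉ Z ∧
      g ∉ Z := by
    refine ⟨((X.erase e).erase f).erase g, ?_, by simp, by simp, by simp⟩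
    rw [Finset.insert_erase (by simp [hfg.symm, heg.symm, hgX]),
      Finset.insert_erase (by simp [hef.symm, hfX]), Finset.insert_erase heX]
  have heE := hX heX
  have hfE := hX hfX
  have hgE := hX hgX
  have hZE : Z ⊆ E := fun z hz => hX (by simp [hZ, hz])
  subst hZ
  have fE := Finset.insert_subset hfE hZE
  have gE := Finset.insert_subset hgE hZE
  have fgE := Finset.insert_subset hfE gE
  have both : ∀ Y ⊆ E, M Y + N Y = M' Y + N' Y := fun Y hY => by rw [← hs Y hY, hs' Y hY]
  have me : ∀ {Y}, Y ⊆ insert f (insert g Z) → M Y = M' Y := fun hY => ih _ <| by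
    refine ⟨hY.trans (Finset.subset_insert _ _), fun h0 => ?_⟩
    have := hY (h0 (Finset.mem_insert_self _ _))
    simp [hef, heg, heZ] at this
  have mf : ∀ {Y}, Y ⊆ insert e (insert g Z) → M Y = M' Y := fun hY => ih _ <| by
    refine ⟨hY.trans (Finset.insert_subset_insert _ (Finset.subset_insert _ _)), fun h0 => ?_⟩
    have := hY (h0 (Finset.mem_insert_of_mem (Finset.mem_insert_self _ _)))
    simp [hef.symm, hfg, hfZ] at this
  have mg : ∀ {Y}, Y ⊆ insert e (insert f Z) → M Y = M' Y := fun hY => ih _ <| by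
    refine ⟨hY.trans (Finset.insert_subset_insert _ (Finset.insert_subset_insert _
      (Finset.subset_insert _ _))), fun h0 => ?_⟩
    have := hY (h0 (Finset.mem_insert_of_mem (Finset.mem_insert_of_mem (Finset.mem_insert_self _ _))))
    simp [hfg.symm, heg.symm, hgZ] at this
  have i1 := mf (Y := insert e Z) (Finset.insert_subset_insert _ (Finset.subset_insert _ _))
  have i2 := me (Y := insert f Z) (Finset.insert_subset_insert _ (Finset.subset_insert _ _))
  have i3 := me (Y := insert g Z) (Finset.subset_insert _ _)
  have i0 := me (Y := Z) ((Finset.subset_insert g Z).trans (Finset.subset_insert _ _))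
  have i12 := mg (Y := insert e (insert f Z)) subset_rfl
  have i13 := mf (Y := insert e (insert g Z)) subset_rfl
  have i23 := me (Y := insert f (insert g Z)) subset_rfl
  have l1 := ht.lam_insert h he hf hg hZE
  have s0 := both _ hZE
  have s1 := both _ (Finset.insert_subset heE hZE)
  have s2 := both _ fE
  have s3 := both _ gE
  have s12 := both _ (Finset.insert_subset heE fE)
  have s13 := both _ (Finset.insert_subset heE gE)
  have s23 := both _ fgE
  have s123 := both _ (Finset.insert_subset heE fgE)
  simp only [lam] at l1
  rw [hs' _ hZE, hs' _ (Finset.insert_subset heE hZE), hs' _ fE, hs' _ gE,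
    hs' _ (Finset.insert_subset heE fE), hs' _ (Finset.insert_subset heE gE), hs' _ fgE,
    hs' _ (Finset.insert_subset heE fgE)] at l1
  have free : ∀ r : Finset α → ℤ, IsRk r →
      r (insert f (insert g Z)) < r (insert e (insert f (insert g Z))) →
      r (insert e (insert g Z)) < r (insert e (insert f (insert g Z))) →
      r (insert e (insert f Z)) < r (insert e (insert f (insert g Z))) →
      r (insert e Z) = r Z + 1 ∧ r (insert f Z) = r Z + 1 ∧ r (insert g Z) = r Z + 1 ∧
      r (insert e (insert f Z)) = r Z + 2 ∧ r (insert e (insert g Z)) = r Z + 2 ∧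
      r (insert f (insert g Z)) = r Z + 2 ∧ r (insert e (insert f (insert g Z))) = r Z + 3 := by
    intro r hr h1 h2 h3
    have a1 := hr.step e Z
    have a2 := hr.step f Z
    have a3 := hr.step g Z
    have a4 := hr.step e (insert f Z)
    have a5 := hr.step e (insert g Z)
    have a6 := hr.step f (insert g Z)
    have a7 := hr.step e (insert f (insert g Z))
    have a8 := hr.submod_insert e f (insert g Z)
    have a9 := hr.submod_insert e g (insert f Z)
    have a10 := hr.submod_insert f g (insert e Z)
    have a11 := hr.submod_insert e f Z
    rw [Finset.insert_comm g f] at a9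
    rw [Finset.insert_comm f e Z, Finset.insert_comm g e Z, Finset.insert_comm f e (insert g Z)]
      at a10
    omega
  have c1 := hM.step e (insert f (insert g Z))
  have c2 := hM.step f (insert e (insert g Z))
  have c3 := hM.step g (insert e (insert f Z))
  rw [Finset.insert_comm f e] at c2
  rw [Finset.insert_comm g e, Finset.insert_comm g f] at c3
  have m1 := hM'.mono (Finset.subset_insert e (insert f (insert g Z)))
  have m2 := hM'.mono (Finset.subset_insert f (insert e (insert g Z)))
  have m3 := hM'.mono (Finset.subset_insert g (insert e (insert f Z)))
  rw [Finset.insert_comm f e] at m2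
  rw [Finset.insert_comm g e, Finset.insert_comm g f] at m3
  have n1 := hN.mono (Finset.subset_insert e (insert f (insert g Z)))
  have n2 := hN.mono (Finset.subset_insert f (insert e (insert g Z)))
  have n3 := hN.mono (Finset.subset_insert g (insert e (insert f Z)))
  rw [Finset.insert_comm f e] at n2
  rw [Finset.insert_comm g e, Finset.insert_comm g f] at n3
  have k1 := free M hM (by omega) (by omega) (by omega)
  have k2 := free N' hN' (by omega) (by omega) (by omega)
  omega

theorem eq_of_eq (ht : IsTriangle E P a b c) (h : Dec E ρ P) (hM : IsRk M) (hN : IsRk N)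
    (hM' : IsRk M') (hN' : IsRk N') (hs : ∀ X ⊆ E, ρ X = M X + N X)
    (hs' : ∀ X ⊆ E, ρ X = M' X + N' X) (hv : ∀ v, ∀ X ⊆ supp E (P v), M X = M' X) (X : Finset α) :
    X ⊆ E → M X = M' X := by
  induction X using Finset.strongInduction with
  | H X ih =>
    intro hX
    have ih' : ∀ Y ⊂ X, M Y = M' Y := fun Y hY => ih Y hY (hY.1.trans hX)
    exact (ht.le_of_ssubset h hM hN hM' hN' hs hs' hv hX ih').antisymm
      (ht.le_of_ssubset h hM' hN' hM hN hs' hs (fun v Y hY => (hv v Y hY).symm) hX fun Y hY =>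
        (ih' Y hY).symm)

end IsTriangle

end PairOfTriangle

section Main

variable [DecidableEq α] {E : Finset α} {ρ : Finset α → ℤ}

namespace IsTriangle

theorem exists_major {ι ι' : Type} [Fintype ι] [Fintype ι'] {P : ι → Finset α → ℤ} {a b c : ι}
    {Q : ι' → Finset α → ℤ} (ht : IsTriangle E P a b c) (h : Dec E ρ P) (h' : Dec E ρ Q)
    (hQ : IsPair E Q) : ∃ x y, x ≠ y ∧ (∀ u, u = x ∨ u = y) ∧ Q x ≠ Q y ∧
      (∀ v, ∀ X ⊆ supp E (P v), Q x X = P v X) ∧ ∀ X ⊆ E, ρ X = Q x X + Q y X := by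
  classical
  obtain ⟨x, y, hxy, hall, hx, hy⟩ := hQ
  have hs : ∀ X ⊆ E, ρ X = Q x X + Q y X := fun X hX => by
    have h1 : (Finset.univ : Finset ι') = {x, y} := by
      ext v
      simpa using hall v
    rw [h'.sum X hX, h1, Finset.sum_pair hxy]
  have key : ∀ {x y}, (∀ X ⊆ E, ρ X = Q x X + Q y X) →
      (∀ v, ¬ ∀ X ⊆ supp E (P v), P v X = Q y X) →
      Q x ≠ Q y ∧ ∀ v, ∀ X ⊆ supp E (P v), Q x X = P v X := by
    intro x y hs hn
    have h1 : ∀ v, ∀ X ⊆ supp E (P v), Q x X = P v X := fun v => by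
      have rx := (h'.piece x).toIsRk
      have ry := (h'.piece y).toIsRk
      rcases ht.all v with rfl | rfl | rfl
      exacts [ht.eq_of_ne h rx ry hs hn, ht.rotate.eq_of_ne h rx ry hs hn,
        ht.rotate.rotate.eq_of_ne h rx ry hs hn]
    exact ⟨fun h0 => hn a fun X hX => by rw [← h0, h1 a X hX], h1⟩
  have hc : Conn (Q x) E := by
    have := (h'.piece x).conn
    rwa [hx] at this
  have hs' : ∀ X ⊆ E, ρ X = Q y X + Q x X := fun X hX => by rw [hs X hX, add_comm]
  rcases ht.ne_or_ne h (h'.piece x).toIsRk (h'.piece y).toIsRk hc hs with hn | hn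
  · obtain ⟨h1, h2⟩ := key hs' hn
    exact ⟨y, x, hxy.symm, fun u => (hall u).symm, h1, h2, hs'⟩
  · obtain ⟨h1, h2⟩ := key hs hn
    exact ⟨x, y, hxy, hall, h1, h2, hs⟩

theorem exists_equiv_of_isPair {ι ι' ι'' : Type} [Fintype ι] [Fintype ι'] [Fintype ι'']
    {P : ι → Finset α → ℤ} {a b c : ι} {Q : ι' → Finset α → ℤ} {Q' : ι'' → Finset α → ℤ}
    (ht : IsTriangle E P a b c) (h : Dec E ρ P) (h' : Dec E ρ Q) (h'' : Dec E ρ Q')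
    (hQ : IsPair E Q) (hQ' : IsPair E Q') : Q.Injective ∧ ∃ e : ι' ≃ ι'', ∀ v, Q' (e v) = Q v := by
  have inj : ∀ {κ : Type} {R : κ → Finset α → ℤ} {x y : κ}, (∀ u, u = x ∨ u = y) → R x ≠ R y →
      R.Injective := by
    intro κ R x y hall hne s t hst
    rcases hall s with rfl | rfl <;> rcases hall t with rfl | rfl
    exacts [rfl, absurd hst hne, absurd hst.symm hne, rfl]
  obtain ⟨x, y, -, hall, hne, hv, hs⟩ := ht.exists_major h h' hQ
  obtain ⟨x', y', -, hall', hne', hv', hs'⟩ := ht.exists_major h h'' hQ'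
  have ex : ∀ X ⊆ E, Q x X = Q' x' X := fun X => ht.eq_of_eq h (h'.piece x).toIsRk
    (h'.piece y).toIsRk (h''.piece x').toIsRk (h''.piece y').toIsRk hs hs'
    (fun v X hX => by rw [hv v X hX, hv' v X hX]) X
  have hx : Q' x' = Q x := by
    funext X
    rw [(h'.piece x).norm, (h''.piece x').norm]
    exact (ex _ Finset.inter_subset_right).symm
  have hy : Q' y' = Q y := by
    funext X
    rw [(h'.piece y).norm, (h''.piece y').norm]
    have h1 := ex _ (Finset.inter_subset_right : X ∩ E ⊆ E)
    have h2 := hs _ (Finset.inter_subset_right : X ∩ E ⊆ E)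
    have h3 := hs' _ (Finset.inter_subset_right : X ∩ E ⊆ E)
    linarith
  refine ⟨inj hall hne, exists_equiv_of_injective (inj hall hne) (inj hall' hne') (fun s => ?_)
    fun s => ?_⟩
  · rcases hall s with rfl | rfl
    exacts [⟨x', hx⟩, ⟨y', hy⟩]
  · rcases hall' s with rfl | rfl
    exacts [⟨x, hx.symm⟩, ⟨y, hy.symm⟩]

theorem chrom {n : ℕ} {P : Fin n → Finset α → ℤ} {a b c : Fin n} (ht : IsTriangle E P a b c)
    (h : Dec E ρ P) (hc : Conn ρ E) (h2 : ∀ e ∈ E, ρ {e} ≤ 2) :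
    Chrom fun k => ((Delta k E ρ).ncard : ℚ) := by
  obtain rfl : n = 3 := by
    have h1 : (Finset.univ : Finset (Fin n)) = {a, b, c} := by
      ext v
      simpa using ht.all v
    have h2 := congrArg Finset.card h1
    rwa [Finset.card_insert_of_notMem (by simp [ht.hab, ht.hac]), Finset.card_pair ht.hbc,
      Finset.card_univ, Fintype.card_fin] at h2
  have two : ∀ {n : ℕ} {Q : Fin n → Finset α → ℤ}, IsPair E Q → n = 2 :=
    fun ⟨x, y, hxy, hall, _⟩ => eq_two_of_forall hxy hall
  have ov : ∀ {v}, (supp E (P a) ∩ supp E (P v)).Nonempty →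
      ¬ Disjoint (supp E (P a)) (supp E (P v)) := fun hne hd =>
    hne.ne_empty (Finset.disjoint_iff_inter_eq_empty.1 hd)
  have pair : ∀ Q : Fin 2 → Finset α → ℤ, Dec E ρ Q → IsPair E Q := fun Q hQ =>
    (ht.isPair_or_exists_equiv h hQ hc h2).resolve_right fun ⟨e, _⟩ => by
      have := Fintype.card_congr e
      simp at this
  refine chrom_of_three h ht.injective ht.hab ht.hac ht.hbc (ov ht.nonempty_inter)
    (ov ht.swap.nonempty_inter) (fun n Q hQ => ?_) (fun Q hQ => ?_) fun Q hQ => ?_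
  · rcases ht.isPair_or_exists_equiv h hQ hc h2 with hp | ⟨e, _⟩
    · exact Or.inl (two hp)
    · have := Fintype.card_congr e
      right
      simpa using this.symm
  · rcases ht.isPair_or_exists_equiv h hQ hc h2 with hp | ⟨e, he⟩
    · have := two hp
      omega
    · exact ⟨e.symm, fun v => by rw [← he, e.apply_symm_apply]⟩
  · have hp := pair Q hQ
    refine ⟨?_, (ht.exists_equiv_of_isPair h hQ hQ hp hp).1, fun Q' hQ' =>
      (ht.exists_equiv_of_isPair h hQ' hQ (pair Q' hQ') hp).2⟩
    obtain ⟨x, y, -, hall, hx, hy⟩ := hp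
    have hE : ∀ v, supp E (Q v) = E := fun v => by
      rcases hall v with rfl | rfl <;> assumption
    have hne := (hQ.piece 0).ne
    rw [hE] at hne
    rw [hE, hE, disjoint_self]
    exact hne.ne_empty

end IsTriangle

theorem chrom_of_conn (hc : Conn ρ E) (h2 : ∀ e ∈ E, ρ {e} ≤ 2) (hE : E.Nonempty) :
    Chrom fun k => ((Delta k E ρ).ncard : ℚ) := by
  by_cases hA : ∃ n, ∃ P : Fin n → Finset α → ℤ, ∃ a b c, Dec E ρ P ∧ IsTriangle E P a b c
  · obtain ⟨n, P, a, b, c, h, ht⟩ := hA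
    exact ht.chrom h hc h2
  have hK : ∀ {n : ℕ} {P : Fin n → Finset α → ℤ}, Dec E ρ P → ∀ a b c, ¬ IsTriangle E P a b c :=
    fun h a b c ht => hA ⟨_, _, a, b, c, h, ht⟩
  by_cases hB : ∃ n, ∃ P : Fin n → Finset α → ℤ, ∃ v, Dec E ρ P ∧ supp E (P v) = E ∧
      ∀ e ∈ E, ρ {e} = 2
  · obtain ⟨n, P, v, h, hv, htwo⟩ := hB
    refine chrom_of_star hE fun m Q hQ => ?_
    obtain ⟨w, hw⟩ := h.cov_congr hQ hc h2 (hK hQ) hE hv.ge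
    exact ⟨w, { hQ with conn := hc, two := htwo, center := (supp_subset _ _).antisymm hw }⟩
  exact chrom_of_same fun n m P Q hP hQ => hP.ncard_pieceColorings_eq hQ hc h2 (hK hP) (hK hQ)
    (fun v hv h0 => hB ⟨n, P, v, hP, hv, h0⟩) fun v hv h0 => hB ⟨m, Q, v, hQ, hv, h0⟩

theorem chrom_ncard_Delta (hρ : IsPM ρ) (E : Finset α) (h2 : ∀ e ∈ E, ρ {e} ≤ 2) :
    Chrom fun k => ((Delta k E ρ).ncard : ℚ) := by
  induction E using Finset.strongInduction with
  | H E ih =>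
    by_cases h0 : ρ E = 0
    · refine Chrom.of_graph (V := Fin 0) ⊥ 1 fun k _ => ?_
      have h1 : {c : Fin 0 → Fin k | ProperColoring (⊥ : SimpleGraph (Fin 0)) c} = Set.univ :=
        Set.eq_univ_of_forall fun c u => u.elim0
      rw [ncard_Delta_eq_one hρ h0, h1, Set.ncard_univ]
      simp
    by_cases hc : Conn ρ E
    · refine chrom_of_conn hc h2 (Finset.nonempty_iff_ne_empty.2 ?_)
      rintro rfl
      exact h0 hρ.empty
    simp only [Conn, not_forall, not_lt] at hc
    obtain ⟨X, hX, hne, hXE, hsep⟩ := hc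
    have hXs : X ⊂ E := hX.ssubset_of_ne hXE
    have hu : X ∪ (E \ X) = E := Finset.union_sdiff_of_subset hX
    have key := (ih X hXs fun e he => h2 e (hX he)).mul
      (ih (E \ X) (Finset.sdiff_ssubset hX hne) fun e he => h2 e (Finset.sdiff_subset he))
    have h1 : ∀ k, (Delta k E ρ).ncard = (Delta k X ρ).ncard * (Delta k (E \ X) ρ).ncard :=
      fun k => by
        have := ncard_Delta_union Finset.disjoint_sdiff hρ (by rwa [hu]) k
        rwa [hu] at this
    simp only [h1, Nat.cast_mul]
    exact key

theorem Delta_congr {ρ' : Finset α → ℤ} (h : ∀ X ⊆ E, ρ X = ρ' X) (k : ℕ) :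
    Delta k E ρ = Delta k E ρ' := by
  ext M
  rw [mem_Delta, mem_Delta]
  exact and_congr_right fun _ => and_congr_right fun _ =>
    forall₂_congr fun X hX => by rw [h X hX]

end Main

theorem stmt8 [DecidableEq α] (E : Finset α) (ρ : Finset α → ℤ)
    (hρ : IsPolymatroidOn E ρ) (h2 : ∀ e ∈ E, ρ {e} ≤ 2) :
    ∃ (n : ℕ) (G : SimpleGraph (Fin n)) (s : ℚ),
      ∀ k : ℕ, 0 < k →
        ((Delta k E ρ).ncard : ℚ) =
          s * ({c : Fin n → Fin k | ProperColoring G c}.ncard : ℚ) := by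
  have hPM : IsPM fun X => ρ (X ∩ E) :=
    { empty := by simpa using hρ.1
      mono := fun h => hρ.2.1 _ _ (Finset.inter_subset_inter_right h) Finset.inter_subset_right
      submod := fun A B => by
        rw [Finset.union_inter_distrib_right, Finset.inter_inter_distrib_right]
        exact hρ.2.2 _ _ Finset.inter_subset_right Finset.inter_subset_right }
  have key := chrom_ncard_Delta hPM E fun e he => by
    rw [Finset.singleton_inter_of_mem he]
    exact h2 e he
  have h1 := Delta_congr (ρ := ρ) (ρ' := fun X => ρ (X ∩ E)) fun X hX => by
    rw [Finset.inter_eq_left.2 hX]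
  simp only [← h1] at key
  exact key
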